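/- arXiv:1903.08104 — 3 statements merged into one kernel-verified Lean document; each statement's English description precedes it below -/
import Mathlib

section
/- Let X be a holomorphically convex complex analytic space. For every point x ∈ X, the set S_x, defined as the union of all compact connected complex analytic subspaces of X containing x, is compact. -/
/-!
Preliminary definitions.

We model a (reduced) complex analytic space as a Hausdorff topological space
equipped with a sheaf of continuous ℂ-valued functions (its holomorphic
functions) which is locally isomorphic to the canonical model: an analytic
subset `A` of an open set `Ω ⊆ ℂⁿ`, with the sheaf of functions that locally
extend to holomorphic functions of the ambient ℂⁿ.
-/

open Set Topology Filter Function

noncomputable section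

/-- Holomorphic (= ℂ-analytic) functions on a subset of ℂⁿ. -/
def CnHolo {n : ℕ} (U : Set (Fin n → ℂ)) (f : (Fin n → ℂ) → ℂ) : Prop :=
  AnalyticOnNhd ℂ f U

/-- `A` is an analytic subset of the open set `Ω ⊆ ℂⁿ`: locally it is the common
zero set of a family of holomorphic functions. -/
def IsAnalyticInCn {n : ℕ} (Ω A : Set (Fin n → ℂ)) : Prop :=
  A ⊆ Ω ∧ ∀ z ∈ Ω, ∃ V : Set (Fin n → ℂ), IsOpen V ∧ z ∈ V ∧ V ⊆ Ω ∧
    ∃ F : Set ((Fin n → ℂ) → ℂ), (∀ f ∈ F, CnHolo V f) ∧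
      A ∩ V = {w ∈ V | ∀ f ∈ F, f w = 0}

/-- A sheaf of continuous ℂ-valued functions on a topological space `X`:
`Holo U f` reads "`f` is holomorphic on the open set `U`" (only the values of
`f` on `U` matter, by `congr_holo`). -/
structure FunctionSheaf (X : Type) [TopologicalSpace X] where
  Holo : Set X → (X → ℂ) → Prop
  isOpen_of_holo : ∀ {U : Set X} {f : X → ℂ}, Holo U f → IsOpen U
  congr_holo : ∀ {U : Set X} {f g : X → ℂ}, Holo U f → (∀ x ∈ U, f x = g x) → Holo U g
  mono : ∀ {U V : Set X} {f : X → ℂ}, Holo U f → IsOpen V → V ⊆ U → Holo V f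
  glue : ∀ {U : Set X} {f : X → ℂ}, IsOpen U →
    (∀ x ∈ U, ∃ V : Set X, x ∈ V ∧ V ⊆ U ∧ Holo V f) → Holo U f
  continuousOn : ∀ {U : Set X} {f : X → ℂ}, Holo U f → ContinuousOn f U
  const_mem : ∀ {U : Set X}, IsOpen U → ∀ c : ℂ, Holo U (fun _ => c)
  add_mem : ∀ {U : Set X} {f g : X → ℂ}, Holo U f → Holo U g → Holo U (f + g)
  mul_mem : ∀ {U : Set X} {f g : X → ℂ}, Holo U f → Holo U g → Holo U (f * g)
  neg_mem : ∀ {U : Set X} {f : X → ℂ}, Holo U f → Holo U (-f)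

/-- A (reduced) complex analytic space structure on a Hausdorff topological
space `X`: a function sheaf which, near every point, is isomorphic (via a chart
`h`) to the canonical sheaf on an analytic subset `A` of an open set `Ω ⊆ ℂⁿ`. -/
structure CStruct (X : Type) [TopologicalSpace X] : Type where
  O : FunctionSheaf X
  t2 : T2Space X
  locallyModel : ∀ x : X, ∃ (U : Set X) (n : ℕ) (Ω A : Set (Fin n → ℂ))
      (h : X → Fin n → ℂ),
    IsOpen U ∧ x ∈ U ∧ IsOpen Ω ∧ IsAnalyticInCn Ω A ∧
    ContinuousOn h U ∧ Set.InjOn h U ∧ h '' U = A ∧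
    (∀ s : Set X, s ⊆ U → (IsOpen s ↔ ∃ V : Set (Fin n → ℂ), IsOpen V ∧ s = U ∩ h ⁻¹' V)) ∧
    (∀ W : Set X, IsOpen W → W ⊆ U → ∀ f : X → ℂ,
      (O.Holo W f ↔ ∀ y ∈ W, ∃ (V : Set (Fin n → ℂ)) (F : (Fin n → ℂ) → ℂ),
        IsOpen V ∧ h y ∈ V ∧ V ⊆ Ω ∧ CnHolo V F ∧
        ∀ z ∈ U, h z ∈ V → z ∈ W ∧ f z = F (h z)))

namespace CStruct

variable {X Y : Type} [TopologicalSpace X] [TopologicalSpace Y]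

/-- `f` is holomorphic on the (arbitrary) subset `A ⊆ X`: near every point of
`A`, `f` agrees on `A` with a holomorphic function.  For open `A` this is
equivalent to `S.O.Holo A f`. -/
def HoloOn (S : CStruct X) (A : Set X) (f : X → ℂ) : Prop :=
  ∀ x ∈ A, ∃ (W : Set X) (F : X → ℂ), IsOpen W ∧ x ∈ W ∧ S.O.Holo W F ∧
    ∀ y ∈ W ∩ A, f y = F y

/-- The holomorphically convex hull of `K` in the domain `A`, taken with respect
to the functions holomorphic on `A`. -/
def hullIn (S : CStruct X) (A K : Set X) : Set X :=
  {x ∈ A | ∀ f : X → ℂ, S.HoloOn A f → ‖f x‖ ≤ sSup ((fun y => ‖f y‖) '' K)}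

/-- The domain `A ⊆ X` is holomorphically convex: hulls of compact subsets of
`A` are compact. -/
def HolConvexOn (S : CStruct X) (A : Set X) : Prop :=
  ∀ K : Set X, K ⊆ A → IsCompact K → IsCompact (S.hullIn A K)

/-- `X` is a holomorphically convex complex space. -/
def HolConvex (S : CStruct X) : Prop := S.HolConvexOn Set.univ

/-- The functions holomorphic on the domain `A` separate the points of `A`. -/
def SeparatesOn (S : CStruct X) (A : Set X) : Prop :=
  ∀ x ∈ A, ∀ y ∈ A, x ≠ y → ∃ f : X → ℂ, S.HoloOn A f ∧ f x ≠ f y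

/-- A Stein space: holomorphically convex, and global holomorphic functions
separate points. -/
def Stein (S : CStruct X) : Prop := S.HolConvex ∧ S.SeparatesOn Set.univ

/-- `φ` is a holomorphic map on the domain `A ⊆ X`, with values in the complex
space `Y`: it is continuous and pulls holomorphic functions back to holomorphic
functions. -/
def IsHoloMapOn (S : CStruct X) (T : CStruct Y) (A : Set X) (φ : X → Y) : Prop :=
  ContinuousOn φ A ∧ ∀ (U : Set Y) (g : Y → ℂ), IsOpen U → T.O.Holo U g →
    S.HoloOn (A ∩ φ ⁻¹' U) (g ∘ φ)

/-- A holomorphic map `X → Y`. -/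
def IsHoloMap (S : CStruct X) (T : CStruct Y) (φ : X → Y) : Prop :=
  S.IsHoloMapOn T Set.univ φ

/-- `φ` is proper on the domain `A ⊆ X`: preimages (within `A`) of compact sets
are compact. -/
def IsProperOn (A : Set X) (φ : X → Y) : Prop :=
  ∀ K : Set Y, IsCompact K → IsCompact (A ∩ φ ⁻¹' K)

/-- The canonical morphism `O_Y → φ_* O_{A}` is an isomorphism of sheaves of
rings: for every open `U ⊆ Y`, pulling back along `φ` is a bijection from
`O_Y(U)` onto the holomorphic functions on `A ∩ φ⁻¹(U)`.  (For `A = univ` this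
says `φ_* O_X ≅ O_Y`.) -/
def DirectImageEqOn (S : CStruct X) (T : CStruct Y) (A : Set X) (φ : X → Y) : Prop :=
  ∀ U : Set Y, IsOpen U →
    (∀ g₁ g₂ : Y → ℂ, T.O.Holo U g₁ → T.O.Holo U g₂ →
      (∀ x ∈ A ∩ φ ⁻¹' U, g₁ (φ x) = g₂ (φ x)) → ∀ y ∈ U, g₁ y = g₂ y) ∧
    (∀ f : X → ℂ, S.HoloOn (A ∩ φ ⁻¹' U) f →
      ∃ g : Y → ℂ, T.O.Holo U g ∧ ∀ x ∈ A ∩ φ ⁻¹' U, f x = g (φ x))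

/-- `φ_* O_X ≅ O_Y` (as sheaves of rings, via the canonical morphism). -/
def DirectImageEq (S : CStruct X) (T : CStruct Y) (φ : X → Y) : Prop :=
  S.DirectImageEqOn T Set.univ φ

/-- `(φ, Y)` is a Remmert reduction of the domain `A ⊆ X`: `Y` is Stein and `φ`
is a proper holomorphic map with `φ_* O_A ≅ O_Y`. -/
def IsRemmertReductionOn (S : CStruct X) (T : CStruct Y) (A : Set X) (φ : X → Y) : Prop :=
  T.Stein ∧ S.IsHoloMapOn T A φ ∧ IsProperOn A φ ∧ S.DirectImageEqOn T A φ

/-- `(φ, Y)` is a Remmert reduction of `X`. -/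
def IsRemmertReduction (S : CStruct X) (T : CStruct Y) (φ : X → Y) : Prop :=
  S.IsRemmertReductionOn T Set.univ φ

/-- `A` is a (closed) complex analytic subset of `X`: locally it is the common
zero set of a family of holomorphic functions. -/
def IsAnalyticSubset (S : CStruct X) (A : Set X) : Prop :=
  ∀ x : X, ∃ U : Set X, IsOpen U ∧ x ∈ U ∧ ∃ F : Set (X → ℂ),
    (∀ f ∈ F, S.O.Holo U f) ∧ A ∩ U = {y ∈ U | ∀ f ∈ F, f y = 0}

/-- `Sx S x`: the union of all compact connected complex analytic subsets of `X`
containing `x`. -/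
def Sx (S : CStruct X) (x : X) : Set X :=
  ⋃₀ {A : Set X | S.IsAnalyticSubset A ∧ IsCompact A ∧ IsConnected A ∧ x ∈ A}

/-- The relation `R`: `x R x'` iff `S_x ∩ S_{x'} ≠ ∅`. -/
def Rrel (S : CStruct X) (x x' : X) : Prop := (S.Sx x ∩ S.Sx x').Nonempty

/-- `B` is a Runge subdomain of `A` (`B ⊆ A`): every function holomorphic on `B`
can be approximated, uniformly on every compact subset of `B`, by functions
holomorphic on `A`. -/
def RungeIn (S : CStruct X) (B A : Set X) : Prop :=
  ∀ f : X → ℂ, S.HoloOn B f → ∀ K : Set X, IsCompact K → K ⊆ B → ∀ ε : ℝ, 0 < ε →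
    ∃ g : X → ℂ, S.HoloOn A g ∧ ∀ x ∈ K, ‖f x - g x‖ < ε

end CStruct

namespace LocalAnalytic

variable {E : Type*} [NormedAddCommGroup E] [NormedSpace ℂ E]
variable {E' : Type*} [NormedAddCommGroup E'] [NormedSpace ℂ E']

/-- `f` is holomorphic near `a`: continuous, and complex differentiable along every complex line. -/
def HolAt (f : E → ℂ) (a : E) : Prop :=
  ∀ᶠ y in 𝓝 a, ContinuousAt f y ∧ ∀ v : E, DifferentiableAt ℂ (fun t : ℂ => f (y + t • v)) 0

namespace HolAt

variable {f g : E → ℂ} {a : E}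

lemma eventually (h : HolAt f a) : ∀ᶠ y in 𝓝 a, HolAt f y := eventually_eventually_nhds.2 h

lemma continuousAt (h : HolAt f a) : ContinuousAt f a := h.self_of_nhds.1

lemma congr (h : HolAt f a) (hfg : f =ᶠ[𝓝 a] g) : HolAt g a := by
  filter_upwards [h, hfg.eventually_nhds] with y hy hfgy
  refine ⟨hy.1.congr hfgy, fun v => (hy.2 v).congr_of_eventuallyEq ?_⟩
  have ht : Tendsto (fun t : ℂ => y + t • v) (𝓝 0) (𝓝 y) := by
    have : Continuous (fun t : ℂ => y + t • v) := by fun_prop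
    simpa using this.tendsto 0
  exact (ht.eventually hfgy).mono fun t ht => ht.symm

lemma const (c : ℂ) (a : E) : HolAt (fun _ => c) a :=
  Eventually.of_forall fun _ => ⟨continuousAt_const, fun _ => differentiableAt_const _⟩

lemma add (hf : HolAt f a) (hg : HolAt g a) : HolAt (fun y => f y + g y) a := by
  filter_upwards [hf, hg] with y h₁ h₂
  exact ⟨h₁.1.add h₂.1, fun v => (h₁.2 v).add (h₂.2 v)⟩

lemma mul (hf : HolAt f a) (hg : HolAt g a) : HolAt (fun y => f y * g y) a := by
  filter_upwards [hf, hg] with y h₁ h₂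
  exact ⟨h₁.1.mul h₂.1, fun v => (h₁.2 v).mul (h₂.2 v)⟩

lemma pow (hf : HolAt f a) (n : ℕ) : HolAt (fun y => f y ^ n) a := by
  filter_upwards [hf] with y h₁
  exact ⟨h₁.1.pow n, fun v => (h₁.2 v).pow n⟩

lemma inv (hf : HolAt f a) (h0 : f a ≠ 0) : HolAt (fun y => (f y)⁻¹) a := by
  filter_upwards [hf, hf.continuousAt.eventually_ne h0] with y h₁ h₂
  exact ⟨h₁.1.inv₀ h₂, fun v => (h₁.2 v).inv (by simpa using h₂)⟩

lemma finset_sum {ι : Type*} {s : Finset ι} {F : ι → E → ℂ} (h : ∀ i ∈ s, HolAt (F i) a) :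
    HolAt (fun y => ∑ i ∈ s, F i y) a := by
  classical
  induction s using Finset.induction_on with
  | empty => simpa using const 0 a
  | insert i s hi ih =>
    simp only [Finset.sum_insert hi]
    exact (h i (by simp)).add (ih fun j hj => h j (by simp [hj]))

lemma finset_prod {ι : Type*} {s : Finset ι} {F : ι → E → ℂ} (h : ∀ i ∈ s, HolAt (F i) a) :
    HolAt (fun y => ∏ i ∈ s, F i y) a := by
  classical
  induction s using Finset.induction_on with
  | empty => simpa using const 1 a
  | insert i s hi ih =>
    simp only [Finset.prod_insert hi]
    exact (h i (by simp)).mul (ih fun j hj => h j (by simp [hj]))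

lemma comp_affine {g : E' → ℂ} (L : E →L[ℂ] E') (c : E') (h : HolAt g (c + L a)) :
    HolAt (fun y => g (c + L y)) a := by
  have hc : Continuous (fun y => c + L y) := by fun_prop
  filter_upwards [hc.continuousAt.eventually h] with y hy
  refine ⟨ContinuousAt.comp (f := fun y => c + L y) hy.1 hc.continuousAt, fun v => ?_⟩
  simpa [add_assoc] using hy.2 (L v)

lemma comp_linear {g : E' → ℂ} (L : E →L[ℂ] E') (h : HolAt g (L a)) :
    HolAt (fun y => g (L y)) a := by
  simpa using comp_affine L 0 (by simpa using h)

lemma of_analyticAt (h : AnalyticAt ℂ f a) : HolAt f a := by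
  filter_upwards [h.eventually_analyticAt] with y hy
  refine ⟨hy.continuousAt, fun v => ?_⟩
  have : DifferentiableAt ℂ f (y + (0 : ℂ) • v) := by simpa using hy.differentiableAt
  exact DifferentiableAt.comp (f := fun t : ℂ => y + t • v) 0 this (by fun_prop)

lemma of_clm (L : E →L[ℂ] ℂ) (a : E) : HolAt (fun y => L y) a :=
  of_analyticAt (L.analyticAt a)

lemma analyticAt {f : ℂ → ℂ} {a : ℂ} (h : HolAt f a) : AnalyticAt ℂ f a := by
  rw [Complex.analyticAt_iff_eventually_differentiableAt]
  filter_upwards [h] with y hy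
  have h1 := hy.2 1
  have h2 : DifferentiableAt ℂ (fun t : ℂ => f (y + t • 1)) (y - y) := by simpa using h1
  have := DifferentiableAt.comp (f := fun t : ℂ => t - y) y h2 (by fun_prop)
  refine this.congr_of_eventuallyEq (Eventually.of_forall fun t => ?_)
  simp

lemma analyticAt_line {t : ℂ} {v : E} (h : HolAt f (a + t • v)) :
    AnalyticAt ℂ (fun s : ℂ => f (a + s • v)) t :=
  (comp_affine (ContinuousLinearMap.toSpanSingleton ℂ v) a (a := t) (by simpa using h)).analyticAt

lemma analyticAt_snd {g : E × ℂ → ℂ} {z : E} {w : ℂ} (h : HolAt g (z, w)) :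
    AnalyticAt ℂ (fun ζ => g (z, ζ)) w := by
  have := (comp_affine (g := g) (ContinuousLinearMap.inr ℂ E ℂ) (z, 0) (a := w)
    (by simpa using h)).analyticAt
  simpa using this

end HolAt

lemma eventually_forall_holAt {f : E × ℂ → ℂ} {z : E} {K : Set ℂ} (hK : IsCompact K)
    (h : ∀ w ∈ K, HolAt f (z, w)) : ∀ᶠ y in 𝓝 z, ∀ w ∈ K, HolAt f (y, w) := by
  refine hK.eventually_forall_of_forall_eventually fun w hw => ?_
  exact (h w hw).eventually

lemma eventually_bound {f : E × ℂ → ℂ} {z : E} {K : Set ℂ} (hK : IsCompact K)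
    (h : ∀ w ∈ K, HolAt f (z, w)) : ∃ C : ℝ, ∀ᶠ y in 𝓝 z, ∀ w ∈ K, ‖f (y, w)‖ ≤ C := by
  have hc : ContinuousOn (fun w => f (z, w)) K := fun w hw =>
    ((h w hw).continuousAt.comp (f := fun w => (z, w)) (by fun_prop)).continuousWithinAt
  obtain ⟨C, hC⟩ := hK.exists_bound_of_continuousOn hc
  refine ⟨C + 1, hK.eventually_forall_of_forall_eventually fun w hw => ?_⟩
  have h1 := (h w hw).continuousAt.norm
  have h2 : ‖f (z, w)‖ < C + 1 := by linarith [hC w hw]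
  exact (h1.eventually (gt_mem_nhds h2)).mono fun p hp => le_of_lt hp

lemma continuous_circleMap_comp {f : E × ℂ → ℂ} {z : E} {b : ℂ} {ε : ℝ} (hε : 0 ≤ ε)
    (h : ∀ w ∈ Metric.sphere b ε, HolAt f (z, w)) :
    Continuous fun θ : ℝ => deriv (circleMap b ε) θ • f (z, circleMap b ε θ) := by
  simp only [smul_eq_mul]
  refine Continuous.mul ?_ ?_
  · rw [show deriv (circleMap b ε) = fun θ => circleMap 0 ε θ * Complex.I from
      funext (deriv_circleMap b ε)]
    fun_prop
  · rw [continuous_iff_continuousAt]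
    intro θ
    exact (h _ (circleMap_mem_sphere b hε θ)).continuousAt.comp
      (f := fun θ => (z, circleMap b ε θ)) (by fun_prop)

lemma norm_deriv_circleMap_smul_le {α : Type*} {f : α × ℂ → ℂ} {z : α} {b : ℂ} {ε C : ℝ} (hε : 0 ≤ ε)
    (h : ∀ w ∈ Metric.sphere b ε, ‖f (z, w)‖ ≤ C) (θ : ℝ) :
    ‖deriv (circleMap b ε) θ • f (z, circleMap b ε θ)‖ ≤ ε * C := by
  rw [norm_smul]
  have : ‖deriv (circleMap b ε) θ‖ = ε := by simp [deriv_circleMap, abs_of_nonneg hε]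
  rw [this]
  exact mul_le_mul_of_nonneg_left (h _ (circleMap_mem_sphere b hε θ)) hε

lemma continuousAt_circleIntegral {f : E × ℂ → ℂ} {z : E} {b : ℂ} {ε : ℝ} (hε : 0 ≤ ε)
    (h : ∀ w ∈ Metric.sphere b ε, HolAt f (z, w)) :
    ContinuousAt (fun y => ∮ w in C(b, ε), f (y, w)) z := by
  have hK := isCompact_sphere b ε
  obtain ⟨C, hC⟩ := eventually_bound hK h
  refine intervalIntegral.continuousAt_of_dominated_interval (bound := fun _ => ε * C) ?_ ?_
    intervalIntegrable_const ?_
  · filter_upwards [eventually_forall_holAt hK h] with y hy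
    exact (continuous_circleMap_comp hε hy).aestronglyMeasurable
  · filter_upwards [hC] with y hy
    exact Eventually.of_forall fun θ _ => norm_deriv_circleMap_smul_le hε hy θ
  · refine Eventually.of_forall fun θ _ => ?_
    simp only [smul_eq_mul]
    exact continuousAt_const.mul ((h _ (circleMap_mem_sphere b hε θ)).continuousAt.comp
      (f := fun y => (y, circleMap b ε θ)) (by fun_prop))

lemma differentiableAt_circleIntegral {f : ℂ × ℂ → ℂ} {z b : ℂ} {ε : ℝ} (hε : 0 ≤ ε)
    (h : ∀ w ∈ Metric.sphere b ε, HolAt f (z, w)) :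
    DifferentiableAt ℂ (fun y => ∮ w in C(b, ε), f (y, w)) z := by
  have hK := isCompact_sphere b ε
  obtain ⟨C, hC⟩ := eventually_bound hK h
  obtain ⟨δ, hδ, hball⟩ := Metric.eventually_nhds_iff_ball.1
    (hC.and (eventually_forall_holAt hK h))
  have hdiff : ∀ y ∈ Metric.ball z δ, ∀ w ∈ Metric.sphere b ε,
      DifferentiableAt ℂ (fun y => f (y, w)) y := by
    intro y hy w hw
    have := HolAt.comp_affine (g := f) (ContinuousLinearMap.inl ℂ ℂ ℂ) (0, w) (a := y)
      (by simpa using (hball y hy).2 w hw)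
    simpa using this.analyticAt.differentiableAt
  have hsub : ∀ y ∈ Metric.ball z (δ / 2), Metric.closedBall y (δ / 3) ⊆ Metric.ball z δ := by
    intro y hy
    refine Metric.closedBall_subset_ball' ?_
    have := Metric.mem_ball.1 hy
    linarith
  have hder : ∀ y ∈ Metric.ball z (δ / 2), ∀ w ∈ Metric.sphere b ε,
      ‖deriv (fun y => f (y, w)) y‖ ≤ C / (δ / 3) := by
    intro y hy w hw
    refine Complex.norm_deriv_le_of_forall_mem_sphere_norm_le (by positivity) ?_ ?_
    · refine DifferentiableOn.diffContOnCl fun x hx => ?_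
      rw [closure_ball _ (by positivity)] at hx
      exact (hdiff x (hsub y hy hx) w hw).differentiableWithinAt
    · intro x hx
      exact (hball x (hsub y hy (Metric.sphere_subset_closedBall hx))).1 w hw
  have hzmem : z ∈ Metric.ball z δ := Metric.mem_ball_self hδ
  have hhalf : Metric.ball z (δ / 2) ⊆ Metric.ball z δ := Metric.ball_subset_ball (by linarith)
  have hdF : ∀ θ : ℝ, ∀ y ∈ Metric.ball z (δ / 2),
      HasDerivAt (fun y => deriv (circleMap b ε) θ • f (y, circleMap b ε θ))
        (deriv (circleMap b ε) θ • deriv (fun y => f (y, circleMap b ε θ)) y) y :=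
    fun θ y hy =>
      ((hdiff y (hhalf hy) _ (circleMap_mem_sphere b hε θ)).hasDerivAt).const_mul _
  refine (intervalIntegral.hasDerivAt_integral_of_dominated_loc_of_deriv_le
    (s := Metric.ball z (δ / 2)) (bound := fun _ => ε * (C / (δ / 3)))
    (F := fun y θ => deriv (circleMap b ε) θ • f (y, circleMap b ε θ))
    (F' := fun y θ => deriv (circleMap b ε) θ • deriv (fun y => f (y, circleMap b ε θ)) y)
    (Metric.ball_mem_nhds z (by positivity)) ?_ ?_ ?_ ?_ intervalIntegrable_const ?_
    ).2.differentiableAt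
  · filter_upwards [Metric.ball_mem_nhds z hδ] with y hy
    exact (continuous_circleMap_comp hε (hball y hy).2).aestronglyMeasurable
  · exact (continuous_circleMap_comp hε h).intervalIntegrable _ _
  · have hseq : Tendsto (fun n : ℕ => ((δ / 2 / (n + 2) : ℝ) : ℂ)) atTop (𝓝[≠] 0) := by
      rw [tendsto_nhdsWithin_iff]
      constructor
      · have h1 : Tendsto (fun n : ℕ => δ / 2 / ((n : ℝ) + 2)) atTop (𝓝 0) :=
          Tendsto.div_atTop tendsto_const_nhds
            (tendsto_atTop_add_const_right _ _ tendsto_natCast_atTop_atTop)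
        exact_mod_cast (Complex.continuous_ofReal.tendsto 0).comp h1
      · refine Eventually.of_forall fun n => ?_
        simp only [mem_compl_iff, mem_singleton_iff, Complex.ofReal_eq_zero]
        positivity
    refine aestronglyMeasurable_of_tendsto_ae atTop
      (f := fun (n : ℕ) θ => (((δ / 2 / (n + 2) : ℝ) : ℂ))⁻¹ •
        (deriv (circleMap b ε) θ • f (z + ((δ / 2 / (n + 2) : ℝ) : ℂ), circleMap b ε θ)
          - deriv (circleMap b ε) θ • f (z, circleMap b ε θ))) ?_ ?_
    · intro n
      have hn : z + ((δ / 2 / (n + 2) : ℝ) : ℂ) ∈ Metric.ball z δ := by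
        rw [mem_ball_iff_norm, add_sub_cancel_left, Complex.norm_real, Real.norm_of_nonneg
          (by positivity)]
        have : δ / 2 / ((n : ℝ) + 2) ≤ δ / 2 := div_le_self (by positivity) (by
          have : (0 : ℝ) ≤ n := Nat.cast_nonneg n
          linarith)
        linarith
      exact (continuous_const.mul ((continuous_circleMap_comp hε (hball _ hn).2).sub
        (continuous_circleMap_comp hε h))).aestronglyMeasurable
    · refine Eventually.of_forall fun θ => ?_
      exact (hasDerivAt_iff_tendsto_slope_zero.1
        (hdF θ z (Metric.mem_ball_self (by positivity)))).comp hseq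
  · refine Eventually.of_forall fun θ _ y hy => ?_
    rw [norm_smul]
    have : ‖deriv (circleMap b ε) θ‖ = ε := by simp [deriv_circleMap, abs_of_nonneg hε]
    rw [this]
    exact mul_le_mul_of_nonneg_left (hder y hy _ (circleMap_mem_sphere b hε θ)) hε
  · exact Eventually.of_forall fun θ _ y hy => hdF θ y hy

lemma HolAt.circleIntegral {f : E × ℂ → ℂ} {z : E} {b : ℂ} {ε : ℝ} (hε : 0 ≤ ε)
    (h : ∀ w ∈ Metric.sphere b ε, HolAt f (z, w)) :
    HolAt (fun y => ∮ w in C(b, ε), f (y, w)) z := by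
  filter_upwards [eventually_forall_holAt (isCompact_sphere b ε) h] with y hy
  refine ⟨continuousAt_circleIntegral hε hy, fun v => ?_⟩
  let L : ℂ × ℂ →L[ℂ] E × ℂ :=
    ((ContinuousLinearMap.toSpanSingleton ℂ v).comp (ContinuousLinearMap.fst ℂ ℂ ℂ)).prod
      (ContinuousLinearMap.snd ℂ ℂ ℂ)
  have hL : ∀ p : ℂ × ℂ, (y, (0 : ℂ)) + L p = (y + p.1 • v, p.2) := fun p => by simp [L]
  have := differentiableAt_circleIntegral (f := fun p => f ((y, 0) + L p)) (z := 0) hε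
    fun w hw => HolAt.comp_affine L (y, 0) (by simpa [hL] using hy w hw)
  simpa only [hL] using this

lemma HolAt.deriv_snd {g : E × ℂ → ℂ} {z : E} {w : ℂ} (h : HolAt g (z, w)) :
    HolAt (fun p : E × ℂ => deriv (fun ζ => g (p.1, ζ)) p.2) (z, w) := by
  obtain ⟨δ, hδ, hball⟩ := Metric.eventually_nhds_iff_ball.1 h.eventually
  have hmem : ∀ y ∈ Metric.ball z δ, ∀ ζ ∈ Metric.closedBall w (δ / 2), HolAt g (y, ζ) := by
    intro y hy ζ hζ
    refine hball (y, ζ) ?_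
    rw [Metric.mem_ball, Prod.dist_eq]
    exact max_lt hy (lt_of_le_of_lt hζ (by linarith))
  have hcauchy : HolAt (fun p : E × ℂ => (2 * Real.pi * Complex.I : ℂ)⁻¹ *
      ∮ ζ in C(w, δ / 2), (g (p.1, ζ) * ((ζ - p.2) ^ 2)⁻¹)) (z, w) := by
    refine (HolAt.const _ _).mul (HolAt.circleIntegral
      (f := fun q : (E × ℂ) × ℂ => g (q.1.1, q.2) * ((q.2 - q.1.2) ^ 2)⁻¹) (by positivity) ?_)
    intro ζ hζ
    refine HolAt.mul ?_ (HolAt.inv (HolAt.pow ?_ 2) ?_)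
    · let L : (E × ℂ) × ℂ →L[ℂ] E × ℂ :=
        ((ContinuousLinearMap.fst ℂ E ℂ).comp (ContinuousLinearMap.fst ℂ (E × ℂ) ℂ)).prod
          (ContinuousLinearMap.snd ℂ (E × ℂ) ℂ)
      exact HolAt.comp_linear L (a := ((z, w), ζ))
        (hmem z (Metric.mem_ball_self hδ) ζ (Metric.sphere_subset_closedBall hζ))
    · let L : (E × ℂ) × ℂ →L[ℂ] ℂ := ContinuousLinearMap.snd ℂ (E × ℂ) ℂ -
        (ContinuousLinearMap.snd ℂ E ℂ).comp (ContinuousLinearMap.fst ℂ (E × ℂ) ℂ)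
      exact HolAt.of_clm L _
    · have : ‖ζ - w‖ = δ / 2 := by simpa [dist_eq_norm] using hζ
      have h0 : ζ - w ≠ 0 := by
        rw [← norm_pos_iff, this]; positivity
      exact pow_ne_zero 2 h0
  refine hcauchy.congr ?_
  have hnear : ∀ᶠ p : E × ℂ in 𝓝 (z, w), p.1 ∈ Metric.ball z δ ∧ p.2 ∈ Metric.ball w (δ / 2) :=
    prod_mem_nhds (Metric.ball_mem_nhds z hδ) (Metric.ball_mem_nhds w (by positivity))
  filter_upwards [hnear] with p hp
  have hU : IsOpen (Metric.ball w δ) := Metric.isOpen_ball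
  have key := Complex.two_pi_I_inv_smul_circleIntegral_sub_sq_inv_smul_of_differentiable
    (U := Metric.ball w δ) (c := w) (R := δ / 2) (w₀ := p.2) (f := fun ζ => g (p.1, ζ)) hU
    (Metric.closedBall_subset_ball (by linarith)) ?_ hp.2
  · rw [← key, smul_eq_mul]
    congr 2
    ext ζ
    simp [mul_comm]
  · intro ζ hζ
    refine (HolAt.analyticAt_snd (hball (p.1, ζ) ?_)).differentiableAt.differentiableWithinAt
    rw [Metric.mem_ball, Prod.dist_eq]
    exact max_lt hp.1 hζ

end LocalAnalytic

namespace LocalAnalytic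

/-- `ρ` lists the zeros of `φ` in the disc of radius `r`, with multiplicity. -/
def IsRootList (φ : ℂ → ℂ) (r : ℝ) {d : ℕ} (ρ : Fin d → ℂ) : Prop :=
  (∀ i, ρ i ∈ Metric.ball (0 : ℂ) r) ∧ ∃ u : ℂ → ℂ,
    AnalyticOnNhd ℂ u (Metric.closedBall 0 r) ∧ (∀ w ∈ Metric.closedBall (0 : ℂ) r, u w ≠ 0) ∧
    ∀ w, φ w = (∏ i, (w - ρ i)) * u w

lemma exists_multiset_factorization {K : Set ℂ} (T : Finset ℂ) : ∀ (φ : ℂ → ℂ),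
    AnalyticOnNhd ℂ φ K → (∀ a ∈ T, a ∈ K ∧ ¬ ∀ᶠ w in 𝓝 a, φ w = 0) →
    (∀ w ∈ K, φ w = 0 → w ∈ T) →
    ∃ (M : Multiset ℂ) (u : ℂ → ℂ), (∀ a ∈ M, a ∈ T) ∧ AnalyticOnNhd ℂ u K ∧
      (∀ w ∈ K, u w ≠ 0) ∧ ∀ w, φ w = (M.map fun a => w - a).prod * u w := by
  classical
  induction T using Finset.induction_on with
  | empty =>
    intro φ hφ _ h0
    exact ⟨0, φ, by simp, hφ, fun w hw h => by simpa using h0 w hw h, by simp⟩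
  | insert a T haT ih =>
    intro φ hφ hT h0
    obtain ⟨haK, hane⟩ := hT a (by simp)
    obtain ⟨k, ψ, hψ, hψ0, hev⟩ := (hφ a haK).exists_eventuallyEq_pow_smul_nonzero_iff.2 hane
    let v : ℂ → ℂ := fun w => if w = a then ψ a else φ w / (w - a) ^ k
    have hva : v =ᶠ[𝓝 a] ψ := by
      filter_upwards [hev] with w hw
      by_cases h : w = a
      · simp [v, h]
      · have : (w - a) ^ k ≠ 0 := pow_ne_zero _ (sub_ne_zero.2 h)
        simp only [v, h, if_false, hw, smul_eq_mul]
        field_simp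
    have hvne : ∀ b, b ≠ a → v =ᶠ[𝓝 b] fun w => φ w / (w - a) ^ k := by
      intro b hb
      filter_upwards [isOpen_ne.mem_nhds hb] with w hw
      simp only [v, if_neg hw]
    have hva' : v a ≠ 0 := by simpa [v] using hψ0
    have hφv : ∀ w, φ w = (w - a) ^ k * v w := by
      intro w
      by_cases h : w = a
      · subst h
        simpa [v] using hev.self_of_nhds
      · have : (w - a) ^ k ≠ 0 := pow_ne_zero _ (sub_ne_zero.2 h)
        simp only [v, h, if_false]
        field_simp
    have hMu := ih v ?_ ?_ ?_
    · obtain ⟨M, u, hM, hu, hu0, hfac⟩ := hMu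
      refine ⟨Multiset.replicate k a + M, u, ?_, hu, hu0, ?_⟩
      · intro b hb
        rcases Multiset.mem_add.1 hb with hb | hb
        · simp [Multiset.eq_of_mem_replicate hb]
        · exact Finset.mem_insert_of_mem (hM b hb)
      · intro w
        rw [hφv w, hfac w]
        simp [mul_assoc]
    · intro b hb
      by_cases h : b = a
      · subst h
        exact hψ.congr hva.symm
      · refine AnalyticAt.congr ?_ (hvne b h).symm
        exact (hφ b hb).div (by fun_prop) (pow_ne_zero _ (sub_ne_zero.2 h))
    · intro b hb
      have hba : b ≠ a := fun h => haT (h ▸ hb)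
      refine ⟨(hT b (by simp [hb])).1, fun hv => (hT b (by simp [hb])).2 ?_⟩
      filter_upwards [hv, hvne b hba, isOpen_ne.mem_nhds hba] with w h1 h2 h3
      rw [h2] at h1
      exact (div_eq_zero_iff.1 h1).resolve_right (pow_ne_zero _ (sub_ne_zero.2 h3))
    · intro w hw hvw
      have : w ∈ insert a T := h0 w hw (by rw [hφv w, hvw, mul_zero])
      refine (Finset.mem_insert.1 this).resolve_left ?_
      rintro rfl
      exact hva' hvw

/-- A holomorphic function without zeros on the boundary circle has a list of roots. -/
lemma exists_isRootList {φ : ℂ → ℂ} {r : ℝ} (hr : 0 < r)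
    (hφ : AnalyticOnNhd ℂ φ (Metric.closedBall 0 r))
    (h0 : ∀ w ∈ Metric.sphere (0 : ℂ) r, φ w ≠ 0) :
    ∃ (d : ℕ) (ρ : Fin d → ℂ), IsRootList φ r ρ := by
  have hne : ∀ a ∈ Metric.closedBall (0 : ℂ) r, ¬ ∃ᶠ w in 𝓝[≠] a, φ w = 0 := by
    intro a ha h
    have := hφ.eqOn_zero_of_preconnected_of_frequently_eq_zero
      (convex_closedBall _ _).isPreconnected ha h
    have hrs : (r : ℂ) ∈ Metric.sphere (0 : ℂ) r := by simp [abs_of_pos hr]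
    exact h0 r hrs (this (Metric.sphere_subset_closedBall hrs))
  have hfin : {w ∈ Metric.closedBall (0 : ℂ) r | φ w = 0}.Finite := by
    by_contra hinf
    obtain ⟨a, ha, hacc⟩ := Set.Infinite.exists_accPt_of_subset_isCompact hinf
      (isCompact_closedBall (0 : ℂ) r) (fun w hw => hw.1)
    refine hne a ha ?_
    rw [accPt_iff_frequently] at hacc
    rw [frequently_nhdsWithin_iff]
    exact hacc.mono fun y hy => ⟨hy.2.2, hy.1⟩
  have hMu := exists_multiset_factorization hfin.toFinset φ hφ
    (fun a ha => ?_) (fun w hw h => by simpa using ⟨by simpa using hw, h⟩)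
  · obtain ⟨M, u, hM, hu, hu0, hfac⟩ := hMu
    refine ⟨M.toList.length, M.toList.get, fun i => ?_, u, hu, hu0, fun w => ?_⟩
    · have h1 : M.toList.get i ∈ M := by
        rw [← Multiset.mem_toList]
        exact List.get_mem _ _
      have h2 := hM _ h1
      rw [Set.Finite.mem_toFinset] at h2
      rw [Metric.mem_ball]
      refine lt_of_le_of_ne (Metric.mem_closedBall.1 h2.1) fun h => h0 _ (Metric.mem_sphere.2 h) h2.2
    · rw [hfac w]
      congr 1
      conv_lhs => rw [← Multiset.coe_toList M]
      rw [Multiset.map_coe, Multiset.prod_coe, ← List.prod_ofFn]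
      congr 1
      apply List.ext_get <;> simp
  · rw [Set.Finite.mem_toFinset] at ha
    exact ⟨ha.1, fun h => hne a ha.1 (h.filter_mono nhdsWithin_le_nhds).frequently⟩

lemma IsRootList.eq_zero_iff {φ : ℂ → ℂ} {r : ℝ} {d : ℕ} {ρ : Fin d → ℂ} (h : IsRootList φ r ρ)
    {w : ℂ} (hw : w ∈ Metric.closedBall (0 : ℂ) r) : φ w = 0 ↔ ∃ i, ρ i = w := by
  obtain ⟨-, u, -, hu0, hfac⟩ := h
  rw [hfac w, mul_eq_zero, or_iff_left (hu0 w hw), Finset.prod_eq_zero_iff]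
  simp only [Finset.mem_univ, true_and, sub_eq_zero, eq_comm]

open scoped Classical in
/-- The generalized argument principle. -/
lemma IsRootList.circleIntegral_logDeriv {φ : ℂ → ℂ} {r : ℝ} {d : ℕ} {ρ : Fin d → ℂ}
    (h : IsRootList φ r ρ) {b : ℂ} {ε : ℝ} (hε : 0 < ε)
    (hsub : Metric.closedBall b ε ⊆ Metric.closedBall 0 r) (hρ : ∀ i, ρ i ∉ Metric.sphere b ε)
    {F : ℂ → ℂ} (hF : AnalyticOnNhd ℂ F (Metric.closedBall b ε)) :
    (∮ w in C(b, ε), F w * (deriv φ w / φ w)) =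
      2 * Real.pi * Complex.I * ∑ i with ρ i ∈ Metric.ball b ε, F (ρ i) := by
  obtain ⟨hρr, u, hu, hu0, hfac⟩ := h
  have hne : ∀ w ∈ Metric.sphere b ε, ∀ i, w - ρ i ≠ 0 := fun w hw i h =>
    hρ i (by rwa [← sub_eq_zero.1 h])
  have hlog : ∀ w ∈ Metric.sphere b ε, F w * (deriv φ w / φ w) =
      (∑ i, (w - ρ i)⁻¹ • F w) + F w * (deriv u w / u w) := by
    intro w hw
    have hwc := Metric.sphere_subset_closedBall hw
    have h1 : deriv φ w / φ w = logDeriv (fun w => (∏ i, (w - ρ i)) * u w) w := by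
      rw [← logDeriv_apply, funext hfac]
    rw [h1, logDeriv_mul w (Finset.prod_ne_zero_iff.2 fun i _ => hne w hw i) (hu0 w (hsub hwc))
      (by fun_prop) (hu w (hsub hwc)).differentiableAt,
      logDeriv_prod (fun i _ => hne w hw i) (fun i _ => by fun_prop), mul_add, logDeriv_apply u,
      Finset.mul_sum]
    congr 1
    refine Finset.sum_congr rfl fun i _ => ?_
    rw [logDeriv_apply]
    simp [mul_comm]
  have hci : ∀ i ∈ (Finset.univ : Finset (Fin d)),
      CircleIntegrable (fun w => (w - ρ i)⁻¹ • F w) b ε := by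
    intro i _
    refine ContinuousOn.circleIntegrable hε.le fun w hw => ContinuousAt.continuousWithinAt ?_
    have := (hF w (Metric.sphere_subset_closedBall hw)).continuousAt
    have h1 : ContinuousAt (fun w => w - ρ i) w := by fun_prop
    exact (h1.inv₀ (hne w hw i)).smul this
  have hana : AnalyticOnNhd ℂ (fun w => F w * (deriv u w / u w)) (Metric.closedBall b ε) :=
    fun w hw => (hF w hw).mul ((hu w (hsub hw)).deriv.div (hu w (hsub hw)) (hu0 w (hsub hw)))
  rw [circleIntegral.integral_congr hε.le hlog, circleIntegral.integral_add _ _,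
    circleIntegral.integral_fun_sum hci]
  · have h2 : (∮ w in C(b, ε), F w * (deriv u w / u w)) = 0 :=
      (hana.differentiableOn.diffContOnCl_ball subset_rfl).circleIntegral_eq_zero hε.le
    rw [h2, add_zero, Finset.mul_sum, Finset.sum_filter]
    refine Finset.sum_congr rfl fun i _ => ?_
    split_ifs with hi
    · rw [hF.differentiableOn.circleIntegral_sub_inv_smul hi, smul_eq_mul]
    · refine DiffContOnCl.circleIntegral_eq_zero hε.le (DifferentiableOn.diffContOnCl_ball ?_ subset_rfl)
      intro w hw
      have hwi : w - ρ i ≠ 0 := by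
        intro h
        rw [sub_eq_zero] at h
        subst h
        rcases (Metric.mem_closedBall.1 hw).lt_or_eq with h | h
        · exact hi h
        · exact hρ i h
      have h1 : DifferentiableAt ℂ (fun w => w - ρ i) w := by fun_prop
      exact ((h1.inv hwi).smul (hF w hw).differentiableAt).differentiableWithinAt
  · have := CircleIntegrable.fun_sum (s := Finset.univ) (f := fun i w => (w - ρ i)⁻¹ • F w) hci
    exact this
  · refine ContinuousOn.circleIntegrable hε.le ?_
    exact hana.continuousOn.mono Metric.sphere_subset_closedBall

end LocalAnalytic

namespace LocalAnalytic

variable {E : Type*} [NormedAddCommGroup E] [NormedSpace ℂ E]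

/-- `ρ z` lists, for `z ∈ D`, the zeros of `g (z, ·)` in the disc of radius `r`;
all of them collapse to the origin over `z = 0`. -/
structure LocalRoots (g : E × ℂ → ℂ) {d : ℕ} (ρ : E → Fin d → ℂ) (D : Set E) (r : ℝ) : Prop where
  r_pos : 0 < r
  isOpen : IsOpen D
  zero_mem : (0 : E) ∈ D
  hol : ∀ z ∈ D, ∀ w ∈ Metric.closedBall (0 : ℂ) r, HolAt g (z, w)
  roots : ∀ z ∈ D, IsRootList (fun w => g (z, w)) r (ρ z)
  root_zero : ∀ i, ρ 0 i = 0

lemma holAt_logDeriv_snd {g : E × ℂ → ℂ} {z : E} {w : ℂ} (h : HolAt g (z, w)) (h0 : g (z, w) ≠ 0) :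
    HolAt (fun p : E × ℂ => deriv (fun ζ => g (p.1, ζ)) p.2 / g p) (z, w) := by
  simpa only [div_eq_mul_inv] using h.deriv_snd.mul (h.inv h0)

lemma eventually_forall_ne_zero {g : E × ℂ → ℂ} {z : E} {K : Set ℂ} (hK : IsCompact K)
    (h : ∀ w ∈ K, HolAt g (z, w)) (h0 : ∀ w ∈ K, g (z, w) ≠ 0) :
    ∀ᶠ y in 𝓝 z, ∀ w ∈ K, g (y, w) ≠ 0 :=
  hK.eventually_forall_of_forall_eventually fun w hw =>
    (h w hw).continuousAt.eventually_ne (h0 w hw)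

open scoped Classical in
lemma exists_holAt_moment {g : E × ℂ → ℂ} {z : E} {r : ℝ} {d : E → ℕ}
    {ρ : (y : E) → Fin (d y) → ℂ}
    (hroots : ∀ᶠ y in 𝓝 z, IsRootList (fun w => g (y, w)) r (ρ y))
    {b : ℂ} {ε : ℝ} (hε : 0 < ε) (hb : Metric.closedBall b ε ⊆ Metric.closedBall 0 r)
    (hg : ∀ w ∈ Metric.closedBall b ε, HolAt g (z, w))
    (hρ : ∀ i, ρ z i ∉ Metric.sphere b ε) {F : E × ℂ → ℂ}
    (hF : ∀ w ∈ Metric.closedBall b ε, HolAt F (z, w)) :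
    ∃ G : E → ℂ, HolAt G z ∧
      ∀ᶠ y in 𝓝 z, G y = ∑ i with ρ y i ∈ Metric.ball b ε, F (y, ρ y i) := by
  have hg0 : ∀ w ∈ Metric.sphere b ε, g (z, w) ≠ 0 := by
    intro w hw h0
    obtain ⟨i, hi⟩ := (hroots.self_of_nhds.eq_zero_iff
      (hb (Metric.sphere_subset_closedBall hw))).1 h0
    exact hρ i (hi ▸ hw)
  have hgs : ∀ w ∈ Metric.sphere b ε, HolAt g (z, w) := fun w hw =>
    hg w (Metric.sphere_subset_closedBall hw)
  refine ⟨fun y => (2 * Real.pi * Complex.I)⁻¹ *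
    ∮ w in C(b, ε), F (y, w) * (deriv (fun ζ => g (y, ζ)) w / g (y, w)), ?_, ?_⟩
  · refine (HolAt.const _ _).mul (HolAt.circleIntegral
      (f := fun p => F p * (deriv (fun ζ => g (p.1, ζ)) p.2 / g p)) hε.le fun w hw => ?_)
    exact (hF w (Metric.sphere_subset_closedBall hw)).mul
      (holAt_logDeriv_snd (hgs w hw) (hg0 w hw))
  · filter_upwards [hroots, eventually_forall_ne_zero (isCompact_sphere b ε) hgs hg0,
      eventually_forall_holAt (isCompact_closedBall b ε) hF] with y h1 h2 h3
    have := h1.circleIntegral_logDeriv hε hb (F := fun w => F (y, w)) (fun i hi => h2 _ hi ?_)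
      (fun w hw => (h3 w hw).analyticAt_snd)
    · rw [this, ← mul_assoc, inv_mul_cancel₀ Complex.two_pi_I_ne_zero, one_mul]
    · exact (h1.eq_zero_iff (hb (Metric.sphere_subset_closedBall hi))).2 ⟨i, rfl⟩

lemma eventually_eq_of_continuousAt_natCast {α : Type*} [TopologicalSpace α] {c : α → ℕ} {z : α}
    (h : ContinuousAt (fun y => (c y : ℂ)) z) : ∀ᶠ y in 𝓝 z, c y = c z := by
  filter_upwards [h.eventually (Metric.ball_mem_nhds _ one_pos)] with y hy
  rw [dist_eq_norm] at hy
  have h1 : ((c y : ℂ) - c z) = (((c y : ℤ) - c z : ℤ) : ℂ) := by push_cast; ring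
  rw [h1, Complex.norm_intCast] at hy
  have h2 : |(c y : ℤ) - c z| < 1 := by exact_mod_cast hy
  have h3 := Int.abs_lt_one_iff.1 h2
  omega

/-- Local form of the Weierstrass preparation theorem. -/
theorem exists_localRoots {g : E × ℂ → ℂ} (hg : HolAt g 0)
    (h0 : ¬ ∀ᶠ w in 𝓝 (0 : ℂ), g (0, w) = 0) {V : Set (E × ℂ)} (hV : V ∈ 𝓝 (0 : E × ℂ)) :
    ∃ (d : ℕ) (ρ : E → Fin d → ℂ) (D : Set E) (r : ℝ), LocalRoots g ρ D r ∧
      D ×ˢ Metric.closedBall 0 r ⊆ V := by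
  classical
  have hline : AnalyticAt ℂ (fun w => g ((0 : E), w)) 0 := HolAt.analyticAt_snd hg
  have hne := (hline.eventually_eq_zero_or_eventually_ne_zero).resolve_left h0
  rw [eventually_nhdsWithin_iff] at hne
  obtain ⟨s, hs, hsne⟩ := Metric.eventually_nhds_iff_ball.1 hne
  obtain ⟨η, hη, hηV⟩ := Metric.eventually_nhds_iff_ball.1 (hg.eventually.and hV)
  obtain ⟨r, hr, hrlt⟩ := exists_between (lt_min hs hη)
  have hmem : ∀ z ∈ Metric.ball (0 : E) η, ∀ w ∈ Metric.closedBall (0 : ℂ) r,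
      HolAt g (z, w) ∧ (z, w) ∈ V := by
    intro z hz w hw
    refine hηV _ ?_
    rw [← Prod.mk_zero_zero, Metric.mem_ball, Prod.dist_eq, max_lt_iff]
    exact ⟨hz, (Metric.mem_closedBall.1 hw).trans_lt (hrlt.trans_le (min_le_right _ _))⟩
  have hz0 : (0 : E) ∈ Metric.ball (0 : E) η := Metric.mem_ball_self hη
  have hzero : ∀ w ∈ Metric.closedBall (0 : ℂ) r, w ≠ 0 → g (0, w) ≠ 0 := fun w hw hw0 =>
    hsne w ((Metric.mem_closedBall.1 hw).trans_lt (hrlt.trans_le (min_le_left _ _))) hw0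
  have hsph := eventually_forall_ne_zero (isCompact_sphere (0 : ℂ) r) (z := (0 : E)) (g := g)
    (fun w hw => (hmem 0 hz0 w (Metric.sphere_subset_closedBall hw)).1)
    (fun w hw => hzero w (Metric.sphere_subset_closedBall hw)
      (by rintro rfl; simp at hw; exact hr.ne hw))
  obtain ⟨δ, hδ, hball⟩ := Metric.eventually_nhds_iff_ball.1
    (hsph.and (Metric.ball_mem_nhds (0 : E) hη))
  have hex : ∀ z : E, ∃ (d : ℕ) (ρ : Fin d → ℂ), z ∈ Metric.ball (0 : E) δ →
      IsRootList (fun w => g (z, w)) r ρ := by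
    intro z
    by_cases hz : z ∈ Metric.ball (0 : E) δ
    · obtain ⟨d, ρ, h⟩ := exists_isRootList hr (φ := fun w => g (z, w))
        (fun w hw => ((hmem z (hball z hz).2 w hw).1).analyticAt_snd) (hball z hz).1
      exact ⟨d, ρ, fun _ => h⟩
    · exact ⟨0, fun _ => 0, fun h => absurd h hz⟩
  choose d ρ hρ using hex
  have hconst : ∀ z ∈ Metric.ball (0 : E) δ, d z = d 0 := by
    have hcont : ContinuousOn d (Metric.ball (0 : E) δ) := by
      intro z hz
      refine ContinuousAt.continuousWithinAt ?_
      obtain ⟨G, hG, hGe⟩ := exists_holAt_moment (d := d) (ρ := ρ) (z := z) (g := g) (r := r)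
        (by filter_upwards [Metric.isOpen_ball.mem_nhds hz] with y hy using hρ y hy) hr subset_rfl
        (fun w hw => (hmem z (hball z hz).2 w hw).1)
        (fun i hi => (Metric.mem_ball.1 ((hρ z hz).1 i)).ne hi)
        (F := fun _ => 1) (fun w _ => HolAt.const _ _)
      have hGd : ∀ᶠ y in 𝓝 z, G y = d y := by
        filter_upwards [hGe, Metric.isOpen_ball.mem_nhds hz] with y h1 h2
        rw [h1, Finset.filter_true_of_mem fun i _ => (hρ y h2).1 i]
        simp
      have h1 : ContinuousAt (fun y => ((d y : ℕ) : ℂ)) z := hG.continuousAt.congr hGd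
      refine continuousAt_const.congr (f := fun _ => d z) ?_
      exact (eventually_eq_of_continuousAt_natCast h1).mono fun y hy => hy.symm
    intro z hz
    exact (convex_ball (0 : E) δ).isPreconnected.constant hcont hz (Metric.mem_ball_self hδ)
  have hcast : ∀ z : E, ∃ ρ' : Fin (d 0) → ℂ, z ∈ Metric.ball (0 : E) δ →
      IsRootList (fun w => g (z, w)) r ρ' := by
    intro z
    by_cases hz : z ∈ Metric.ball (0 : E) δ
    · have := hρ z hz
      have hd := hconst z hz
      generalize ρ z = ρz at this
      generalize d z = n at ρz this hd
      subst hd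
      exact ⟨_, fun _ => this⟩
    · exact ⟨fun _ => 0, fun h => absurd h hz⟩
  choose ρ' hρ' using hcast
  have h0δ := Metric.mem_ball_self (x := (0 : E)) hδ
  refine ⟨d 0, ρ', Metric.ball 0 δ, r, ⟨hr, Metric.isOpen_ball, h0δ, fun z hz w hw =>
    (hmem z (hball z hz).2 w hw).1, hρ', fun i => ?_⟩, ?_⟩
  · by_contra hne
    have hi := Metric.ball_subset_closedBall ((hρ' 0 h0δ).1 i)
    exact hzero _ hi hne (((hρ' 0 h0δ).eq_zero_iff hi).2 ⟨i, rfl⟩)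
  · rintro ⟨z, w⟩ ⟨hz, hw⟩
    exact (hmem z (hball z hz).2 w hw).2

namespace LocalRoots

variable {g : E × ℂ → ℂ} {d : ℕ} {ρ : E → Fin d → ℂ} {D : Set E} {r : ℝ}

lemma mono (h : LocalRoots g ρ D r) {D' : Set E} (ho : IsOpen D') (h0 : (0 : E) ∈ D')
    (hD : D' ⊆ D) : LocalRoots g ρ D' r :=
  ⟨h.r_pos, ho, h0, fun z hz => h.hol z (hD hz), fun z hz => h.roots z (hD hz), h.root_zero⟩

lemma root_mem (h : LocalRoots g ρ D r) {z : E} (hz : z ∈ D) (i : Fin d) :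
    ρ z i ∈ Metric.ball (0 : ℂ) r := (h.roots z hz).1 i

lemma eq_zero_iff (h : LocalRoots g ρ D r) {z : E} (hz : z ∈ D) {w : ℂ}
    (hw : w ∈ Metric.closedBall (0 : ℂ) r) : g (z, w) = 0 ↔ ∃ i, ρ z i = w :=
  (h.roots z hz).eq_zero_iff hw

open scoped Classical in
lemma exists_holAt_sum (h : LocalRoots g ρ D r) {z : E} (hz : z ∈ D)
    {b : ℂ} {ε : ℝ} (hε : 0 < ε) (hb : Metric.closedBall b ε ⊆ Metric.closedBall 0 r)
    (hρ : ∀ i, ρ z i ∉ Metric.sphere b ε) {F : E × ℂ → ℂ}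
    (hF : ∀ w ∈ Metric.closedBall b ε, HolAt F (z, w)) :
    ∃ G : E → ℂ, HolAt G z ∧
      ∀ᶠ y in 𝓝 z, G y = ∑ i with ρ y i ∈ Metric.ball b ε, F (y, ρ y i) :=
  exists_holAt_moment (d := fun _ => d)
    (by filter_upwards [h.isOpen.mem_nhds hz] with y hy using h.roots y hy) hε hb
    (fun w hw => h.hol z hz w (hb hw)) hρ hF

open scoped Classical in
lemma eventually_card_eq (h : LocalRoots g ρ D r) {z : E} (hz : z ∈ D)
    {b : ℂ} {ε : ℝ} (hε : 0 < ε) (hb : Metric.closedBall b ε ⊆ Metric.closedBall 0 r)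
    (hρ : ∀ i, ρ z i ∉ Metric.sphere b ε) :
    ∀ᶠ y in 𝓝 z, Finset.card {i | ρ y i ∈ Metric.ball b ε} =
      Finset.card {i | ρ z i ∈ Metric.ball b ε} := by
  obtain ⟨G, hG, hGe⟩ := h.exists_holAt_sum hz hε hb hρ (F := fun _ => 1)
    (fun w _ => HolAt.const _ _)
  set c : E → ℕ := fun y => Finset.card {i | ρ y i ∈ Metric.ball b ε}
  have hGd : ∀ᶠ y in 𝓝 z, G y = c y := by
    filter_upwards [hGe] with y h1
    rw [h1]
    simp [c]
  have h1 : ContinuousAt (fun y => ((c y : ℕ) : ℂ)) z := hG.continuousAt.congr hGd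
  exact eventually_eq_of_continuousAt_natCast h1

lemma eventually_roots_mem_ball (h : LocalRoots g ρ D r) {ε : ℝ} (hε : 0 < ε) :
    ∀ᶠ z in 𝓝 0, ∀ i, ρ z i ∈ Metric.ball (0 : ℂ) ε := by
  classical
  have hm := lt_min hε h.r_pos
  have h1 := h.eventually_card_eq h.zero_mem hm (b := 0)
    (Metric.closedBall_subset_closedBall (min_le_right _ _))
    (fun i hi => by rw [h.root_zero] at hi; simp at hi; exact hm.ne hi)
  filter_upwards [h1] with z hz i
  have h2 : Finset.univ.filter (fun i => ρ 0 i ∈ Metric.ball (0 : ℂ) (min ε r)) = Finset.univ := by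
    refine Finset.filter_true_of_mem fun i _ => ?_
    rw [h.root_zero]
    exact Metric.mem_ball_self hm
  rw [h2, Finset.card_univ, Finset.card_eq_iff_eq_univ] at hz
  have h3 : i ∈ Finset.univ.filter (fun i => ρ z i ∈ Metric.ball (0 : ℂ) (min ε r)) := by
    rw [hz]
    exact Finset.mem_univ _
  exact Metric.ball_subset_ball (min_le_left _ _) (Finset.mem_filter.1 h3).2

/-- Roots depend continuously on the parameter, up to a permutation. -/
lemma exists_perm (h : LocalRoots g ρ D r) {z₀ : E} (hz₀ : z₀ ∈ D) {δ : ℝ} (hδ : 0 < δ) :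
    ∃ ε > 0, ε < δ ∧ (∀ i, Metric.closedBall (ρ z₀ i) ε ⊆ Metric.closedBall 0 r) ∧
      (∀ i j, ρ z₀ j ∉ Metric.sphere (ρ z₀ i) ε) ∧
      ∀ᶠ z in 𝓝 z₀, ∃ σ : Equiv.Perm (Fin d), ∀ i j,
        ρ z (σ i) ∈ Metric.ball (ρ z₀ j) ε ↔ ρ z₀ i = ρ z₀ j := by
  classical
  have hsmall : ∀ᶠ ε in 𝓝[>] (0 : ℝ), 0 < ε ∧ ε < δ ∧ (∀ i, ε < r - ‖ρ z₀ i‖) ∧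
      ∀ i j, ρ z₀ i ≠ ρ z₀ j → 2 * ε < dist (ρ z₀ i) (ρ z₀ j) := by
    have hlt : ∀ c : ℝ, 0 < c → ∀ᶠ ε in 𝓝[>] (0 : ℝ), ε < c := fun c hc =>
      (eventually_lt_nhds hc).filter_mono nhdsWithin_le_nhds
    refine Eventually.and eventually_mem_nhdsWithin ((hlt δ hδ).and (Eventually.and ?_ ?_))
    · refine eventually_all.2 fun i => hlt _ ?_
      simpa using h.root_mem hz₀ i
    · refine eventually_all.2 fun i => eventually_all.2 fun j => ?_
      by_cases hij : ρ z₀ i = ρ z₀ j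
      · simp [hij]
      · filter_upwards [hlt (dist (ρ z₀ i) (ρ z₀ j) / 2) (half_pos (dist_pos.2 hij))] with ε hε _
        linarith
  obtain ⟨ε, hε, hεδ, hεr, hsep⟩ := hsmall.exists
  have hball : ∀ i, Metric.closedBall (ρ z₀ i) ε ⊆ Metric.closedBall 0 r := by
    intro i w hw
    rw [mem_closedBall_iff_norm] at hw
    rw [mem_closedBall_zero_iff]
    have := norm_add_le (w - ρ z₀ i) (ρ z₀ i)
    rw [sub_add_cancel] at this
    linarith [hεr i]
  have hsph : ∀ i j, ρ z₀ j ∉ Metric.sphere (ρ z₀ i) ε := by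
    intro i j hj
    rw [Metric.mem_sphere] at hj
    by_cases hij : ρ z₀ j = ρ z₀ i
    · rw [hij, dist_self] at hj
      exact hε.ne hj
    · linarith [hsep j i hij]
  refine ⟨ε, hε, hεδ, hball, hsph, ?_⟩
  have hcard := eventually_all.2 fun i => h.eventually_card_eq hz₀ hε (hball i) (hsph i)
  filter_upwards [hcard] with z hz
  have hmem₀ : ∀ i j, ρ z₀ i ∈ Metric.ball (ρ z₀ j) ε ↔ ρ z₀ i = ρ z₀ j := by
    intro i j
    refine ⟨fun hi => ?_, fun hij => hij ▸ Metric.mem_ball_self hε⟩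
    by_contra hij
    linarith [hsep i j hij, Metric.mem_ball.1 hi]
  have huniq : ∀ w i j, w ∈ Metric.ball (ρ z₀ i) ε → w ∈ Metric.ball (ρ z₀ j) ε →
      ρ z₀ i = ρ z₀ j := by
    intro w i j hi hj
    by_contra hij
    have := dist_triangle_left (ρ z₀ i) (ρ z₀ j) w
    linarith [hsep i j hij, Metric.mem_ball.1 hi, Metric.mem_ball.1 hj]
  have hcover : ∀ k, ∃ i, ρ z k ∈ Metric.ball (ρ z₀ i) ε := by
    let B : ℂ → Finset (Fin d) := fun b => {k | ρ z k ∈ Metric.ball b ε}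
    have h1 : ((Finset.univ.image (ρ z₀)).biUnion B).card = d := by
      rw [Finset.card_biUnion]
      · have h2 := Finset.card_eq_sum_card_image (ρ z₀) (Finset.univ : Finset (Fin d))
        rw [Finset.card_univ, Fintype.card_fin] at h2
        refine Eq.trans (Finset.sum_congr rfl fun b hb => ?_) h2.symm
        obtain ⟨i, -, rfl⟩ := Finset.mem_image.1 hb
        rw [hz i]
        simp only [hmem₀]
      · intro b hb b' hb' hne
        obtain ⟨i, -, rfl⟩ := Finset.mem_image.1 hb
        obtain ⟨j, -, rfl⟩ := Finset.mem_image.1 hb'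
        refine Finset.disjoint_left.2 fun k hk hk' => hne ?_
        exact huniq _ i j (Finset.mem_filter.1 hk).2 (Finset.mem_filter.1 hk').2
    have h2 : (Finset.univ.image (ρ z₀)).biUnion B = Finset.univ := by
      rw [← Finset.card_eq_iff_eq_univ, h1, Fintype.card_fin]
    intro k
    have h3 : k ∈ (Finset.univ.image (ρ z₀)).biUnion B := by
      rw [h2]
      exact Finset.mem_univ k
    obtain ⟨b, hb, hk⟩ := Finset.mem_biUnion.1 h3
    obtain ⟨i, -, rfl⟩ := Finset.mem_image.1 hb
    exact ⟨i, (Finset.mem_filter.1 hk).2⟩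
  choose κ hκ using hcover
  have hκ' : ∀ k j, ρ z k ∈ Metric.ball (ρ z₀ j) ε ↔ ρ z₀ (κ k) = ρ z₀ j := fun k j =>
    ⟨fun hk => huniq _ _ _ (hκ k) hk, fun hk => hk ▸ hκ k⟩
  have hfib : ∀ c, Nonempty ({i // ρ z₀ i = c} ≃ {k // ρ z₀ (κ k) = c}) := by
    intro c
    by_cases hc : ∃ j, ρ z₀ j = c
    · obtain ⟨j, rfl⟩ := hc
      refine ⟨Fintype.equivOfCardEq ?_⟩
      rw [Fintype.card_subtype, Fintype.card_subtype]
      have := hz j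
      simp only [hmem₀, hκ'] at this
      exact this.symm
    · push Not at hc
      have : IsEmpty {i // ρ z₀ i = c} := ⟨fun i => hc _ i.2⟩
      have : IsEmpty {k // ρ z₀ (κ k) = c} := ⟨fun i => hc _ i.2⟩
      exact ⟨Equiv.equivOfIsEmpty _ _⟩
  refine ⟨Equiv.ofFiberEquiv (f := ρ z₀) (g := fun k => ρ z₀ (κ k)) fun c => (hfib c).some,
    fun i j => ?_⟩
  rw [hκ']
  have := Equiv.ofFiberEquiv_map (f := ρ z₀) (g := fun k => ρ z₀ (κ k))
    (fun c => (hfib c).some) i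
  rw [this]

end LocalRoots

end LocalAnalytic

namespace LocalAnalytic

section SymmetricFunctions

variable {d : ℕ}

/-- Elementary symmetric function of a finite family of complex numbers. -/
def elemSymm (x : Fin d → ℂ) (j : ℕ) : ℂ := ∑ s ∈ Finset.univ.powersetCard j, ∏ i ∈ s, x i

lemma mul_elemSymm (x : Fin d → ℂ) (k : ℕ) :
    (k : ℂ) * elemSymm x k = (-1) ^ (k + 1) *
      ∑ a ∈ Finset.HasAntidiagonal.antidiagonal k with a.1 < k,
        (-1) ^ a.1 * elemSymm x a.1 * ∑ i, x i ^ a.2 := by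
  have := congrArg (MvPolynomial.aeval x) (MvPolynomial.mul_esymm_eq_sum (Fin d) ℂ k)
  simpa [MvPolynomial.esymm, MvPolynomial.psum, elemSymm, map_sum, map_prod] using this

lemma elemSymm_eq_zero {x : Fin d → ℂ} {j : ℕ} (h : {i | x i ≠ 0}.ncard < j) :
    elemSymm x j = 0 := by
  refine Finset.sum_eq_zero fun s hs => ?_
  rw [Finset.prod_eq_zero_iff]
  by_contra! hne
  have : s.card ≤ {i | x i ≠ 0}.ncard := by
    rw [← Set.ncard_coe_finset]
    exact Set.ncard_le_ncard (fun i hi => hne i hi) (Set.toFinite _)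
  rw [(Finset.mem_powersetCard.1 hs).2] at this
  omega

lemma elemSymm_ne_zero (x : Fin d → ℂ) : elemSymm x {i | x i ≠ 0}.ncard ≠ 0 := by
  classical
  set T : Finset (Fin d) := Finset.univ.filter fun i => x i ≠ 0 with hT
  have hTc : {i | x i ≠ 0}.ncard = T.card := by
    rw [← Set.ncard_coe_finset]
    congr 1
    ext i
    simp [T]
  have : elemSymm x T.card = ∏ i ∈ T, x i := by
    refine Finset.sum_eq_single_of_mem T (by simp) fun s hs hsT => ?_
    rw [Finset.prod_eq_zero_iff]
    by_contra! hne
    have hsub : s ⊆ T := fun i hi => by simpa [T] using hne i hi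
    exact hsT (Finset.eq_of_subset_of_card_le hsub (Finset.mem_powersetCard.1 hs).2.ge)
  rw [hTc, this, Finset.prod_ne_zero_iff]
  intro i hi
  simpa [T] using hi

lemma eq_zero_of_forall_powerSum_eq_zero {x : Fin d → ℂ}
    (h : ∀ j, 1 ≤ j → ∑ i, x i ^ j = 0) : ∀ i, x i = 0 := by
  have he : ∀ k, 1 ≤ k → elemSymm x k = 0 := by
    intro k hk
    have h1 : (k : ℂ) * elemSymm x k = 0 := by
      rw [mul_elemSymm, Finset.sum_eq_zero, mul_zero]
      intro a ha
      rw [Finset.mem_filter, Finset.HasAntidiagonal.mem_antidiagonal] at ha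
      rw [h a.2 (by omega), mul_zero]
    exact (mul_eq_zero.1 h1).resolve_left (Nat.cast_ne_zero.2 (by omega))
  intro i
  by_contra hi
  refine elemSymm_ne_zero x (he _ ?_)
  exact (Set.ncard_pos (Set.toFinite _)).2 ⟨i, hi⟩

end SymmetricFunctions

variable {E : Type*} [NormedAddCommGroup E] [NormedSpace ℂ E]

lemma HolAt.elemSymm {d : ℕ} {x : E → Fin d → ℂ} {z : E}
    (h : ∀ j, HolAt (fun y => ∑ i, x y i ^ j) z) (k : ℕ) :
    HolAt (fun y => LocalAnalytic.elemSymm (x y) k) z := by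
  induction k using Nat.strong_induction_on with
  | _ k ih =>
    rcases Nat.eq_zero_or_pos k with rfl | hk
    · have : (fun y => LocalAnalytic.elemSymm (x y) 0) = fun _ => 1 := by
        funext y
        simp [LocalAnalytic.elemSymm]
      rw [this]
      exact HolAt.const _ _
    · have : (fun y => LocalAnalytic.elemSymm (x y) k) = fun y => (k : ℂ)⁻¹ * ((-1) ^ (k + 1) *
          ∑ a ∈ Finset.HasAntidiagonal.antidiagonal k with a.1 < k,
            (-1) ^ a.1 * LocalAnalytic.elemSymm (x y) a.1 * ∑ i, x y i ^ a.2) := by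
        funext y
        rw [← mul_elemSymm, inv_mul_cancel_left₀ (Nat.cast_ne_zero.2 hk.ne')]
      rw [this]
      refine (HolAt.const _ _).mul ((HolAt.const _ _).mul (HolAt.finset_sum fun a ha => ?_))
      exact ((HolAt.const _ _).mul (ih a.1 (Finset.mem_filter.1 ha).2)).mul (h a.2)

/-- `Z` is the common zero set of a family of holomorphic functions on the open set `V`. -/
def IsZeroSetOn (Z V : Set E) : Prop :=
  IsOpen V ∧ ∃ F : Set (E → ℂ), (∀ f ∈ F, ∀ y ∈ V, HolAt f y) ∧
    ∀ z ∈ V, z ∈ Z ↔ ∀ f ∈ F, f z = 0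

/-- `Z` is analytic near the origin. -/
def AnGerm (Z : Set E) : Prop := ∃ V, (0 : E) ∈ V ∧ IsZeroSetOn Z V

lemma IsZeroSetOn.eventually_notMem {Z V : Set E} (h : IsZeroSetOn Z V) {y : E} (hy : y ∈ V)
    (hyZ : y ∉ Z) : ∀ᶠ z in 𝓝 y, z ∉ Z := by
  obtain ⟨hV, F, hF, hZ⟩ := h
  rw [hZ y hy] at hyZ
  push Not at hyZ
  obtain ⟨f, hf, hfy⟩ := hyZ
  filter_upwards [(hF f hf y hy).continuousAt.eventually_ne hfy, hV.mem_nhds hy] with z hz hzV hzZ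
  exact hz ((hZ z hzV).1 hzZ f hf)

lemma IsZeroSetOn.mono {Z V W : Set E} (h : IsZeroSetOn Z V) (hW : IsOpen W) (hWV : W ⊆ V) :
    IsZeroSetOn Z W := by
  obtain ⟨-, F, hF, hZ⟩ := h
  exact ⟨hW, F, fun f hf y hy => hF f hf y (hWV hy), fun z hz => hZ z (hWV hz)⟩

lemma IsZeroSetOn.iInter {ι : Type*} {Z : ι → Set E} {V : Set E} (hV : IsOpen V)
    (h : ∀ i, IsZeroSetOn (Z i) V) : IsZeroSetOn (⋂ i, Z i) V := by
  choose _ F hF hZ using h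
  refine ⟨hV, ⋃ i, F i, ?_, ?_⟩
  · intro f hf
    obtain ⟨i, hi⟩ := mem_iUnion.1 hf
    exact hF i f hi
  · intro z hz
    simp only [mem_iInter, mem_iUnion, hZ _ z hz]
    exact ⟨fun h f ⟨i, hi⟩ => h i f hi, fun h i f hi => h f ⟨i, hi⟩⟩

lemma exists_isZeroSetOn {ι : Type*} [Finite ι] {Z : ι → Set E} (h : ∀ i, AnGerm (Z i)) :
    ∃ V, (0 : E) ∈ V ∧ IsOpen V ∧ ∀ i, IsZeroSetOn (Z i) V := by
  choose V h0 hV using h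
  have ho : IsOpen (⋂ i, V i) := isOpen_iInter_of_finite fun i => (hV i).1
  exact ⟨⋂ i, V i, mem_iInter.2 h0, ho, fun i => (hV i).mono ho (iInter_subset _ i)⟩

lemma AnGerm.iInter {ι : Type*} [Finite ι] {Z : ι → Set E} (h : ∀ i, AnGerm (Z i)) :
    AnGerm (⋂ i, Z i) := by
  obtain ⟨V, h0, ho, hV⟩ := exists_isZeroSetOn h
  exact ⟨V, h0, IsZeroSetOn.iInter ho hV⟩

/-- The number of roots over `z` lying in `A`. -/
def rootCount {d : ℕ} (ρ : E → Fin d → ℂ) (A : Set (E × ℂ)) (z : E) : ℕ :=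
  {i | (z, ρ z i) ∈ A}.ncard

/-- Elimination: the set of parameters with at least `k` roots in `A` is analytic. -/
theorem LocalRoots.anGerm_rootCount {g : E × ℂ → ℂ} {d : ℕ} {ρ : E → Fin d → ℂ} {D : Set E} {r : ℝ}
    (h : LocalRoots g ρ D r) {A : Set (E × ℂ)} (hA : AnGerm A) (k : ℕ) :
    AnGerm {z | k ≤ rootCount ρ A z} := by
  classical
  obtain ⟨V, h0V, hVo, F, hF, hAF⟩ := hA
  obtain ⟨η, hη, hηV⟩ := Metric.isOpen_iff.1 hVo 0 h0V
  obtain ⟨ε, hε, hεlt⟩ := exists_between (lt_min hη h.r_pos)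
  have hεr : ε ≤ r := (hεlt.trans_le (min_le_right _ _)).le
  have hmem : ∀ z ∈ Metric.ball (0 : E) η, ∀ w ∈ Metric.closedBall (0 : ℂ) ε, (z, w) ∈ V := by
    intro z hz w hw
    refine hηV ?_
    rw [← Prod.mk_zero_zero, Metric.mem_ball, Prod.dist_eq, max_lt_iff]
    exact ⟨hz, (Metric.mem_closedBall.1 hw).trans_lt (hεlt.trans_le (min_le_left _ _))⟩
  obtain ⟨δ, hδ, hball⟩ := Metric.eventually_nhds_iff_ball.1
    ((h.eventually_roots_mem_ball hε).and ((h.isOpen.eventually_mem h.zero_mem).and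
      (Metric.ball_mem_nhds (0 : E) hη)))
  have hspan : ∀ f ∈ Submodule.span ℂ F, ∀ y ∈ V, HolAt f y := by
    intro f hf y hy
    induction hf using Submodule.span_induction with
    | mem f hf => exact hF f hf y hy
    | zero => exact HolAt.const 0 y
    | add f f' _ _ h1 h2 => exact h1.add h2
    | smul c f _ h1 => exact (HolAt.const c y).mul h1
  have hspanA : ∀ f ∈ Submodule.span ℂ F, ∀ y ∈ V, y ∈ A → f y = 0 := by
    intro f hf y hy hyA
    induction hf using Submodule.span_induction with
    | mem f hf => exact (hAF y hy).1 hyA f hf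
    | zero => rfl
    | add f f' _ _ h1 h2 => simp [h1, h2]
    | smul c f _ h1 => simp [h1]
  have hV : ∀ z ∈ Metric.ball (0 : E) δ, ∀ i, (z, ρ z i) ∈ V := fun z hz i =>
    hmem z (hball z hz).2.2 _ (Metric.ball_subset_closedBall ((hball z hz).1 i))
  have hcompl : ∀ z, {i | (z, ρ z i) ∉ A}.ncard + rootCount ρ A z = d := by
    intro z
    have := Set.ncard_add_ncard_compl {i | (z, ρ z i) ∈ A}
    rw [Nat.card_eq_fintype_card, Fintype.card_fin] at this
    rw [add_comm]
    exact this
  refine ⟨Metric.ball 0 δ, Metric.mem_ball_self hδ, Metric.isOpen_ball,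
    {e | ∃ f ∈ Submodule.span ℂ F, ∃ j, d < j + k ∧
      e = fun z => elemSymm (fun i => f (z, ρ z i)) j}, ?_, ?_⟩
  · rintro _ ⟨f, hf, j, -, rfl⟩ z hz
    refine HolAt.elemSymm (x := fun z i => f (z, ρ z i)) (fun l => ?_) j
    obtain ⟨G, hG, hGe⟩ := h.exists_holAt_sum (hball z hz).2.1 hε (b := 0)
      (Metric.closedBall_subset_closedBall hεr)
      (fun i hi => (Metric.mem_ball.1 ((hball z hz).1 i)).ne hi)
      (F := fun p => f p ^ l)
      (fun w hw => (hspan f hf _ (hmem z (hball z hz).2.2 w hw)).pow l)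
    refine hG.congr ?_
    filter_upwards [hGe, Metric.isOpen_ball.mem_nhds hz] with y h1 h2
    rw [h1, Finset.filter_true_of_mem fun i _ => (hball y h2).1 i]
  · intro z hz
    have hc := hcompl z
    constructor
    · rintro (hk : k ≤ _) _ ⟨f, hf, j, hj, rfl⟩
      refine elemSymm_eq_zero ?_
      have : {i | f (z, ρ z i) ≠ 0}.ncard ≤ {i | (z, ρ z i) ∉ A}.ncard :=
        Set.ncard_le_ncard (fun i hi hiA => hi (hspanA f hf _ (hV z hz i) hiA)) (Set.toFinite _)
      omega
    · intro hall
      by_contra hk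
      have hk : rootCount ρ A z < k := not_le.1 hk
      obtain ⟨f, hf, hfne⟩ := Module.Dual.exists_forall_mem_ne_zero_of_forall_exists
        (ι := {i // (z, ρ z i) ∉ A}) (Submodule.span ℂ F)
        (fun i => LinearMap.proj (R := ℂ) (φ := fun _ : E × ℂ => ℂ) (z, ρ z i.1)) (by
          rintro ⟨i, hi⟩
          rw [hAF _ (hV z hz i)] at hi
          push Not at hi
          obtain ⟨f, hf, hfi⟩ := hi
          exact ⟨f, Submodule.subset_span hf, hfi⟩)
      have hset : {i | f (z, ρ z i) ≠ 0} = {i | (z, ρ z i) ∉ A} := by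
        ext i
        exact ⟨fun hi hiA => hi (hspanA f hf _ (hV z hz i) hiA), fun hi => hfne ⟨i, hi⟩⟩
      refine elemSymm_ne_zero (fun i => f (z, ρ z i)) ?_
      refine hall _ ⟨f, hf, {i | f (z, ρ z i) ≠ 0}.ncard, ?_, rfl⟩
      rw [hset]
      omega

end LocalAnalytic

namespace LocalAnalytic

lemma eventually_ne_zero_of_apply_one_ne_zero {φ : ℂ → ℂ}
    (hφ : AnalyticOnNhd ℂ φ (Metric.closedBall 0 1)) (h1 : φ 1 ≠ 0) :
    ∀ c ∈ Metric.closedBall (0 : ℂ) 1, ∀ᶠ w in 𝓝[≠] c, φ w ≠ 0 := by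
  intro c hc
  by_contra h
  have := hφ.eqOn_zero_of_preconnected_of_frequently_eq_zero
    (convex_closedBall _ _).isPreconnected hc ((not_eventually.1 h).mono fun _ => not_not.1)
  exact h1 (this (by simp))

/-- Identity theorem across the zeros of `φ`. -/
lemma apply_one_eq_zero {φ F : ℂ → ℂ} (hφ : AnalyticOnNhd ℂ φ (Metric.closedBall 0 1))
    (h1 : φ 1 ≠ 0) (hF : ∀ t ∈ Metric.closedBall (0 : ℂ) 1, φ t ≠ 0 → AnalyticAt ℂ F t)
    (h0 : ∀ᶠ t in 𝓝 0, F t = 0) : F 1 = 0 := by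
  have hfin : {w ∈ Metric.closedBall (0 : ℂ) 1 | φ w = 0}.Finite := by
    by_contra hinf
    obtain ⟨a, ha, hacc⟩ := Set.Infinite.exists_accPt_of_subset_isCompact hinf
      (isCompact_closedBall (0 : ℂ) 1) (fun w hw => hw.1)
    rw [accPt_iff_frequently] at hacc
    have h2 := eventually_ne_zero_of_apply_one_ne_zero hφ h1 a ha
    rw [eventually_nhdsWithin_iff] at h2
    obtain ⟨y, hy, hy'⟩ := (hacc.and_eventually h2).exists
    exact hy' hy.1 hy.2.2
  obtain ⟨η, hη, hball⟩ := Metric.eventually_nhds_iff_ball.1 h0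
  obtain ⟨s, ⟨hs0, hsη⟩, hsbad⟩ := (Set.Ioo_infinite (lt_min hη one_pos)).exists_notMem_finite
    (hfin.image fun z : ℂ => z.im / (1 - z.re))
  have hs1 : s < 1 := hsη.trans_le (min_le_right _ _)
  have hw : (s * Complex.I : ℂ) ∈ Metric.ball (0 : ℂ) η := by
    simp only [mem_ball_zero_iff, norm_mul, Complex.norm_real, Complex.norm_I, mul_one,
      Real.norm_eq_abs, abs_of_pos hs0]
    exact hsη.trans_le (min_le_left _ _)
  have hsub : segment ℝ (1 : ℂ) (s * Complex.I) ⊆ Metric.closedBall 0 1 := by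
    refine (convex_closedBall (0 : ℂ) 1).segment_subset (by simp) ?_
    simp [abs_of_pos hs0, hs1.le]
  have hana : AnalyticOnNhd ℂ F (segment ℝ (1 : ℂ) (s * Complex.I)) := by
    intro t ht
    refine hF t (hsub ht) fun hφt => ?_
    have htb := hsub ht
    obtain ⟨a, b, ha, hb, hab, rfl⟩ := ht
    rcases eq_or_ne b 0 with rfl | hb0
    · have : a = 1 := by linarith
      subst this
      simp at hφt
      exact h1 hφt
    · refine hsbad ⟨_, ⟨htb, hφt⟩, ?_⟩
      have : 1 - a = b := by linarith
      simp [this]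
      field_simp
  exact hana.eqOn_zero_of_preconnected_of_eventuallyEq_zero
    (convex_segment _ _).isPreconnected (right_mem_segment ℝ _ _)
    (by filter_upwards [Metric.isOpen_ball.mem_nhds hw] with t ht using hball t ht)
    (left_mem_segment ℝ _ _)

/-- Maximum principle across the zeros of `φ`. -/
lemma apply_one_eq_one {φ F : ℂ → ℂ} (hφ : AnalyticOnNhd ℂ φ (Metric.closedBall 0 1))
    (h1 : φ 1 ≠ 0) (hF : ∀ t ∈ Metric.closedBall (0 : ℂ) 1, φ t ≠ 0 → AnalyticAt ℂ F t)
    (hb : ∀ t ∈ Metric.closedBall (0 : ℂ) 1, ‖F t‖ ≤ 1) (h0 : Tendsto F (𝓝[≠] 0) (𝓝 1)) :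
    F 1 = 1 := by
  have hne := eventually_ne_zero_of_apply_one_ne_zero hφ h1
  let G : ℂ → ℂ := fun t => limUnder (𝓝[≠] t) F
  have hGF : ∀ t, ContinuousAt F t → G t = F t := fun t ht =>
    (ht.tendsto.mono_left nhdsWithin_le_nhds).limUnder_eq
  have hG : ∀ c ∈ Metric.ball (0 : ℂ) 1, DifferentiableAt ℂ G c := by
    intro c hc
    have hev := hne c (Metric.ball_subset_closedBall hc)
    rw [eventually_nhdsWithin_iff] at hev
    obtain ⟨s, hs, hball⟩ := Metric.eventually_nhds_iff_ball.1
      (hev.and (Metric.isOpen_ball.eventually_mem hc))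
    have hFa : ∀ t ∈ Metric.ball c s \ {c}, AnalyticAt ℂ F t := fun t ht =>
      hF t (Metric.ball_subset_closedBall (hball t ht.1).2) ((hball t ht.1).1 ht.2)
    have hd := Complex.differentiableOn_update_limUnder_of_bddAbove (f := F) (c := c)
      (Metric.ball_mem_nhds c hs)
      (fun t ht => (hFa t ht).differentiableAt.differentiableWithinAt)
      ⟨1, by
        rintro _ ⟨t, ht, rfl⟩
        exact hb t (Metric.ball_subset_closedBall (hball t ht.1).2)⟩
    refine (hd.differentiableAt (Metric.ball_mem_nhds c hs)).congr_of_eventuallyEq ?_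
    filter_upwards [Metric.ball_mem_nhds c hs] with t ht
    by_cases htc : t = c
    · subst htc
      simp [G]
    · rw [update_of_ne htc, hGF t (hFa t ⟨ht, htc⟩).continuousAt]
  have hGb : ∀ c ∈ Metric.ball (0 : ℂ) 1, ‖G c‖ ≤ 1 := by
    intro c hc
    have h2 : Tendsto G (𝓝[≠] c) (𝓝 (G c)) :=
      (hG c hc).continuousAt.tendsto.mono_left nhdsWithin_le_nhds
    refine le_of_tendsto h2.norm ?_
    have hball : ∀ᶠ t in 𝓝[≠] c, t ∈ Metric.ball (0 : ℂ) 1 :=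
      (Metric.isOpen_ball.eventually_mem hc).filter_mono nhdsWithin_le_nhds
    filter_upwards [hne c (Metric.ball_subset_closedBall hc), hball] with t ht ht'
    have ht'' := Metric.ball_subset_closedBall ht'
    rw [hGF t (hF t ht'' ht).continuousAt]
    exact hb t ht''
  have hG0 : G 0 = 1 := h0.limUnder_eq
  have hG1 : EqOn G (const ℂ (G 0)) (Metric.ball 0 1) :=
    Complex.eqOn_of_isPreconnected_of_isMaxOn_norm (convex_ball _ _).isPreconnected
      Metric.isOpen_ball (fun c hc => (hG c hc).differentiableWithinAt) (Metric.mem_ball_self one_pos)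
      (fun c hc => by simpa [hG0] using hGb c hc)
  have hF1 := hF 1 (by simp) h1
  have hcl : (1 : ℂ) ∈ closure (Metric.ball (0 : ℂ) 1) := by
    rw [closure_ball _ one_ne_zero]
    simp
  have : (𝓝[Metric.ball (0 : ℂ) 1] 1).NeBot := mem_closure_iff_nhdsWithin_neBot.1 hcl
  refine tendsto_nhds_unique (hF1.continuousAt.continuousWithinAt (s := Metric.ball (0 : ℂ) 1)) ?_
  refine tendsto_const_nhds.congr' ?_
  have hφ1 := (hφ 1 (by simp)).continuousAt.eventually_ne h1
  filter_upwards [eventually_mem_nhdsWithin, hφ1.filter_mono nhdsWithin_le_nhds] with t ht hφt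
  rw [← hGF t (hF t (Metric.ball_subset_closedBall ht) hφt).continuousAt, hG1 ht, hG0]
  rfl

variable {E : Type*} [NormedAddCommGroup E] [NormedSpace ℂ E]

lemma eq_zero_of_eventually_eq_zero {f : E → ℂ} {B : Set E} (hB : Convex ℝ B)
    (hf : ∀ y ∈ B, HolAt f y) {a : E} (ha : a ∈ B) (h0 : ∀ᶠ y in 𝓝 a, f y = 0) :
    ∀ y ∈ B, f y = 0 := by
  intro y hy
  have hseg : ∀ t ∈ segment ℝ (0 : ℂ) 1, a + t • (y - a) ∈ B := by
    rintro t ⟨α, β, hα, hβ, hαβ, rfl⟩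
    have : a + (α • (0 : ℂ) + β • (1 : ℂ)) • (y - a) = α • a + β • y := by
      have h1 : α = 1 - β := by linarith
      subst h1
      simp only [smul_zero, zero_add, smul_assoc, one_smul, smul_sub, sub_smul]
      abel
    rw [this]
    exact hB ha hy hα hβ hαβ
  have hana : AnalyticOnNhd ℂ (fun t : ℂ => f (a + t • (y - a))) (segment ℝ (0 : ℂ) 1) :=
    fun t ht => (hf _ (hseg t ht)).analyticAt_line
  have hc : Tendsto (fun t : ℂ => a + t • (y - a)) (𝓝 0) (𝓝 a) := by
    have : Continuous (fun t : ℂ => a + t • (y - a)) := by fun_prop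
    simpa using this.tendsto 0
  have := hana.eqOn_zero_of_preconnected_of_eventuallyEq_zero
    (convex_segment _ _).isPreconnected (left_mem_segment ℝ _ _) (hc.eventually h0)
    (right_mem_segment ℝ _ _)
  simpa using this

lemma not_eventually_prod_eq_zero {ι : Type*} (s : Finset ι) {f : ι → E → ℂ} {B : Set E}
    (hB : Convex ℝ B) (hBo : IsOpen B) {a : E} (ha : a ∈ B) (hf : ∀ i ∈ s, ∀ y ∈ B, HolAt (f i) y)
    (h : ∀ i ∈ s, ¬ ∀ᶠ y in 𝓝 a, f i y = 0) : ¬ ∀ᶠ y in 𝓝 a, ∏ i ∈ s, f i y = 0 := by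
  classical
  induction s using Finset.induction_on with
  | empty => simpa using NeBot.ne inferInstance
  | insert i s hi ih =>
    intro h0
    simp only [Finset.prod_insert hi] at h0
    have hprod : ∀ y ∈ B, HolAt (fun y => ∏ i ∈ s, f i y) y := fun y hy =>
      HolAt.finset_prod fun j hj => hf j (by simp [hj]) y hy
    have h0' := eq_zero_of_eventually_eq_zero hB
      (fun y hy => (hf i (by simp) y hy).mul (hprod y hy)) ha h0
    refine h i (by simp) ?_
    filter_upwards [hBo.mem_nhds ha] with b hb
    by_contra hne
    refine ih (fun j hj => hf j (by simp [hj])) (fun j hj => h j (by simp [hj])) ?_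
    have hz := eq_zero_of_eventually_eq_zero hB hprod hb (by
      filter_upwards [hBo.mem_nhds hb, (hf i (by simp) b hb).continuousAt.eventually_ne hne]
        with y hy hy'
      exact (mul_eq_zero.1 (h0' y hy)).resolve_left hy')
    filter_upwards [hBo.mem_nhds ha] with y hy using hz y hy

/-- A holomorphic germ which is not zero is not zero along some complex line. -/
lemma exists_line_not_eventually_zero [Nontrivial E] {g : E → ℂ} (hg : HolAt g 0)
    (h0 : ¬ ∀ᶠ y in 𝓝 0, g y = 0) : ∃ v : E, v ≠ 0 ∧ ¬ ∀ᶠ t in 𝓝 (0 : ℂ), g (t • v) = 0 := by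
  by_contra! hall
  refine h0 ?_
  obtain ⟨δ, hδ, hball⟩ := Metric.eventually_nhds_iff_ball.1 hg.eventually
  filter_upwards [Metric.ball_mem_nhds (0 : E) hδ] with y hy
  by_cases hy0 : y = 0
  · obtain ⟨v, hv⟩ := exists_ne (0 : E)
    simpa [hy0] using (hall v hv).self_of_nhds
  · have hana : AnalyticOnNhd ℂ (fun t : ℂ => g (t • y)) (Metric.closedBall 0 1) := by
      intro t ht
      have : HolAt g (0 + t • y) := by
        refine hball _ ?_
        rw [mem_ball_zero_iff, zero_add, norm_smul]
        rw [mem_ball_zero_iff] at hy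
        rw [mem_closedBall_zero_iff] at ht
        nlinarith [norm_nonneg y]
      simpa using this.analyticAt_line
    have := hana.eqOn_zero_of_preconnected_of_eventuallyEq_zero
      (convex_closedBall _ _).isPreconnected (by simp) (hall y hy0) (x := 1) (by simp)
    simpa using this

end LocalAnalytic

namespace LocalAnalytic

variable {ι : Type*} {E : Type*} [NormedAddCommGroup E] [NormedSpace ℂ E]
variable {E' : Type*} [NormedAddCommGroup E'] [NormedSpace ℂ E']

/-- Two points lie in the same members of the family `A`. -/
def SameCell (A : ι → Set E) (y z : E) : Prop := ∀ i, z ∈ A i ↔ y ∈ A i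

/-- `f` is holomorphic along the cells of the family `A`: near each point `y`, it agrees on the
cell of `y` with a holomorphic function. -/
def StratHol (A : ι → Set E) (P : Set E) (f : E → ℂ) : Prop :=
  ∀ y ∈ P, ∃ F, HolAt F y ∧ ∀ᶠ z in 𝓝 y, SameCell A y z → f z = F z

lemma StratHol.const_mul {A : ι → Set E} {P : Set E} {f : E → ℂ} (h : StratHol A P f) (c : ℂ) :
    StratHol A P (fun z => c * f z) := by
  intro y hy
  obtain ⟨F, hF, hFe⟩ := h y hy
  exact ⟨_, (HolAt.const c y).mul hF, hFe.mono fun z hz hzc => by simp only [hz hzc]⟩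

lemma StratHol.pow {A : ι → Set E} {P : Set E} {f : E → ℂ} (h : StratHol A P f) (n : ℕ) :
    StratHol A P (fun z => f z ^ n) := by
  intro y hy
  obtain ⟨F, hF, hFe⟩ := h y hy
  exact ⟨_, hF.pow n, hFe.mono fun z hz hzc => by simp only [hz hzc]⟩

/-- `P` is a neighbourhood of the origin on which functions holomorphic along the cells of `A`
satisfy the maximum principle and the identity theorem at the origin. -/
structure Rigid (A : ι → Set E) (P : Set E) : Prop where
  isOpen : IsOpen P
  zero_mem : (0 : E) ∈ P
  balanced : ∀ y ∈ P, ∀ t : ℂ, ‖t‖ ≤ 1 → t • y ∈ P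
  eq_one : ∀ f, StratHol A P f → (∀ y ∈ P, ‖f y‖ ≤ 1) → Tendsto f (𝓝 0) (𝓝 1) → ∀ y ∈ P, f y = 1
  eq_zero : ∀ f, StratHol A P f → (∀ᶠ y in 𝓝 0, f y = 0) → ∀ y ∈ P, f y = 0

lemma IsZeroSetOn.preimage {Z V : Set E} (h : IsZeroSetOn Z V) (e : E' →L[ℂ] E) :
    IsZeroSetOn (e ⁻¹' Z) (e ⁻¹' V) := by
  obtain ⟨hV, F, hF, hZ⟩ := h
  refine ⟨hV.preimage e.continuous, (fun f => f ∘ e) '' F, ?_, ?_⟩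
  · rintro _ ⟨f, hf, rfl⟩ y hy
    exact (hF f hf (e y) hy).comp_linear e
  · intro z hz
    rw [mem_preimage, hZ _ hz]
    simp

lemma Rigid.preimage {A : ι → Set E} {P : Set E'} (e : E ≃L[ℂ] E')
    (h : Rigid (fun i => e.symm ⁻¹' (A i)) P) : Rigid A (e ⁻¹' P) := by
  have hs : ∀ f, StratHol A (e ⁻¹' P) f → StratHol (fun i => e.symm ⁻¹' (A i)) P (f ∘ e.symm) := by
    intro f hf y hy
    obtain ⟨F, hF, hFe⟩ := hf (e.symm y) (by simpa using hy)
    refine ⟨F ∘ e.symm, HolAt.comp_linear (e.symm : E' →L[ℂ] E) hF, ?_⟩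
    filter_upwards [e.symm.continuous.continuousAt.eventually hFe] with z hz hzc
    exact hz hzc
  have ht : Tendsto e.symm (𝓝 0) (𝓝 0) := by
    simpa using e.symm.continuous.tendsto 0
  refine ⟨h.isOpen.preimage e.continuous, by simpa using h.zero_mem, fun y hy t htn => ?_,
    fun f hf hb h1 y hy => ?_, fun f hf h0 y hy => ?_⟩
  · rw [mem_preimage, map_smul]
    exact h.balanced _ hy t htn
  · have := h.eq_one _ (hs f hf) (fun z hz => hb _ (by simpa using hz)) (h1.comp ht) (e y) hy
    simpa using this
  · have := h.eq_zero _ (hs f hf) (ht.eventually h0) (e y) hy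
    simpa using this

/-- `g` vanishes on each of the sets `A i` which is not a neighbourhood of the origin. -/
structure Discriminant (g : E → ℂ) (A : ι → Set E) (V : Set E) : Prop where
  hol : HolAt g 0
  isOpen : IsOpen V
  zero_mem : (0 : E) ∈ V
  zeroSet : ∀ i, IsZeroSetOn (A i) V
  full_or : ∀ i, V ⊆ A i ∨ ∀ y ∈ V, y ∈ A i → g y = 0

lemma Discriminant.preimage {g : E → ℂ} {A : ι → Set E} {V : Set E} (h : Discriminant g A V)
    (e : E' →L[ℂ] E) : Discriminant (g ∘ e) (fun i => e ⁻¹' (A i)) (e ⁻¹' V) := by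
  refine ⟨HolAt.comp_linear e (by simpa using h.hol), h.isOpen.preimage e.continuous,
    by simpa using h.zero_mem, fun i => (h.zeroSet i).preimage e, fun i => ?_⟩
  rcases h.full_or i with hi | hi
  · exact Or.inl (preimage_mono hi)
  · exact Or.inr fun y hy hyA => hi _ hy hyA

lemma exists_discriminant [Finite ι] {A : ι → Set E} (hA : ∀ i, AnGerm (A i)) :
    ∃ g V, Discriminant g A V ∧ ¬ ∀ᶠ y in 𝓝 0, g y = 0 := by
  classical
  have := Fintype.ofFinite ι
  obtain ⟨V, h0V, hVo, hV⟩ := exists_isZeroSetOn hA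
  obtain ⟨δ, hδ, hball⟩ := Metric.isOpen_iff.1 hVo 0 h0V
  have hB : ∀ i, IsZeroSetOn (A i) (Metric.ball 0 δ) := fun i =>
    (hV i).mono Metric.isOpen_ball hball
  have h0 := Metric.mem_ball_self (x := (0 : E)) hδ
  have hconv : Convex ℝ (Metric.ball (0 : E) δ) := convex_ball _ _
  have hex : ∀ i, ∃ f : E → ℂ, (∀ y ∈ Metric.ball (0 : E) δ, HolAt f y) ∧
      (¬ ∀ᶠ y in 𝓝 0, f y = 0) ∧
      (Metric.ball (0 : E) δ ⊆ A i ∨ ∀ y ∈ Metric.ball (0 : E) δ, y ∈ A i → f y = 0) := by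
    intro i
    obtain ⟨-, F, hF, hAF⟩ := hB i
    by_cases hfull : ∀ f ∈ F, ∀ᶠ y in 𝓝 0, f y = 0
    · refine ⟨fun _ => 1, fun y _ => HolAt.const _ _, by simpa using NeBot.ne inferInstance,
        Or.inl fun y hy => (hAF y hy).2 fun f hf => ?_⟩
      exact eq_zero_of_eventually_eq_zero hconv (hF f hf) h0 (hfull f hf) y hy
    · push Not at hfull
      obtain ⟨f, hf, hne⟩ := hfull
      refine ⟨f, hF f hf, ?_, Or.inr fun y hy hyA => (hAF y hy).1 hyA f hf⟩
      simpa using hne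
  choose f hf hne hor using hex
  refine ⟨fun y => ∏ i, f i y, Metric.ball 0 δ, ⟨HolAt.finset_prod fun i _ => hf i 0 h0,
    Metric.isOpen_ball, h0, hB, fun i => (hor i).imp_right fun h y hy hyA => ?_⟩,
    not_eventually_prod_eq_zero _ hconv Metric.isOpen_ball h0 (fun i _ => hf i) (fun i _ => hne i)⟩
  exact Finset.prod_eq_zero (Finset.mem_univ i) (h y hy hyA)

/-- Along the line through a point of the big cell, there is a holomorphic function of one variable
off whose zero set the cell does not change. -/
lemma exists_analytic_along_line [Finite ι] {A : ι → Set E} {V P : Set E}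
    (hA : ∀ i, IsZeroSetOn (A i) V) (hPV : P ⊆ V)
    (hbal : ∀ y ∈ P, ∀ t : ℂ, ‖t‖ ≤ 1 → t • y ∈ P) {y : E} (hy : y ∈ P)
    (hcell : ∀ i, V ⊆ A i ∨ y ∉ A i) (hVo : IsOpen V) {f : E → ℂ} (hf : StratHol A P f) :
    ∃ φ : ℂ → ℂ, AnalyticOnNhd ℂ φ (Metric.closedBall 0 1) ∧ φ 1 ≠ 0 ∧
      ∀ t ∈ Metric.closedBall (0 : ℂ) 1, φ t ≠ 0 → AnalyticAt ℂ (fun s : ℂ => f (s • y)) t := by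
  classical
  have := Fintype.ofFinite ι
  have hex : ∀ i, ∃ b : E → ℂ, (∀ z ∈ V, HolAt b z) ∧ b y ≠ 0 ∧
      (V ⊆ A i ∨ ∀ z ∈ V, b z ≠ 0 → z ∉ A i) := by
    intro i
    rcases hcell i with h | h
    · exact ⟨fun _ => 1, fun _ _ => HolAt.const _ _, one_ne_zero, Or.inl h⟩
    · obtain ⟨-, F, hF, hAF⟩ := hA i
      rw [hAF y (hPV hy)] at h
      push Not at h
      obtain ⟨b, hb, hby⟩ := h
      exact ⟨b, hF b hb, hby, Or.inr fun z hz hbz hzA => hbz ((hAF z hz).1 hzA b hb)⟩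
  choose b hbh hby hbor using hex
  have hmem : ∀ t ∈ Metric.closedBall (0 : ℂ) 1, t • y ∈ P := fun t ht =>
    hbal y hy t (by simpa using ht)
  have hprod : ∀ z ∈ V, HolAt (fun z => ∏ i, b i z) z := fun z hz =>
    HolAt.finset_prod fun i _ => hbh i z hz
  refine ⟨fun t => ∏ i, b i (t • y), fun t ht => ?_, ?_, fun t ht hne => ?_⟩
  · have : HolAt (fun z => ∏ i, b i z) (0 + t • y) := by
      simpa using hprod _ (hPV (hmem t ht))
    simpa using this.analyticAt_line
  · simpa [Finset.prod_ne_zero_iff] using hby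
  · obtain ⟨F, hF, hFe⟩ := hf _ (hmem t ht)
    have hF' : HolAt F (0 + t • y) := by simpa using hF
    have hFa : AnalyticAt ℂ (fun s : ℂ => F (s • y)) t := by simpa using hF'.analyticAt_line
    refine hFa.congr ?_
    have hc : ContinuousAt (fun s : ℂ => s • y) t := by fun_prop
    have hne' : ∀ᶠ z in 𝓝 (t • y), ∏ i, b i z ≠ 0 :=
      (hprod _ (hPV (hmem t ht))).continuousAt.eventually_ne hne
    filter_upwards [hc.eventually (hFe.and (hne'.and (hVo.eventually_mem (hPV (hmem t ht)))))]
      with s hs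
    refine (hs.1 fun i => ?_).symm
    rcases hbor i with h | h
    · exact iff_of_true (h hs.2.2) (h (hPV (hmem t ht)))
    · exact iff_of_false (h _ hs.2.2 (Finset.prod_ne_zero_iff.1 hs.2.1 i (Finset.mem_univ i)))
        (h _ (hPV (hmem t ht)) (Finset.prod_ne_zero_iff.1 hne i (Finset.mem_univ i)))

end LocalAnalytic

namespace LocalAnalytic

variable {ι : Type*} {E : Type*}

lemma rootCount_le {d : ℕ} (ρ : E → Fin d → ℂ) (A : Set (E × ℂ)) (z : E) :
    rootCount ρ A z ≤ d := by
  have := Set.ncard_le_ncard (subset_univ {i | (z, ρ z i) ∈ A})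
  simpa [rootCount, Set.ncard_univ] using this

/-- The cells on the base induced by counting the roots in each member of the family. -/
def rootCells {d : ℕ} (ρ : E → Fin d → ℂ) (A : ι → Set (E × ℂ)) (p : ι × Fin (d + 1)) : Set E :=
  {z | (p.2 : ℕ) ≤ rootCount ρ (A p.1) z}

lemma SameCell.rootCount_eq {d : ℕ} {ρ : E → Fin d → ℂ} {A : ι → Set (E × ℂ)} {y z : E}
    (h : SameCell (rootCells ρ A) y z) (j : ι) :
    rootCount ρ (A j) z = rootCount ρ (A j) y := by
  apply le_antisymm
  · exact (h (j, ⟨rootCount ρ (A j) z, Nat.lt_succ_of_le (rootCount_le _ _ _)⟩)).1 (le_refl (rootCount ρ (A j) z))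
  · exact (h (j, ⟨rootCount ρ (A j) y, Nat.lt_succ_of_le (rootCount_le _ _ _)⟩)).2 (le_refl (rootCount ρ (A j) y))

variable [NormedAddCommGroup E] [NormedSpace ℂ E]

/-- Summing over the roots a function holomorphic along cells yields such a function. -/
lemma LocalRoots.stratHol_sum [Finite ι] {g : E × ℂ → ℂ} {d : ℕ} {ρ : E → Fin d → ℂ} {D : Set E}
    {r : ℝ} (h : LocalRoots g ρ D r) {A : ι → Set (E × ℂ)} {V : Set (E × ℂ)}
    (hV : D ×ˢ Metric.ball 0 r ⊆ V) (hA : ∀ j, IsZeroSetOn (A j) V) {f : E × ℂ → ℂ}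
    (hf : StratHol A (D ×ˢ Metric.ball 0 r) f) :
    StratHol (rootCells ρ A) D (fun z => ∑ i, f (z, ρ z i)) := by
  classical
  intro z₀ hz₀
  have hf' : ∀ b ∈ Metric.ball (0 : ℂ) r, ∃ F, HolAt F (z₀, b) ∧
      ∀ᶠ y in 𝓝 (z₀, b), SameCell A (z₀, b) y → f y = F y := fun b hb => hf (z₀, b) ⟨hz₀, hb⟩
  choose! F hF hFe using hf'
  have hroot := h.root_mem hz₀
  have hev : ∀ i, ∀ᶠ δ in 𝓝[>] (0 : ℝ), ∀ y, dist y (z₀, ρ z₀ i) < δ →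
      HolAt (F (ρ z₀ i)) y ∧ (SameCell A (z₀, ρ z₀ i) y → f y = F (ρ z₀ i) y) ∧
        ∀ j, (z₀, ρ z₀ i) ∉ A j → y ∉ A j := by
    intro i
    have h3 : ∀ᶠ y in 𝓝 (z₀, ρ z₀ i), ∀ j, (z₀, ρ z₀ i) ∉ A j → y ∉ A j := by
      refine eventually_all.2 fun j => ?_
      by_cases hj : (z₀, ρ z₀ i) ∈ A j
      · exact Eventually.of_forall fun y hy => (hy hj).elim
      · exact ((hA j).eventually_notMem (hV ⟨hz₀, hroot i⟩) hj).mono fun y hy _ => hy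
    obtain ⟨δ, hδ, hy⟩ := Metric.eventually_nhds_iff.1
      ((hF _ (hroot i)).eventually.and ((hFe _ (hroot i)).and h3))
    filter_upwards [Ioo_mem_nhdsGT hδ] with δ' hδ' y hyd
    exact hy (hyd.trans hδ'.2)
  obtain ⟨δ, hδ, hδ0⟩ := ((eventually_all.2 hev).and self_mem_nhdsWithin).exists
  obtain ⟨ε, hε, hεδ, hcb, hsph, hperm⟩ := h.exists_perm hz₀ hδ0
  have hG : ∀ b ∈ Finset.univ.image (ρ z₀), ∃ G, HolAt G z₀ ∧
      ∀ᶠ y in 𝓝 z₀, G y = ∑ i with ρ y i ∈ Metric.ball b ε, F b (y, ρ y i) := by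
    intro b hb
    obtain ⟨i, -, rfl⟩ := Finset.mem_image.1 hb
    refine h.exists_holAt_sum hz₀ hε (hcb i) (hsph i) fun w hw => (hδ i _ ?_).1
    rw [Prod.dist_eq, dist_self]
    exact max_lt hδ0 ((Metric.mem_closedBall.1 hw).trans_lt hεδ)
  choose! G hGh hGe using hG
  refine ⟨fun z => ∑ b ∈ Finset.univ.image (ρ z₀), G b z, HolAt.finset_sum hGh, ?_⟩
  filter_upwards [hperm, (Finset.eventually_all _).2 hGe, Metric.ball_mem_nhds z₀ hδ0]
    with z hσ hGz hzδ hcell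
  obtain ⟨σ, hσ⟩ := hσ
  have hnear : ∀ i, dist (z, ρ z (σ i)) (z₀, ρ z₀ i) < δ := fun i =>
    max_lt hzδ ((Metric.mem_ball.1 ((hσ i i).2 rfl)).trans hεδ)
  have hsame : ∀ i, SameCell A (z₀, ρ z₀ i) (z, ρ z (σ i)) := by
    intro i j
    have hsub : {i | (z, ρ z (σ i)) ∈ A j} ⊆ {i | (z₀, ρ z₀ i) ∈ A j} := fun i hi => by
      by_contra hn
      exact (hδ i _ (hnear i)).2.2 j hn hi
    have hcard : {i | (z, ρ z (σ i)) ∈ A j}.ncard = rootCount ρ (A j) z :=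
      Set.ncard_preimage_of_injective_subset_range (f := σ)
        (s := {i | (z, ρ z i) ∈ A j}) σ.injective (by simp)
    have heq := Set.eq_of_subset_of_ncard_le hsub (by
      rw [hcard, hcell.rootCount_eq j]; rfl) (Set.toFinite _)
    exact Set.ext_iff.1 heq i
  calc ∑ i, f (z, ρ z i) = ∑ i, f (z, ρ z (σ i)) :=
        (Equiv.sum_comp σ fun i => f (z, ρ z i)).symm
    _ = ∑ i, F (ρ z₀ i) (z, ρ z (σ i)) :=
        Finset.sum_congr rfl fun i _ => (hδ i _ (hnear i)).2.1 (hsame i)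
    _ = ∑ b ∈ Finset.univ.image (ρ z₀), ∑ i with ρ z₀ i = b, F (ρ z₀ i) (z, ρ z (σ i)) :=
        (Finset.sum_fiberwise_of_maps_to (fun i hi => Finset.mem_image_of_mem _ hi) _).symm
    _ = ∑ b ∈ Finset.univ.image (ρ z₀), G b z := by
        refine Finset.sum_congr rfl fun b hb => ?_
        rw [hGz b hb]
        obtain ⟨j, -, rfl⟩ := Finset.mem_image.1 hb
        rw [Finset.sum_filter, Finset.sum_filter]
        refine Eq.trans ?_ (Equiv.sum_comp σ _)
        refine Finset.sum_congr rfl fun i _ => ?_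
        by_cases hij : ρ z₀ i = ρ z₀ j
        · rw [if_pos hij, if_pos ((hσ i j).2 hij), hij]
        · rw [if_neg hij, if_neg (mt (hσ i j).1 hij)]

end LocalAnalytic

namespace LocalAnalytic

lemma eq_one_of_sum_eq_card {d : ℕ} {x : Fin d → ℂ} (hx : ∀ i, ‖x i‖ ≤ 1)
    (hs : ∑ i, x i = d) (i : Fin d) : x i = 1 := by
  have hre : ∀ j, (x j).re ≤ 1 := fun j => (Complex.re_le_norm _).trans (hx j)
  have hsum : ∑ j, (1 - (x j).re) = 0 := by
    have := congrArg Complex.re hs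
    simp at this
    simp [this]
  have h1 : (x i).re = 1 := by
    have := (Finset.sum_eq_zero_iff_of_nonneg fun j _ => sub_nonneg.2 (hre j)).1 hsum i
      (Finset.mem_univ i)
    linarith
  have h2 : (x i).im = 0 := by
    have h3 := Complex.sq_norm (x i)
    rw [Complex.normSq_apply, h1] at h3
    have h4 := hx i
    have h5 := norm_nonneg (x i)
    nlinarith [mul_self_nonneg (x i).im]
  exact Complex.ext h1 h2

variable {ι : Type*} {E : Type*} [NormedAddCommGroup E] [NormedSpace ℂ E]

lemma LocalRoots.tendsto_root {g : E × ℂ → ℂ} {d : ℕ} {ρ : E → Fin d → ℂ} {D : Set E}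
    {r : ℝ} (h : LocalRoots g ρ D r) (i : Fin d) :
    Tendsto (fun z => (z, ρ z i)) (𝓝 0) (𝓝 (0 : E × ℂ)) := by
  refine Tendsto.prodMk_nhds tendsto_id (Metric.tendsto_nhds.2 fun ε hε => ?_)
  exact (h.eventually_roots_mem_ball hε).mono fun z hz => hz i

/-- Rigidity of the base with its induced cells implies rigidity upstairs. -/
lemma LocalRoots.rigid [Finite ι] {g : E × ℂ → ℂ} {d : ℕ} {ρ : E → Fin d → ℂ} {D : Set E}
    {r : ℝ} (h : LocalRoots g ρ D r) {A : ι → Set (E × ℂ)} {V : Set (E × ℂ)}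
    (hg : Discriminant g A V) (hV : D ×ˢ Metric.ball 0 r ⊆ V)
    (hR : Rigid (rootCells ρ A) D) : Rigid A (D ×ˢ Metric.ball 0 r) := by
  have hbal : ∀ y ∈ D ×ˢ Metric.ball (0 : ℂ) r, ∀ t : ℂ, ‖t‖ ≤ 1 →
      t • y ∈ D ×ˢ Metric.ball (0 : ℂ) r := by
    rintro ⟨z, w⟩ ⟨hz, hw⟩ t ht
    refine ⟨hR.balanced z hz t ht, ?_⟩
    simp only [mem_ball_zero_iff, Prod.smul_mk, smul_eq_mul, norm_mul] at hw ⊢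
    nlinarith [norm_nonneg w]
  have hbig : ∀ y ∈ D ×ˢ Metric.ball (0 : ℂ) r, g y ≠ 0 → ∀ i, V ⊆ A i ∨ y ∉ A i :=
    fun y hy hgy i => (hg.full_or i).imp_right fun hi hyA => hgy (hi y (hV hy) hyA)
  have hroot : ∀ z ∈ D, ∀ i, (z, ρ z i) ∈ D ×ˢ Metric.ball (0 : ℂ) r := fun z hz i =>
    ⟨hz, h.root_mem hz i⟩
  have hline : ∀ y : E × ℂ, Tendsto (fun s : ℂ => s • y) (𝓝 0) (𝓝 0) := fun y => by
    have : ContinuousAt (fun s : ℂ => s • y) 0 := by fun_prop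
    simpa [ContinuousAt] using this
  refine ⟨h.isOpen.prod Metric.isOpen_ball, ⟨h.zero_mem, Metric.mem_ball_self h.r_pos⟩, hbal,
    fun f hf hb h1 y hy => ?_, fun f hf h0 y hy => ?_⟩
  · by_cases hgy : g y = 0
    · obtain ⟨z, w⟩ := y
      obtain ⟨hz, hw⟩ := mem_prod.1 hy
      dsimp only at hz hw
      obtain ⟨i, rfl⟩ := (h.eq_zero_iff hz (Metric.ball_subset_closedBall hw)).1 hgy
      have hd : (d : ℂ) ≠ 0 := by
        have := i.pos
        exact_mod_cast this.ne'
      have hm := hR.eq_one (fun z => (d : ℂ)⁻¹ * ∑ i, f (z, ρ z i))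
        ((h.stratHol_sum hV hg.zeroSet hf).const_mul _) (fun z hz => ?_) ?_ z hz
      · refine eq_one_of_sum_eq_card (x := fun i => f (z, ρ z i)) (fun i => hb _ (hroot z hz i)) ?_ i
        field_simp at hm
        exact hm
      · have hle : ‖∑ i, f (z, ρ z i)‖ ≤ d := by
          refine (norm_sum_le _ _).trans ?_
          refine (Finset.sum_le_sum fun i _ => hb _ (hroot z hz i)).trans ?_
          simp
        rw [norm_mul, norm_inv, Complex.norm_natCast]
        exact inv_mul_le_one_of_le₀ hle (Nat.cast_nonneg d)
      · have ht : Tendsto (fun z => ∑ i, f (z, ρ z i)) (𝓝 0) (𝓝 (∑ i : Fin d, 1)) :=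
          tendsto_finsetSum _ fun i _ => h1.comp (h.tendsto_root i)
        have := ht.const_mul (d : ℂ)⁻¹
        simpa [hd] using this
    · obtain ⟨φ, hφ, hφ1, hφa⟩ := exists_analytic_along_line hg.zeroSet hV hbal hy
        (hbig y hy hgy) hg.isOpen hf
      have := apply_one_eq_one hφ hφ1 hφa
        (fun t ht => hb _ (hbal y hy t (by simpa using ht)))
        ((h1.comp (hline y)).mono_left nhdsWithin_le_nhds)
      simpa using this
  · by_cases hgy : g y = 0
    · obtain ⟨z, w⟩ := y
      obtain ⟨hz, hw⟩ := mem_prod.1 hy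
      dsimp only at hz hw
      obtain ⟨i, rfl⟩ := (h.eq_zero_iff hz (Metric.ball_subset_closedBall hw)).1 hgy
      refine eq_zero_of_forall_powerSum_eq_zero (x := fun i => f (z, ρ z i)) (fun j hj => ?_) i
      refine hR.eq_zero (fun z => ∑ i, f (z, ρ z i) ^ j)
        (h.stratHol_sum hV hg.zeroSet (hf.pow j)) ?_ z hz
      have hall : ∀ᶠ z in 𝓝 (0 : E), ∀ i, f (z, ρ z i) = 0 :=
        eventually_all.2 fun i => (h.tendsto_root i).eventually h0
      filter_upwards [hall] with z hz
      exact Finset.sum_eq_zero fun i _ => by rw [hz i, zero_pow (by omega)]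
    · obtain ⟨φ, hφ, hφ1, hφa⟩ := exists_analytic_along_line hg.zeroSet hV hbal hy
        (hbig y hy hgy) hg.isOpen hf
      have := apply_one_eq_zero hφ hφ1 hφa ((hline y).eventually h0)
      simpa using this

/-- Linear coordinates in which a given nonzero vector is the last basis vector. -/
lemma exists_equiv_prod {E : Type} [NormedAddCommGroup E] [NormedSpace ℂ E]
    [FiniteDimensional ℂ E] {v : E} (hv : v ≠ 0) :
    ∃ (H : Submodule ℂ E) (e : E ≃L[ℂ] H × ℂ), (∀ t : ℂ, e.symm (0, t) = t • v) ∧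
      Module.finrank ℂ H + 1 = Module.finrank ℂ E := by
  obtain ⟨φ, hφ⟩ := SeparatingDual.exists_eq_one (R := ℂ) hv
  let s : ℂ →L[ℂ] E := ContinuousLinearMap.toSpanSingleton ℂ v
  have hs : Function.RightInverse s φ := fun t => by simp [s, hφ]
  let e := (ContinuousLinearEquiv.equivOfRightInverse φ s hs).trans
    (ContinuousLinearEquiv.prodComm ℂ ℂ φ.ker)
  refine ⟨φ.ker, e, fun t => ?_, ?_⟩
  · simp [e, s]
  · have := e.toLinearEquiv.finrank_eq
    rw [this]
    simp

/-- Arbitrarily small rigid neighbourhoods of the origin exist for every finite family of analytic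
germs. -/
theorem exists_rigid {E : Type} [NormedAddCommGroup E] [NormedSpace ℂ E] [FiniteDimensional ℂ E]
    {ι : Type} [Finite ι] {A : ι → Set E} (hA : ∀ i, AnGerm (A i)) {V : Set E} (hV : V ∈ 𝓝 0) :
    ∃ P ⊆ V, Rigid A P := by
  induction hn : Module.finrank ℂ E generalizing E ι with
  | zero =>
    have : Subsingleton E := Module.finrank_zero_iff.1 hn
    refine ⟨V, subset_rfl, ?_, mem_of_mem_nhds hV, fun y hy t _ => Subsingleton.elim y (t • y) ▸ hy,
      fun f hf hb h1 y hy => ?_, fun f hf h0 y hy => ?_⟩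
    · exact isOpen_discrete V
    · rw [Subsingleton.elim y 0]
      have hc : Tendsto f (𝓝 0) (𝓝 (f 0)) := continuous_of_discreteTopology.tendsto 0
      exact tendsto_nhds_unique hc h1
    · rw [Subsingleton.elim y 0]
      exact h0.self_of_nhds
  | succ n ih =>
    have : Nontrivial E := Module.nontrivial_of_finrank_eq_succ hn
    obtain ⟨g, W, hg, hg0⟩ := exists_discriminant hA
    obtain ⟨v, hv, hgv⟩ := exists_line_not_eventually_zero hg.hol hg0
    obtain ⟨H, e, hev, hH⟩ := exists_equiv_prod hv
    have hge := hg.preimage (e.symm : H × ℂ →L[ℂ] E)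
    have hne : ¬ ∀ᶠ w in 𝓝 (0 : ℂ), (g ∘ e.symm) ((0 : H), w) = 0 := by
      simpa only [comp_apply, hev] using hgv
    have hU : e.symm ⁻¹' (V ∩ W) ∈ 𝓝 (0 : H × ℂ) := by
      refine e.symm.continuous.continuousAt ?_
      rw [map_zero]
      exact inter_mem hV (hg.isOpen.mem_nhds hg.zero_mem)
    obtain ⟨d, ρ, D, r, hroots, hDr⟩ := exists_localRoots hge.hol hne hU
    have hAe : ∀ i, AnGerm (e.symm ⁻¹' A i) := fun i => ⟨_, hge.zero_mem, hge.zeroSet i⟩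
    obtain ⟨D', hD', hR⟩ := ih (A := rootCells ρ fun i => e.symm ⁻¹' A i)
      (fun p => hroots.anGerm_rootCount (hAe p.1) p.2) (hroots.isOpen.mem_nhds hroots.zero_mem)
      (by omega)
    have hsub : D' ×ˢ Metric.ball (0 : ℂ) r ⊆ e.symm ⁻¹' (V ∩ W) :=
      (Set.prod_mono hD' Metric.ball_subset_closedBall).trans hDr
    have hP := (hroots.mono hR.isOpen hR.zero_mem hD').rigid hge (hsub.trans inter_subset_right) hR
    refine ⟨_, ?_, hP.preimage e⟩
    intro y hy
    simpa using (hsub hy).1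

end LocalAnalytic

namespace LocalAnalytic

variable {E : Type*} [NormedAddCommGroup E] [NormedSpace ℂ E]

lemma AnGerm.preimage {E' : Type*} [NormedAddCommGroup E'] [NormedSpace ℂ E'] {Z : Set E}
    (h : AnGerm Z) (e : E' →L[ℂ] E) : AnGerm (e ⁻¹' Z) := by
  obtain ⟨V, h0, hV⟩ := h
  exact ⟨e ⁻¹' V, by simpa using h0, hV.preimage e⟩

/-- Reverse inclusion of germs at the origin. -/
def GermGE (A B : Set E) : Prop := ∀ᶠ z in 𝓝 (0 : E), z ∈ B → z ∈ A

instance : IsTrans (Set E) GermGE :=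
  ⟨fun _ _ _ h₁ h₂ => by filter_upwards [h₁, h₂] with z hz₁ hz₂ hz using hz₁ (hz₂ hz)⟩

lemma LocalRoots.eventually_subset {g : E × ℂ → ℂ} {d : ℕ} {ρ : E → Fin d → ℂ} {D : Set E}
    {r : ℝ} (h : LocalRoots g ρ D r) {A B : Set (E × ℂ)} (hAB : GermGE A B) :
    ∀ᶠ z in 𝓝 (0 : E), {i | (z, ρ z i) ∈ B} ⊆ {i | (z, ρ z i) ∈ A} := by
  have hall : ∀ᶠ z in 𝓝 (0 : E), ∀ i, (z, ρ z i) ∈ B → (z, ρ z i) ∈ A :=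
    eventually_all.2 fun i => (h.tendsto_root i).eventually hAB
  exact hall

lemma LocalRoots.germGE_rootCells {ι : Type*} {g : E × ℂ → ℂ} {d : ℕ} {ρ : E → Fin d → ℂ}
    {D : Set E} {r : ℝ} (h : LocalRoots g ρ D r) {B : ι → Set (E × ℂ)} {i j : ι}
    (hAB : GermGE (B i) (B j)) (k : Fin (d + 1)) :
    GermGE (rootCells ρ B (i, k)) (rootCells ρ B (j, k)) := by
  filter_upwards [h.eventually_subset hAB] with z hz hzk
  exact le_trans hzk (Set.ncard_le_ncard hz (Set.toFinite _))

/-- A downward directed family of analytic germs has a least element. -/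
theorem exists_least_germ {E : Type} [NormedAddCommGroup E] [NormedSpace ℂ E]
    [FiniteDimensional ℂ E] {ι : Type*} [Nonempty ι] {Z : ι → Set E} (hZ : ∀ i, AnGerm (Z i))
    (hdir : Directed GermGE Z) : ∃ i₀, ∀ i, GermGE (Z i) (Z i₀) := by
  induction hn : Module.finrank ℂ E generalizing E with
  | zero =>
    have : Subsingleton E := Module.finrank_zero_iff.1 hn
    by_cases h : ∃ i, (0 : E) ∉ Z i
    · obtain ⟨i, hi⟩ := h
      exact ⟨i, fun j => Eventually.of_forall fun z hz => absurd (Subsingleton.elim z 0 ▸ hz) hi⟩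
    · push Not at h
      exact ⟨Classical.arbitrary ι, fun j =>
        Eventually.of_forall fun z _ => Subsingleton.elim 0 z ▸ h j⟩
  | succ n ih =>
    have : Nontrivial E := Module.nontrivial_of_finrank_eq_succ hn
    by_cases hfull : ∀ i, ∀ᶠ z in 𝓝 0, z ∈ Z i
    · exact ⟨Classical.arbitrary ι, fun j => (hfull j).mono fun z hz _ => hz⟩
    rw [not_forall] at hfull
    obtain ⟨i₁, hi₁⟩ := hfull
    obtain ⟨g, W, hg, hg0⟩ := exists_discriminant (ι := Unit) (A := fun _ => Z i₁) fun _ => hZ i₁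
    have hgZ : ∀ y ∈ W, y ∈ Z i₁ → g y = 0 := by
      refine (hg.full_or ()).resolve_left fun hW => hi₁ ?_
      exact mem_of_superset (hg.isOpen.mem_nhds hg.zero_mem) hW
    obtain ⟨v, hv, hgv⟩ := exists_line_not_eventually_zero hg.hol hg0
    obtain ⟨H, e, hev, hH⟩ := exists_equiv_prod hv
    have hge := hg.preimage (e.symm : H × ℂ →L[ℂ] E)
    have hne : ¬ ∀ᶠ w in 𝓝 (0 : ℂ), (g ∘ e.symm) ((0 : H), w) = 0 := by
      simpa only [comp_apply, hev] using hgv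
    obtain ⟨d, ρ, D, r, hroots, hDr⟩ :=
      exists_localRoots hge.hol hne (hge.isOpen.mem_nhds hge.zero_mem)
    let B : ι → Set (H × ℂ) := fun i => e.symm ⁻¹' Z i
    have hB : ∀ i, AnGerm (B i) := fun i => (hZ i).preimage (e.symm : H × ℂ →L[ℂ] E)
    have hBle : ∀ i j, GermGE (Z i) (Z j) → GermGE (B i) (B j) := by
      intro i j hij
      have ht : Tendsto e.symm (𝓝 0) (𝓝 0) := by simpa using e.symm.continuous.tendsto 0
      exact ht.eventually hij
    have hmin : ∀ k : Fin (d + 1), ∃ m, ∀ i,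
        GermGE (rootCells ρ B (i, k)) (rootCells ρ B (m, k)) := by
      intro k
      refine ih (Z := fun i => rootCells ρ B (i, k))
        (fun i => hroots.anGerm_rootCount (hB i) k) (fun i j => ?_) (by omega)
      obtain ⟨l, hil, hjl⟩ := hdir i j
      exact ⟨l, hroots.germGE_rootCells (hBle _ _ hil) k,
        hroots.germGE_rootCells (hBle _ _ hjl) k⟩
    choose m hm using hmin
    obtain ⟨i₀, hi₀⟩ := hdir.finite_le fun o : Option (Fin (d + 1)) => o.elim i₁ m
    refine ⟨i₀, fun i => ?_⟩
    obtain ⟨j, hj₀, hji⟩ := hdir i₀ i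
    suffices hs : GermGE (B j) (B i₀) by
      have ht : Tendsto e (𝓝 0) (𝓝 0) := by simpa using e.continuous.tendsto 0
      filter_upwards [ht.eventually hs, hji] with z hz hzi hz₀
      refine hzi ?_
      have := hz (by simpa [B] using hz₀)
      simpa [B] using this
    have hcount : ∀ᶠ z in 𝓝 (0 : H), ∀ i, (z, ρ z i) ∈ B i₀ → (z, ρ z i) ∈ B j := by
      have hk : ∀ᶠ z in 𝓝 (0 : H), ∀ k : Fin (d + 1),
          z ∈ rootCells ρ B (i₀, k) → z ∈ rootCells ρ B (j, k) := by
        refine eventually_all.2 fun k => ?_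
        filter_upwards [hroots.germGE_rootCells (hBle _ _ (hi₀ (some k))) k, hm k j]
          with z hz₁ hz₂ hz using hz₂ (hz₁ hz)
      filter_upwards [hk, hroots.eventually_subset (hBle _ _ hj₀)] with z hz hsub i hi
      have hle : rootCount ρ (B i₀) z ≤ rootCount ρ (B j) z :=
        hz ⟨rootCount ρ (B i₀) z, Nat.lt_succ_of_le (rootCount_le _ _ _)⟩
          (le_refl (rootCount ρ (B i₀) z))
      have heq := Set.eq_of_subset_of_ncard_le hsub hle (Set.toFinite _)
      exact (Set.ext_iff.1 heq i).2 hi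
    have hD : ∀ᶠ y in 𝓝 (0 : H × ℂ), y ∈ D ×ˢ Metric.ball (0 : ℂ) r :=
      (hroots.isOpen.prod Metric.isOpen_ball).eventually_mem
        ⟨hroots.zero_mem, Metric.mem_ball_self hroots.r_pos⟩
    have hfst : Tendsto Prod.fst (𝓝 (0 : H × ℂ)) (𝓝 (0 : H)) := continuous_fst.tendsto 0
    filter_upwards [hfst.eventually hcount, hD, hBle _ _ (hi₀ none)] with y hy hyD hy₁ hy₀
    obtain ⟨z, w⟩ := y
    have hyD' := Set.prod_mono subset_rfl Metric.ball_subset_closedBall hyD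
    obtain ⟨k, hk⟩ := (hroots.eq_zero_iff hyD'.1 hyD'.2).1 (hgZ _ (hDr hyD') (hy₁ hy₀))
    have := hy k
    simp only [hk] at this
    exact this hy₀

end LocalAnalytic

namespace LocalAnalytic

section

variable {E : Type*} [NormedAddCommGroup E] [NormedSpace ℂ E]

/-- `f` is holomorphic on `Z ∩ P`, in the sense of local extensions. -/
def HolAlong (Z P : Set E) (f : E → ℂ) : Prop :=
  ∀ y ∈ P, y ∈ Z → ∃ F, HolAt F y ∧ ∀ᶠ z in 𝓝 y, z ∈ Z → f z = F z

lemma HolAlong.anGerm_sep {M V : Set E} {f : E → ℂ} (hf : HolAlong M V f) (hV : (0 : E) ∈ V)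
    (h0 : (0 : E) ∈ M) (hM : AnGerm M) : AnGerm {y ∈ M | f y = 0} := by
  obtain ⟨F, hF, hFe⟩ := hf 0 hV h0
  obtain ⟨U, h0U, hU, 𝓕, h𝓕, hMU⟩ := hM
  obtain ⟨O, hO, hOo, h0O⟩ := eventually_nhds_iff.1
    (hF.eventually.and (hFe.and (hU.eventually_mem h0U)))
  refine ⟨O, h0O, hOo, insert F 𝓕, ?_, fun z hz => ?_⟩
  · rintro k (rfl | hk) y hy
    · exact (hO y hy).1
    · exact h𝓕 k hk y (hO y hy).2.2
  · obtain ⟨-, hfz, hzU⟩ := hO z hz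
    rw [mem_sep_iff, forall_mem_insert, ← hMU z hzU]
    constructor
    · rintro ⟨h1, h2⟩
      exact ⟨hfz h1 ▸ h2, h1⟩
    · rintro ⟨h1, h2⟩
      exact ⟨h2, (hfz h2).trans h1⟩

lemma AnGerm.sep_finset {ι : Type*} {M V : Set E} (hM : AnGerm M) (hV : (0 : E) ∈ V)
    (h0 : (0 : E) ∈ M) {f : ι → E → ℂ} (hf : ∀ i, HolAlong M V (f i)) (s : Finset ι) :
    AnGerm {y ∈ M | ∀ i ∈ s, f i y = 0} := by
  have := AnGerm.iInter (ι := Option s)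
    (Z := fun o => o.elim M fun i => {y ∈ M | f i y = 0}) (by
      rintro (_ | i)
      · exact hM
      · exact (hf i).anGerm_sep hV h0 hM)
  convert this using 1
  ext y
  simp only [mem_sep_iff, mem_iInter, Option.forall, Option.elim_none, Option.elim_some,
    Subtype.forall]
  exact ⟨fun h => ⟨h.1, fun i hi => ⟨h.1, h.2 i hi⟩⟩, fun h => ⟨h.1, fun i hi => (h.2 i hi).2⟩⟩

open Classical in
lemma HolAlong.stratHol {Z P : Set E} {f : E → ℂ} (hf : HolAlong Z P f) (c : ℂ) :
    StratHol (fun _ : Unit => Z) P (fun y => if y ∈ Z then f y else c) := by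
  intro y hy
  by_cases hyZ : y ∈ Z
  · obtain ⟨F, hF, hFe⟩ := hf y hy hyZ
    refine ⟨F, hF, hFe.mono fun z hz hc => ?_⟩
    have hzZ := (hc ()).2 hyZ
    simp only [if_pos hzZ, hz hzZ]
  · refine ⟨fun _ => c, HolAt.const c y, Eventually.of_forall fun z hc => ?_⟩
    exact if_neg fun hz => hyZ ((hc ()).1 hz)

end

variable {E : Type} [NormedAddCommGroup E] [NormedSpace ℂ E] [FiniteDimensional ℂ E]

/-- An analytic germ has arbitrarily small neighbourhoods of the origin on which the identity
theorem and the maximum principle at the origin hold. -/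
lemma AnGerm.exists_nhds {Z V : Set E} (hZ : AnGerm Z) (h0 : (0 : E) ∈ Z) (hV : V ∈ 𝓝 (0 : E)) :
    ∃ P ⊆ V, IsOpen P ∧ (0 : E) ∈ P ∧ ∀ f, HolAlong Z P f →
      ((∀ᶠ y in 𝓝 0, y ∈ Z → f y = 0) → ∀ y ∈ P, y ∈ Z → f y = 0) ∧
      ((∀ y ∈ P, y ∈ Z → ‖f y‖ ≤ 1) → f 0 = 1 → ∀ y ∈ P, y ∈ Z → f y = 1) := by
  classical
  obtain ⟨P, hPV, hP⟩ := exists_rigid (ι := Unit) (A := fun _ => Z) (fun _ => hZ) hV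
  refine ⟨P, hPV, hP.isOpen, hP.zero_mem, fun f hf => ⟨fun hf0 y hy hyZ => ?_,
    fun hb hf1 y hy hyZ => ?_⟩⟩
  · have := hP.eq_zero _ (hf.stratHol 0) (hf0.mono fun z hz => ?_) y hy
    · simpa only [if_pos hyZ] using this
    · split_ifs with hzZ
      · exact hz hzZ
      · rfl
  · have := hP.eq_one _ (hf.stratHol 1) (fun z hz => ?_) ?_ y hy
    · simpa only [if_pos hyZ] using this
    · split_ifs with hzZ
      · exact hb z hz hzZ
      · simp
    · obtain ⟨F, hF, hFe⟩ := hf 0 hP.zero_mem h0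
      have hF1 : Tendsto F (𝓝 0) (𝓝 1) := by
        rw [← hf1, hFe.self_of_nhds h0]
        exact hF.continuousAt
      intro N hN
      rw [mem_map]
      filter_upwards [hF1 hN, hFe] with z hzN hz
      rw [mem_preimage]
      split_ifs with hzZ
      · rw [hz hzZ]
        exact hzN
      · exact mem_of_mem_nhds hN

/-- The common zero locus of a possibly infinite family of holomorphic functions, defined on one
neighbourhood of the origin in an analytic germ, is an analytic germ. -/
lemma AnGerm.sep_forall {ι : Type*} {M V : Set E} (hM : AnGerm M) (hV : V ∈ 𝓝 (0 : E))
    (h0 : (0 : E) ∈ M) {f : ι → E → ℂ} (hf : ∀ i, HolAlong M V (f i)) (hf0 : ∀ i, f i 0 = 0) :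
    AnGerm {y ∈ M | ∀ i, f i y = 0} := by
  classical
  let Z : Finset ι → Set E := fun s => {y ∈ M | ∀ i ∈ s, f i y = 0}
  have hZ : ∀ s, AnGerm (Z s) := fun s => hM.sep_finset (mem_of_mem_nhds hV) h0 hf s
  have hmono : ∀ s t, s ⊆ t → GermGE (Z s) (Z t) := fun s t hst =>
    Eventually.of_forall fun z hz => ⟨hz.1, fun i hi => hz.2 i (hst hi)⟩
  obtain ⟨s, hs⟩ := exists_least_germ hZ fun s t =>
    ⟨s ∪ t, hmono _ _ Finset.subset_union_left, hmono _ _ Finset.subset_union_right⟩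
  obtain ⟨P, hPV, hPo, h0P, hP⟩ := (hZ s).exists_nhds ⟨h0, fun i _ => hf0 i⟩ hV
  have hzero : ∀ i, ∀ y ∈ P, y ∈ Z s → f i y = 0 := by
    intro i
    refine (hP (f i) fun y hy hyZ => ?_).1 ?_
    · obtain ⟨F, hF, hFe⟩ := hf i y (hPV hy) hyZ.1
      exact ⟨F, hF, hFe.mono fun z hz hzZ => hz hzZ.1⟩
    · filter_upwards [hs {i}] with z hz hzs
      exact (hz hzs).2 i (Finset.mem_singleton_self i)
  obtain ⟨U, h0U, hU, 𝓕, h𝓕, hZU⟩ := hZ s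
  refine ⟨U ∩ P, ⟨h0U, h0P⟩, hU.inter hPo, 𝓕, fun k hk y hy => h𝓕 k hk y hy.1, fun z hz => ?_⟩
  rw [← hZU z hz.1]
  exact ⟨fun h => ⟨h.1, fun i _ => h.2 i⟩, fun h => ⟨h.1, fun i => hzero i z hz.2 h⟩⟩

end LocalAnalytic

namespace LocalAnalytic

variable {X : Type} [TopologicalSpace X]

lemma HolAt.translate {E : Type*} [NormedAddCommGroup E] [NormedSpace ℂ E] {F : E → ℂ} {a u : E}
    (h : HolAt F (a + u)) : HolAt (fun u => F (a + u)) u :=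
  HolAt.comp_affine (ContinuousLinearMap.id ℂ E) a (by simpa using h)

/-- A chart centred at a point, with inverse `g`, phrased in terms of analytic germs. -/
lemma exists_chart (S : CStruct X) (q : X) :
    ∃ (n : ℕ) (M : Set (Fin n → ℂ)) (k : X → Fin n → ℂ) (g : (Fin n → ℂ) → X) (U : Set X),
      IsOpen U ∧ q ∈ U ∧ k q = 0 ∧ AnGerm M ∧ (∀ u ∈ M, g u ∈ U ∧ k (g u) = u) ∧
      (∀ y ∈ U, k y ∈ M ∧ g (k y) = y) ∧ ContinuousOn k U ∧
      ∀ W f, S.O.Holo W f → ∀ y ∈ U, y ∈ W → ∃ F, HolAt F (k y) ∧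
        ∀ᶠ u in 𝓝 (k y), u ∈ M → g u ∈ W ∧ f (g u) = F u := by
  obtain ⟨U, n, Ω, M, h, hU, hqU, hΩ, hM, hc, hinj, himg, -, hholo⟩ := S.locallyModel q
  have : Nonempty X := ⟨q⟩
  have hinv : ∀ y ∈ U, invFunOn h U (h q + (h y - h q)) = y := fun y hy => by
    rw [add_sub_cancel]
    exact hinj.leftInvOn_invFunOn hy
  refine ⟨n, {u | h q + u ∈ M}, fun y => h y - h q, fun u => invFunOn h U (h q + u), U, hU, hqU,
    sub_self _, ?_, fun u hu => ?_, fun y hy => ⟨?_, hinv y hy⟩, hc.sub continuousOn_const, ?_⟩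
  · have hqM : h q ∈ M := himg ▸ mem_image_of_mem h hqU
    obtain ⟨V, hV, hqV, -, F, hF, hMV⟩ := hM.2 _ (hM.1 hqM)
    refine ⟨(fun u => h q + u) ⁻¹' V, by simpa using hqV, hV.preimage (by fun_prop),
      (fun f u => f (h q + u)) '' F, ?_, fun u hu => ?_⟩
    · rintro _ ⟨f, hf, rfl⟩ y hy
      exact (HolAt.of_analyticAt (hF f hf _ hy)).translate
    · have := Set.ext_iff.1 hMV (h q + u)
      simp only [mem_inter_iff, mem_sep_iff, show h q + u ∈ V from hu, and_true, true_and] at this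
      simpa using this
  · have hu' : h q + u ∈ h '' U := himg ▸ hu
    exact ⟨invFunOn_mem hu', by simp only [invFunOn_eq hu', add_sub_cancel_left]⟩
  · change h q + (h y - h q) ∈ M
    rw [add_sub_cancel]
    exact himg ▸ mem_image_of_mem h hy
  · intro W f hf y hyU hyW
    have hWU := (S.O.isOpen_of_holo hf).inter hU
    obtain ⟨V, F, hV, hyV, -, hF, hVf⟩ := (hholo (W ∩ U) hWU inter_subset_right f).1
      (S.O.mono hf hWU inter_subset_left) y ⟨hyW, hyU⟩
    refine ⟨fun u => F (h q + u), HolAt.translate (HolAt.of_analyticAt ?_), ?_⟩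
    · rw [add_sub_cancel]
      exact hF _ hyV
    · have hcont : ContinuousAt (fun u => h q + u) (h y - h q) := by fun_prop
      have hyV' : h q + (h y - h q) ∈ V := by rwa [add_sub_cancel]
      filter_upwards [hcont.eventually (hV.eventually_mem hyV')] with u hu huM
      have hu' : h q + u ∈ h '' U := himg ▸ huM
      have heq := invFunOn_eq hu'
      obtain ⟨h1, h2⟩ := hVf _ (invFunOn_mem hu') (by rwa [heq])
      exact ⟨h1.1, by rw [h2, heq]⟩

/-- Points of an analytic subset have arbitrarily small neighbourhoods on which the identity
theorem and the maximum principle at the point hold. -/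
lemma exists_nhds_rigid (S : CStruct X) {A : Set X} (hA : S.IsAnalyticSubset A) {q : X}
    (hq : q ∈ A) {N : Set X} (hN : N ∈ 𝓝 q) :
    ∃ W ⊆ N, IsOpen W ∧ q ∈ W ∧ ∀ f, S.HoloOn (A ∩ W) f →
      ((∀ᶠ y in 𝓝 q, y ∈ A → f y = 0) → ∀ y ∈ A ∩ W, f y = 0) ∧
      ((∀ y ∈ A ∩ W, ‖f y‖ ≤ 1) → f q = 1 → ∀ y ∈ A ∩ W, f y = 1) := by
  obtain ⟨n, M, k, g, U, hU, hqU, hkq, hM, hgM, hkU, hkc, hext⟩ := exists_chart S q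
  obtain ⟨U', hU', hqU', 𝓕, h𝓕, hA𝓕⟩ := hA q
  have hgq : g 0 = q := hkq ▸ (hkU q hqU).2
  have hg_mem : ∀ O : Set X, O ∈ 𝓝 q → ∀ᶠ u in 𝓝 (0 : Fin n → ℂ), u ∈ M → g u ∈ O := by
    intro O hO
    obtain ⟨O', hO'O, hO', hqO'⟩ := mem_nhds_iff.1 hO
    obtain ⟨F, -, hF⟩ := hext O' _ (S.O.const_mem hO' 0) q hqU hqO'
    rw [hkq] at hF
    exact hF.mono fun u hu huM => hO'O (hu huM).1
  have hAmem : ∀ y ∈ U', y ∈ A ↔ ∀ f ∈ 𝓕, f y = 0 := fun y hy => by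
    have := Set.ext_iff.1 hA𝓕 y
    simpa [hy] using this
  have hV := hg_mem (N ∩ U') (inter_mem hN (hU'.mem_nhds hqU'))
  have h0M : (0 : Fin n → ℂ) ∈ M := hkq ▸ (hkU q hqU).1
  have hZ : AnGerm {u ∈ M | ∀ f : 𝓕, f.1 (g u) = 0} := by
    refine hM.sep_forall (f := fun (f : 𝓕) u => f.1 (g u)) hV h0M (fun f u hu huM => ?_)
      fun f => ?_
    · obtain ⟨F, hF, hFe⟩ := hext U' f.1 (h𝓕 _ f.2) (g u) (hgM u huM).1 (hu huM).2
      rw [(hgM u huM).2] at hF hFe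
      exact ⟨F, hF, hFe.mono fun z hz hzM => (hz hzM).2⟩
    · rw [hgq]
      exact (hAmem q hqU').1 hq f.1 f.2
  have h0Z : (0 : Fin n → ℂ) ∈ {u ∈ M | ∀ f : 𝓕, f.1 (g u) = 0} :=
    ⟨h0M, fun f => by rw [hgq]; exact (hAmem q hqU').1 hq f.1 f.2⟩
  obtain ⟨P, hPV, hPo, h0P, hP⟩ := hZ.exists_nhds h0Z hV
  have hPA : ∀ u ∈ P, u ∈ {u ∈ M | ∀ f : 𝓕, f.1 (g u) = 0} → g u ∈ A := fun u hu huZ =>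
    (hAmem _ (hPV hu huZ.1).2).2 fun f hf => huZ.2 ⟨f, hf⟩
  have hWN : ∀ y ∈ U ∩ k ⁻¹' P, y ∈ N ∩ U' := fun y hy => by
    have := hPV hy.2 (hkU y hy.1).1
    rwa [(hkU y hy.1).2] at this
  have hAZ : ∀ y ∈ A ∩ (U ∩ k ⁻¹' P), k y ∈ {u ∈ M | ∀ f : 𝓕, f.1 (g u) = 0} := fun y hy =>
    ⟨(hkU y hy.2.1).1, fun f => by
      rw [(hkU y hy.2.1).2]
      exact (hAmem y (hWN y hy.2).2).1 hy.1 f.1 f.2⟩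
  have hgW : ∀ u ∈ P, u ∈ M → g u ∈ U ∩ k ⁻¹' P := fun u hu huM =>
    ⟨(hgM u huM).1, by rwa [mem_preimage, (hgM u huM).2]⟩
  refine ⟨U ∩ k ⁻¹' P, fun y hy => (hWN y hy).1, hkc.isOpen_inter_preimage hU hPo,
    ⟨hqU, by rwa [mem_preimage, hkq]⟩, fun f hf => ?_⟩
  obtain ⟨hzero, hone⟩ := hP (fun u => f (g u)) fun u hu huZ => by
    obtain ⟨W, F₁, hW, hgu, hF₁, hfF₁⟩ := hf (g u) ⟨hPA u hu huZ, hgW u hu huZ.1⟩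
    obtain ⟨F, hF, hFe⟩ := hext W F₁ hF₁ (g u) (hgM u huZ.1).1 hgu
    rw [(hgM u huZ.1).2] at hF hFe
    refine ⟨F, hF, ?_⟩
    filter_upwards [hFe, hPo.eventually_mem hu] with z hz hzP hzZ
    rw [← (hz hzZ.1).2]
    exact hfF₁ _ ⟨(hz hzZ.1).1, hPA z hzP hzZ, hgW z hzP hzZ.1⟩
  have hback : ∀ c : ℂ, (∀ u ∈ P, u ∈ {u ∈ M | ∀ f : 𝓕, f.1 (g u) = 0} → f (g u) = c) →
      ∀ y ∈ A ∩ (U ∩ k ⁻¹' P), f y = c := fun c h y hy => by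
    have := h (k y) hy.2.2 (hAZ y hy)
    rwa [(hkU y hy.2.1).2] at this
  refine ⟨fun h => hback 0 (hzero ?_), fun hb h1 => hback 1 (hone ?_ ?_)⟩
  · filter_upwards [hg_mem _ h, hPo.eventually_mem h0P] with u hu huP huZ
    exact hu huZ.1 (hPA u huP huZ)
  · exact fun u hu huZ => hb _ ⟨hPA u hu huZ, hgW u hu huZ.1⟩
  · rw [hgq, h1]

end LocalAnalytic

namespace LocalAnalytic

variable {X : Type} [TopologicalSpace X]

lemma holo_univ_of_holoOn {S : CStruct X} {f : X → ℂ} (hf : S.HoloOn univ f) :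
    S.O.Holo univ f := by
  refine S.O.glue isOpen_univ fun y _ => ?_
  obtain ⟨W, F, -, hyW, hF, hfF⟩ := hf y (mem_univ y)
  exact ⟨W, hyW, subset_univ W, S.O.congr_holo hF fun z hz => (hfF z ⟨hz, mem_univ z⟩).symm⟩

lemma holoOn_of_holo_univ {S : CStruct X} {f : X → ℂ} (hf : S.O.Holo univ f) (A : Set X) :
    S.HoloOn A f :=
  fun y _ => ⟨univ, f, isOpen_univ, mem_univ y, hf, fun _ _ => rfl⟩

/-- The common level set through `x` of all global holomorphic functions. -/
def levelSet (S : CStruct X) (x : X) : Set X := {y | ∀ f, S.O.Holo univ f → f y = f x}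

lemma isCompact_levelSet {S : CStruct X} (hconv : S.HolConvex) (x : X) :
    IsCompact (levelSet S x) := by
  convert hconv {x} (subset_univ _) isCompact_singleton using 1
  ext y
  simp only [CStruct.hullIn, image_singleton, csSup_singleton, mem_univ, true_and, levelSet]
  refine ⟨fun h f hf => (congrArg norm (h f (holo_univ_of_holoOn hf))).le, fun h f hf => ?_⟩
  have := h _ (holoOn_of_holo_univ (S.O.add_mem hf (S.O.const_mem isOpen_univ (-f x))) _)
  simpa [← sub_eq_add_neg, sub_eq_zero] using this

lemma mem_levelSet_iff {S : CStruct X} {x y : X} :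
    y ∈ levelSet S x ↔ ∀ f ∈ {f | S.O.Holo univ f ∧ f x = 0}, f y = 0 := by
  refine ⟨fun h f hf => (h f hf.1).trans hf.2, fun h f hf => ?_⟩
  have := h (f + fun _ => -f x) ⟨S.O.add_mem hf (S.O.const_mem isOpen_univ _), by simp⟩
  simpa [← sub_eq_add_neg, sub_eq_zero] using this

lemma isAnalyticSubset_levelSet (S : CStruct X) (x : X) :
    S.IsAnalyticSubset (levelSet S x) := by
  refine fun y => ⟨univ, isOpen_univ, mem_univ y, {f | S.O.Holo univ f ∧ f x = 0},
    fun f hf => hf.1, ?_⟩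
  ext z
  simp [mem_levelSet_iff]

/-- Global holomorphic functions are constant on compact connected analytic subsets. -/
lemma subset_levelSet {S : CStruct X} {A : Set X} (hA : S.IsAnalyticSubset A) (hc : IsCompact A)
    (hconn : IsPreconnected A) {x : X} (hx : x ∈ A) : A ⊆ levelSet S x := by
  intro y hy f hf
  have hcont : Continuous f := continuousOn_univ.1 (S.O.continuousOn hf)
  obtain ⟨q, hq, hmax⟩ := hc.exists_isMaxOn ⟨x, hx⟩ hcont.norm.continuousOn
  have hle : ∀ z ∈ A, ‖f z‖ ≤ ‖f q‖ := fun z hz => hmax hz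
  by_cases hfq : f q = 0
  · have hz : ∀ z ∈ A, f z = 0 := fun z hz => by simpa [hfq] using hle z hz
    rw [hz y hy, hz x hx]
  have hloc : ∀ p ∈ A, ∀ᶠ z in 𝓝[A] p, (f p = f q ↔ f z = f q) := by
    intro p hp
    by_cases hpq : f p = f q
    · obtain ⟨W, -, hW, hpW, hr⟩ := exists_nhds_rigid S hA hp univ_mem
      have hone := (hr ((fun _ => (f q)⁻¹) * f)
        (holoOn_of_holo_univ (S.O.mul_mem (S.O.const_mem isOpen_univ _) hf) _)).2
        (fun z hz => ?_) (by simp [hpq, hfq])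
      · filter_upwards [self_mem_nhdsWithin, mem_nhdsWithin_of_mem_nhds (hW.mem_nhds hpW)]
          with z hzA hzW
        have := hone z ⟨hzA, hzW⟩
        simp only [Pi.mul_apply, inv_mul_eq_one₀ hfq] at this
        exact iff_of_true hpq this.symm
      · simp only [Pi.mul_apply, norm_mul, norm_inv]
        exact inv_mul_le_one_of_le₀ (hle z hz.1) (norm_nonneg _)
    · filter_upwards [mem_nhdsWithin_of_mem_nhds (hcont.continuousAt.eventually_ne hpq)] with z hz
      exact iff_of_false hpq hz
  have hiff : ∀ z ∈ A, f z = f q := fun z hz =>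
    (hconn.induction₂ (fun a b => (f a = f q ↔ f b = f q)) hloc
      (fun _ _ _ _ _ _ h₁ h₂ => h₁.trans h₂) (fun _ _ _ _ h => h.symm) hq hz).1 rfl
  rw [hiff y hy, hiff x hx]

/-- Connected components of compact analytic subsets are relatively open. -/
lemma exists_nhds_subset_connectedComponentIn {S : CStruct X} {F : Set X}
    (hF : S.IsAnalyticSubset F) (hc : IsCompact F) {x p : X}
    (hp : p ∈ connectedComponentIn F x) :
    ∃ W, IsOpen W ∧ p ∈ W ∧ F ∩ W ⊆ connectedComponentIn F x := by
  classical
  have := S.t2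
  have := isCompact_iff_compactSpace.1 hc
  have hpF : p ∈ F := connectedComponentIn_subset _ _ hp
  obtain ⟨W, -, hW, hpW, hr⟩ := exists_nhds_rigid S hF hpF univ_mem
  refine ⟨W, hW, hpW, fun y hy => ?_⟩
  rw [connectedComponentIn_eq hp, connectedComponentIn_eq_image hpF]
  refine ⟨⟨y, hy.1⟩, ?_, rfl⟩
  rw [connectedComponent_eq_iInter_isClopen, mem_iInter]
  rintro ⟨s, hs, hps⟩
  obtain ⟨O, hO, hOs⟩ := isOpen_induced_iff.1 hs.isOpen
  obtain ⟨O', hO', hOs'⟩ := isOpen_induced_iff.1 hs.compl.isOpen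
  have hmem : ∀ z (hz : z ∈ F), z ∈ O ↔ (⟨z, hz⟩ : F) ∈ s := fun z hz => by rw [← hOs]; rfl
  have hmem' : ∀ z (hz : z ∈ F), z ∈ O' ↔ (⟨z, hz⟩ : F) ∉ s := fun z hz => by
    rw [← mem_compl_iff, ← hOs']; rfl
  have hzero := (hr (fun z => if z ∈ O then 0 else 1) fun z hz => ?_).1 ?_ y hy
  · by_contra hn
    rw [if_neg (mt (hmem y hy.1).1 hn)] at hzero
    exact one_ne_zero hzero
  · by_cases hzs : (⟨z, hz.1⟩ : F) ∈ s
    · exact ⟨O, fun _ => 0, hO, (hmem z hz.1).2 hzs, S.O.const_mem hO 0,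
        fun a ha => if_pos ha.1⟩
    · refine ⟨O', fun _ => 1, hO', (hmem' z hz.1).2 hzs, S.O.const_mem hO' 1, fun a ha => ?_⟩
      exact if_neg (mt (hmem a ha.2.1).1 ((hmem' a ha.2.1).1 ha.1))
  · filter_upwards [hO.eventually_mem ((hmem p hpF).2 hps)] with z hz _
    exact if_pos hz

lemma isCompact_connectedComponentIn {F : Set X} (hc : IsCompact F) {x : X} (hx : x ∈ F) :
    IsCompact (connectedComponentIn F x) := by
  have := isCompact_iff_compactSpace.1 hc
  rw [connectedComponentIn_eq_image hx]
  exact isClosed_connectedComponent.isCompact.image continuous_subtype_val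

lemma isAnalyticSubset_connectedComponentIn {S : CStruct X} {x : X}
    (hc : IsCompact (levelSet S x)) (hx : x ∈ levelSet S x) :
    S.IsAnalyticSubset (connectedComponentIn (levelSet S x) x) := by
  have := S.t2
  intro p
  by_cases hp : p ∈ connectedComponentIn (levelSet S x) x
  · obtain ⟨W, hW, hpW, hsub⟩ :=
      exists_nhds_subset_connectedComponentIn (isAnalyticSubset_levelSet S x) hc hp
    refine ⟨W, hW, hpW, {f | S.O.Holo univ f ∧ f x = 0},
      fun f hf => S.O.mono hf.1 hW (subset_univ W), ?_⟩
    ext z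
    rw [mem_sep_iff, ← mem_levelSet_iff]
    exact ⟨fun h => ⟨h.2, connectedComponentIn_subset _ _ h.1⟩, fun h => ⟨hsub ⟨h.2, h.1⟩, h.1⟩⟩
  · have hop := (isCompact_connectedComponentIn hc hx).isClosed.isOpen_compl
    refine ⟨_, hop, hp, {fun _ => 1}, fun f hf => ?_, ?_⟩
    · rw [mem_singleton_iff.1 hf]
      exact S.O.const_mem hop 1
    · ext z
      simp

lemma Sx_eq_connectedComponentIn {S : CStruct X} {x : X} (hc : IsCompact (levelSet S x)) :
    S.Sx x = connectedComponentIn (levelSet S x) x := by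
  have hx : x ∈ levelSet S x := fun _ _ => rfl
  apply subset_antisymm
  · refine sUnion_subset ?_
    rintro A ⟨hA, hAc, hconn, hxA⟩
    exact hconn.isPreconnected.subset_connectedComponentIn hxA
      (subset_levelSet hA hAc hconn.isPreconnected hxA)
  · exact subset_sUnion_of_mem ⟨isAnalyticSubset_connectedComponentIn hc hx,
      isCompact_connectedComponentIn hc hx, isConnected_connectedComponentIn_iff.2 hx,
      mem_connectedComponentIn hx⟩

end LocalAnalytic

/-- If `X` is a holomorphically convex complex analytic space,
then for every `x ∈ X` the union `S_x` of all compact connected complex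
analytic subsets of `X` containing `x` is compact. -/
theorem Sx_compact
    {X : Type} [TopologicalSpace X] (S : CStruct X)
    (hconv : S.HolConvex) (x : X) :
    IsCompact (S.Sx x) := by
  have hc := LocalAnalytic.isCompact_levelSet hconv x
  rw [LocalAnalytic.Sx_eq_connectedComponentIn hc]
  exact LocalAnalytic.isCompact_connectedComponentIn hc fun _ _ => rfl
end
end

section
/- Let X be a holomorphically convex complex analytic space and define the relation R on X by x R x' if and only if S_x ∩ S_{x'} ≠ ∅. Then R is a proper relation: for every compact set K ⋐ X, the saturation K' = ⋃_{x ∈ K} S_x is relatively compact in X. -/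
/-!
Preliminary definitions.

We model a (reduced) complex analytic space as a Hausdorff topological space
equipped with a sheaf of continuous ℂ-valued functions (its holomorphic
functions) which is locally isomorphic to the canonical model: an analytic
subset `A` of an open set `Ω ⊆ ℂⁿ`, with the sheaf of functions that locally
extend to holomorphic functions of the ambient ℂⁿ.
-/

open Set Topology Filter Function

noncomputable section

/-- A set of complex numbers all but countably many of whose points are interior. -/
def AlmostOpen (s : Set ℂ) : Prop := (s \ interior s).Countable

theorem AlmostOpen.biUnion {ι : Type*} {I : Set ι} (hI : I.Countable) {s : ι → Set ℂ}
    (hs : ∀ i ∈ I, AlmostOpen (s i)) : AlmostOpen (⋃ i ∈ I, s i) := by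
  refine (hI.biUnion hs).mono ?_
  rintro z ⟨hz, hz'⟩
  obtain ⟨i, hi, hzi⟩ := mem_iUnion₂.1 hz
  exact mem_iUnion₂.2 ⟨i, hi, hzi, fun h => hz' (interior_mono (subset_biUnion_of_mem hi) h)⟩

theorem AlmostOpen.iUnion {ι : Type*} [Countable ι] {s : ι → Set ℂ}
    (hs : ∀ i, AlmostOpen (s i)) : AlmostOpen (⋃ i, s i) := by
  simpa using AlmostOpen.biUnion (countable_univ (α := ι)) fun i _ => hs i

theorem AlmostOpen.of_isOpen {s : Set ℂ} (hs : IsOpen s) : AlmostOpen s := by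
  simp [AlmostOpen, hs.interior_eq]

theorem AlmostOpen.of_countable {s : Set ℂ} (hs : s.Countable) : AlmostOpen s :=
  hs.mono sdiff_subset

/-- An image is almost open if it is so locally, in the sense that each point of `B ⊆ A` has, within
`B`, a neighbourhood contained in a subset of `A` with almost open image. -/
theorem exists_almostOpen_image_of_nhdsWithin {E : Type*} [TopologicalSpace E]
    [SecondCountableTopology E] {f : E → ℂ} {A B : Set E}
    (h : ∀ b ∈ B, ∃ T ∈ 𝓝[B] b, T ⊆ A ∧ AlmostOpen (f '' T)) :
    ∃ T, B ⊆ T ∧ T ⊆ A ∧ AlmostOpen (f '' T) := by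
  choose! T hT hTA hTf using h
  obtain ⟨I, hIB, hI, hcov⟩ := TopologicalSpace.countable_cover_nhdsWithin hT
  refine ⟨⋃ b ∈ I, T b, hcov, iUnion₂_subset fun b hb => hTA b (hIB hb), ?_⟩
  rw [image_iUnion₂]
  exact AlmostOpen.biUnion hI fun b hb => hTf b (hIB hb)

/-- A compact connected almost open set of complex numbers has at most one point. -/
theorem AlmostOpen.subsingleton {C : Set ℂ} (h : AlmostOpen C) (hC : IsCompact C)
    (hconn : IsPreconnected C) : C.Subsingleton := by
  intro p hp q hq
  by_contra hpq
  set u : ℂ := starRingEnd ℂ (q - p) with hu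
  have hu0 : u ≠ 0 := (map_ne_zero _).2 (sub_ne_zero.2 fun h => hpq h.symm)
  have hL : Continuous fun z : ℂ => (u * z).re := by fun_prop
  have hM : Continuous fun z : ℂ => (u * z).im := by fun_prop
  have hlt : (u * p).re < (u * q).re := by
    have h1 : u * q - u * p = (Complex.normSq (q - p) : ℂ) := by
      rw [← mul_sub, hu, mul_comm, Complex.mul_conj]
    have h2 : (u * q).re - (u * p).re = Complex.normSq (q - p) := by
      rw [← Complex.sub_re, h1, Complex.ofReal_re]
    have h3 : 0 < Complex.normSq (q - p) :=
      Complex.normSq_pos.2 (sub_ne_zero.2 fun h => hpq h.symm)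
    linarith
  have hsub : Icc (u * p).re (u * q).re ⊆ (fun z : ℂ => (u * z).re) '' (C \ interior C) := by
    intro s hs
    obtain ⟨z₀, hz₀, hz₀s⟩ := hconn.intermediate_value hp hq hL.continuousOn hs
    have hcomp : IsCompact (C ∩ {z | (u * z).re = s}) :=
      hC.inter_right (isClosed_eq hL continuous_const)
    obtain ⟨z, ⟨hzC, hzs⟩, hmax⟩ := hcomp.exists_isMaxOn ⟨z₀, hz₀, hz₀s⟩ hM.continuousOn
    refine ⟨z, ⟨hzC, fun hint => ?_⟩, hzs⟩
    have hpath : Tendsto (fun δ : ℝ => z + δ * (Complex.I * starRingEnd ℂ u)) (𝓝[>] 0) (𝓝 z) := by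
      have : Continuous fun δ : ℝ => z + δ * (Complex.I * starRingEnd ℂ u) := by fun_prop
      simpa using (this.tendsto 0).mono_left nhdsWithin_le_nhds
    obtain ⟨δ, hδC, hδ⟩ :=
      ((hpath.eventually (mem_interior_iff_mem_nhds.1 hint)).and self_mem_nhdsWithin).exists
    have key : u * (z + δ * (Complex.I * starRingEnd ℂ u)) =
        u * z + ((δ * Complex.normSq u : ℝ) : ℂ) * Complex.I := by
      rw [Complex.ofReal_mul, ← Complex.mul_conj]; ring
    have h1 : (u * (z + δ * (Complex.I * starRingEnd ℂ u))).re = s := by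
      rw [key]; simpa using hzs
    have h2 := hmax (show _ ∈ C ∩ {z | (u * z).re = s} from ⟨hδC, h1⟩)
    simp only [mem_ofPred_eq, key] at h2
    have h3 : 0 < δ * Complex.normSq u := mul_pos hδ (Complex.normSq_pos.2 hu0)
    simp only [Complex.add_im, Complex.im_ofReal_mul, Complex.I_im] at h2
    linarith
  have hcount : (Icc (u * p).re (u * q).re).Countable := (h.image _).mono hsub
  have := hcount.measure_zero MeasureTheory.volume
  rw [Real.volume_Icc, ENNReal.ofReal_eq_zero] at this
  linarith

section LocalTheory

variable {E : Type} [NormedAddCommGroup E] [NormedSpace ℂ E]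

/-- The derivative of `g` in the direction `e`. -/
def dirDeriv (e : E) (g : E → ℂ) (z : E) : ℂ := fderiv ℂ g z e

theorem AnalyticAt.dirDeriv {g : E → ℂ} {z : E} (hg : AnalyticAt ℂ g z) (e : E) :
    AnalyticAt ℂ (dirDeriv e g) z :=
  ((ContinuousLinearMap.apply ℂ ℂ e).analyticAt _).comp hg.fderiv

theorem AnalyticAt.iterate_dirDeriv {g : E → ℂ} {z : E} (hg : AnalyticAt ℂ g z) (e : E) (k : ℕ) :
    AnalyticAt ℂ ((_root_.dirDeriv e)^[k] g) z := by
  induction k with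
  | zero => exact hg
  | succ k ih => rw [iterate_succ_apply']; exact ih.dirDeriv e

theorem iterate_deriv_comp_line {g : E → ℂ} {a : E} (hg : AnalyticAt ℂ g a) (e : E) (k : ℕ) :
    deriv^[k] (fun t : ℂ => g (a + t • e)) =ᶠ[𝓝 0]
      fun t => (dirDeriv e)^[k] g (a + t • e) := by
  induction k with
  | zero => rfl
  | succ k ih =>
    rw [iterate_succ_apply', iterate_succ_apply']
    refine ih.deriv.trans ?_
    have hcont : Tendsto (fun t : ℂ => a + t • e) (𝓝 0) (𝓝 a) := by
      have : Continuous fun t : ℂ => a + t • e := by fun_prop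
      simpa using this.tendsto 0
    filter_upwards [hcont.eventually (hg.iterate_dirDeriv e k).eventually_analyticAt] with t ht
    have hline : HasDerivAt (fun t : ℂ => a + t • e) e t := by
      simpa using ((hasDerivAt_id t).smul_const e).const_add a
    exact (ht.differentiableAt.hasFDerivAt.comp_hasDerivAt t hline).deriv

/-- An analytic function all of whose directional derivatives vanish at `a` vanishes near `a`. -/
theorem eventually_eq_zero_of_iterate_dirDeriv {g : E → ℂ} {a : E} (hg : AnalyticAt ℂ g a)
    (h : ∀ (e : E) (k : ℕ), (dirDeriv e)^[k] g a = 0) : ∀ᶠ z in 𝓝 a, g z = 0 := by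
  obtain ⟨r, hr, hball⟩ := Metric.isOpen_iff.1 (isOpen_analyticAt ℂ g) a hg
  filter_upwards [Metric.ball_mem_nhds a hr] with z hz
  rcases eq_or_ne z a with rfl | hza
  · exact h 0 0
  set e := z - a with he
  have he0 : 0 < ‖e‖ := norm_pos_iff.2 (sub_ne_zero.2 hza)
  have her : ‖e‖ < r := by rwa [he, ← dist_eq_norm]
  have hline : AnalyticOnNhd ℂ (fun t : ℂ => g (a + t • e)) (Metric.ball 0 (r / ‖e‖)) := by
    intro t ht
    have hmem : AnalyticAt ℂ g (a + t • e) := hball <| by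
      rw [mem_ball_zero_iff, lt_div_iff₀ he0] at ht
      simpa [norm_smul] using ht
    exact hmem.comp (f := fun t : ℂ => a + t • e) (by fun_prop)
  have h0 : (0 : ℂ) ∈ Metric.ball (0 : ℂ) (r / ‖e‖) := Metric.mem_ball_self (by positivity)
  have hzero : (fun t : ℂ => g (a + t • e)) =ᶠ[𝓝 0] 0 := by
    have hps := (hline 0 h0).hasFPowerSeriesAt
    have hcoef : (fun n : ℕ => iteratedDeriv n (fun t : ℂ => g (a + t • e)) 0 / n.factorial) =
        fun _ => 0 := by
      funext n
      rw [iteratedDeriv_eq_iterate, (iterate_deriv_comp_line hg e n).self_of_nhds]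
      simp [h e n]
    rw [hcoef] at hps
    have hser : FormalMultilinearSeries.ofScalars ℂ (fun _ : ℕ => (0 : ℂ)) = 0 := by
      ext n; simp
    rw [hser] at hps
    exact hps.eventually_eq_zero
  have := hline.eqOn_zero_of_preconnected_of_eventuallyEq_zero
    (convex_ball _ _).isPreconnected h0 hzero
    (show (1 : ℂ) ∈ Metric.ball (0 : ℂ) (r / ‖e‖) by
      rw [mem_ball_zero_iff, norm_one, lt_div_iff₀ he0]; simpa using her)
  simpa [he] using this


/-- Every point of `U` has a neighbourhood in which `Z` is the common zero set of a family of
analytic functions. -/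
def IsLocallyZeroSet (U Z : Set E) : Prop :=
  ∀ a ∈ U, ∃ V, IsOpen V ∧ a ∈ V ∧ ∃ F : Set (E → ℂ), (∀ f ∈ F, AnalyticOnNhd ℂ f V) ∧
    ∀ w ∈ V, w ∈ Z ↔ ∀ f ∈ F, f w = 0

theorem IsLocallyZeroSet.exists_ball {U Z : Set E} (hZ : IsLocallyZeroSet U Z) {a : E}
    (ha : a ∈ U) : ∃ r > 0, ∃ F : Set (E → ℂ), (∀ f ∈ F, AnalyticOnNhd ℂ f (Metric.ball a r)) ∧
      ∀ w ∈ Metric.ball a r, w ∈ Z ↔ ∀ f ∈ F, f w = 0 := by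
  obtain ⟨V, hV, haV, F, hF, hFZ⟩ := hZ a ha
  obtain ⟨r, hr, hrV⟩ := Metric.isOpen_iff.1 hV a haV
  exact ⟨r, hr, F, fun f hf => (hF f hf).mono hrV, fun w hw => hFZ w (hrV hw)⟩

theorem IsLocallyZeroSet.preimage {E' : Type} [NormedAddCommGroup E'] [NormedSpace ℂ E']
    {U Z : Set E} (hZ : IsLocallyZeroSet U Z) {V : Set E'} {φ : E' → E} (hV : IsOpen V)
    (hφ : AnalyticOnNhd ℂ φ V) (hVU : MapsTo φ V U) : IsLocallyZeroSet V (φ ⁻¹' Z) := by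
  intro y hy
  obtain ⟨W, hW, hyW, F, hF, hFZ⟩ := hZ (φ y) (hVU hy)
  refine ⟨V ∩ φ ⁻¹' W, hφ.continuousOn.isOpen_inter_preimage hV hW, ⟨hy, hyW⟩,
    (· ∘ φ) '' F, ?_, fun w hw => ?_⟩
  · rintro _ ⟨f, hf, rfl⟩ w hw
    exact (hF f hf _ hw.2).comp (hφ w hw.1)
  · rw [mem_preimage, hFZ _ hw.2, forall_mem_image]
    rfl

/-- Identity theorem: a locally analytic set containing a nonempty open subset of a connected open
set contains all of it. -/
theorem IsLocallyZeroSet.subset_of_mem_nhds {U Z : Set E} (hZ : IsLocallyZeroSet U Z)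
    (hU : IsPreconnected U) {a : E} (ha : a ∈ U) (haZ : Z ∈ 𝓝 a) : U ⊆ Z := by
  refine Subset.trans (hU.subset_of_closure_inter_subset isOpen_interior
    ⟨a, ha, mem_interior_iff_mem_nhds.2 haZ⟩ ?_) interior_subset
  rintro b ⟨hbZ, hbU⟩
  obtain ⟨r, hr, F, hF, hFZ⟩ := hZ.exists_ball hbU
  obtain ⟨c, hcr, hcZ⟩ := mem_closure_iff.1 hbZ _ Metric.isOpen_ball (Metric.mem_ball_self hr)
  refine mem_interior_iff_mem_nhds.2 (mem_of_superset (Metric.ball_mem_nhds b hr) fun w hw => ?_)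
  refine (hFZ w hw).2 fun f hf => ?_
  refine (hF f hf).eqOn_zero_of_preconnected_of_eventuallyEq_zero
    (convex_ball b r).isPreconnected hcr ?_ hw
  filter_upwards [mem_interior_iff_mem_nhds.1 hcZ, Metric.isOpen_ball.mem_nhds hcr] with z hz hzr
  exact (hFZ z hzr).1 hz f hf

theorem IsLocallyZeroSet.exists_analytic_vanishing {U Z : Set E} (hZ : IsLocallyZeroSet U Z) {a : E}
    (ha : a ∈ U) (haZ : Z ∉ 𝓝 a) : ∃ (V : Set E) (g : E → ℂ), IsOpen V ∧ a ∈ V ∧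
      AnalyticOnNhd ℂ g V ∧ (∀ w ∈ V ∩ Z, g w = 0) ∧ ¬ ∀ᶠ z in 𝓝 a, g z = 0 := by
  obtain ⟨r, hr, F, hF, hFZ⟩ := hZ.exists_ball ha
  by_contra! hcon
  refine haZ (mem_of_superset (Metric.ball_mem_nhds a hr) fun w hw => (hFZ w hw).2 fun f hf => ?_)
  exact (hF f hf).eqOn_zero_of_preconnected_of_eventuallyEq_zero
    (convex_ball a r).isPreconnected (Metric.mem_ball_self hr)
    (hcon _ f Metric.isOpen_ball (Metric.mem_ball_self hr) (hF f hf)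
      fun z hz => (hFZ z hz.1).1 hz.2 f hf) hw

/-- A smooth analytic hypersurface is locally the image of an analytic map defined on an open subset
of its tangent space. -/
theorem exists_hypersurface_parametrization [FiniteDimensional ℂ E] {q : E → ℂ} {b : E}
    (hq : AnalyticAt ℂ q b) (hqb : q b = 0) (hd : fderiv ℂ q b ≠ 0) {W : Set E} (hW : W ∈ 𝓝 b) :
    ∃ (V : Set (fderiv ℂ q b).ker) (φ : (fderiv ℂ q b).ker → E), IsOpen V ∧
      AnalyticOnNhd ℂ φ V ∧ MapsTo φ V W ∧ ∀ᶠ z in 𝓝 b, q z = 0 → z ∈ φ '' V := by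
  have : CompleteSpace E := FiniteDimensional.complete ℂ E
  set L := fderiv ℂ q b with hL
  have hrange : L.range = ⊤ :=
    LinearMap.range_eq_top.2 (LinearMap.surjective (f := L.toLinearMap)
      fun h => hd (ContinuousLinearMap.coe_injective h))
  have hker : L.ker.ClosedComplemented := Submodule.ClosedComplemented.of_finiteDimensional _
  let Φ := HasStrictFDerivAt.implicitFunctionDataOfComplemented q L hq.hasStrictFDerivAt hrange hker
  have hright : AnalyticAt ℂ Φ.rightFun b :=
    (ContinuousLinearMap.analyticAt _ _).comp (analyticAt_id.sub analyticAt_const)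
  have hΦ : AnalyticAt ℂ (uncurry Φ.implicitFunction) (q b, Φ.rightFun b) :=
    (ImplicitFunctionData.contDiffAt_implicitFunction (φ := Φ) (n := ⊤) hq.contDiffAt
      hright.contDiffAt (by simp)).analyticAt
  let φ : L.ker → E := Φ.implicitFunction 0
  have hφ : AnalyticAt ℂ φ (Φ.rightFun b) := by
    rw [hqb] at hΦ
    exact hΦ.comp (f := fun y => ((0 : ℂ), y)) (analyticAt_const.prod analyticAt_id)
  have hinv : ∀ᶠ z in 𝓝 b, Φ.implicitFunction (q z) (Φ.rightFun z) = z :=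
    Φ.implicitFunction_apply_image
  have hφb : φ (Φ.rightFun b) = b := by
    have := hinv.self_of_nhds
    rwa [hqb] at this
  have hnear : ∀ᶠ y in 𝓝 (Φ.rightFun b), AnalyticAt ℂ φ y ∧ φ y ∈ W :=
    hφ.eventually_analyticAt.and (hφ.continuousAt.eventually (by rwa [hφb]))
  obtain ⟨V, hV, hVo, hbV⟩ := eventually_nhds_iff.1 hnear
  refine ⟨V, φ, hVo, fun y hy => (hV y hy).1, fun y hy => (hV y hy).2, ?_⟩
  filter_upwards [hinv, hright.continuousAt.eventually (hVo.mem_nhds hbV)] with z hz hzV hqz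
  exact ⟨Φ.rightFun z, hzV, by rwa [hqz] at hz⟩

/-- The image under an analytic function of an intersection of locally analytic sets is
almost open. -/
theorem almostOpen_image_inter_sInter [FiniteDimensional ℂ E] {U : Set E} {f : E → ℂ}
    {𝒵 : Set (Set E)} (hU : IsOpen U) (hf : AnalyticOnNhd ℂ f U)
    (h𝒵 : ∀ Z ∈ 𝒵, IsLocallyZeroSet U Z) : AlmostOpen (f '' (U ∩ ⋂₀ 𝒵)) := by
  induction hn : Module.finrank ℂ E using Nat.strong_induction_on generalizing E with
  | _ n ih =>
  have : ProperSpace E := FiniteDimensional.proper ℂ E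
  set A := U ∩ ⋂₀ 𝒵 with hA
  suffices h : ∀ a ∈ A, ∃ T ∈ 𝓝[A] a, T ⊆ A ∧ AlmostOpen (f '' T) by
    obtain ⟨T, hAT, hTA, hT⟩ := exists_almostOpen_image_of_nhdsWithin h
    rwa [hAT.antisymm hTA]
  rintro a ⟨haU, ha𝒵⟩
  by_cases hopen : ∀ Z ∈ 𝒵, Z ∈ 𝓝 a
  · obtain ⟨r, hr, hrU⟩ := Metric.isOpen_iff.1 hU a haU
    have hconn : IsPreconnected (Metric.ball a r) := (convex_ball a r).isPreconnected
    refine ⟨Metric.ball a r, mem_nhdsWithin_of_mem_nhds (Metric.ball_mem_nhds a hr),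
      subset_inter hrU (subset_sInter fun Z hZ => ?_), ?_⟩
    · exact IsLocallyZeroSet.subset_of_mem_nhds (fun b hb => h𝒵 Z hZ b (hrU hb)) hconn
        (Metric.mem_ball_self hr) (hopen Z hZ)
    · rcases (hf.mono hrU).is_constant_or_isOpen hconn with ⟨w, hw⟩ | h
      · refine .of_countable ((countable_singleton w).mono ?_)
        rintro _ ⟨z, hz, rfl⟩
        exact hw z hz
      · exact .of_isOpen (h _ Subset.rfl Metric.isOpen_ball)
  · push Not at hopen
    obtain ⟨Z, hZ, haZ⟩ := hopen
    obtain ⟨V, g, hV, haV, hg, hgZ, hg0⟩ := (h𝒵 Z hZ).exists_analytic_vanishing haU haZ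
    obtain ⟨e, k, hk⟩ : ∃ (e : E) (k : ℕ), (dirDeriv e)^[k] g a ≠ 0 := by
      by_contra! h
      exact hg0 (eventually_eq_zero_of_iterate_dirDeriv (hg a haV) h)
    have hgA : ∀ z ∈ A ∩ V, g z = 0 := fun z hz => hgZ z ⟨hz.2, hz.1.2 Z hZ⟩
    let B : ℕ → Set E := fun j =>
      {z ∈ A ∩ V | (dirDeriv e)^[j] g z = 0 ∧ (dirDeriv e)^[j + 1] g z ≠ 0}
    have hB : ∀ j, ∃ T, B j ⊆ T ∧ T ⊆ A ∧ AlmostOpen (f '' T) := by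
      intro j
      refine exists_almostOpen_image_of_nhdsWithin ?_
      rintro b ⟨⟨hbA, hbV⟩, hqb, hdb⟩
      have hq := (hg b hbV).iterate_dirDeriv e j
      rw [iterate_succ_apply'] at hdb
      have hd : fderiv ℂ ((dirDeriv e)^[j] g) b ≠ 0 := fun h => hdb (by simp [dirDeriv, h])
      obtain ⟨V', φ, hV', hφ, hφU, hcov⟩ :=
        exists_hypersurface_parametrization hq hqb hd (hU.mem_nhds hbA.1)
      have hfin : Module.finrank ℂ (fderiv ℂ ((dirDeriv e)^[j] g) b).ker < n := by
        rw [← hn]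
        refine Submodule.finrank_lt fun h => hd ?_
        exact ContinuousLinearMap.coe_injective (LinearMap.ker_eq_top.1 h)
      have hsmall := ih _ hfin hV' (hf.comp hφ hφU) (𝒵 := (φ ⁻¹' ·) '' 𝒵)
        (forall_mem_image.2 fun Z hZ => (h𝒵 Z hZ).preimage hV' hφ hφU) rfl
      refine ⟨φ '' (V' ∩ ⋂₀ ((φ ⁻¹' ·) '' 𝒵)), ?_, ?_, by rwa [← image_comp]⟩
      · filter_upwards [nhdsWithin_le_nhds hcov, self_mem_nhdsWithin] with z hz hzB
        obtain ⟨y, hy, rfl⟩ := hz hzB.2.1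
        exact ⟨y, ⟨hy, by simpa using fun Z hZ => hzB.1.1.2 Z hZ⟩, rfl⟩
      · rintro _ ⟨y, ⟨hy, hy𝒵⟩, rfl⟩
        exact ⟨hφU hy, fun Z hZ => hy𝒵 _ (mem_image_of_mem _ hZ)⟩
    choose T hBT hTA hT using hB
    refine ⟨⋃ j, T j, ?_, iUnion_subset hTA, by rw [image_iUnion]; exact AlmostOpen.iUnion hT⟩
    have hne := ((hg a haV).iterate_dirDeriv e k).continuousAt.eventually_ne hk
    filter_upwards [nhdsWithin_le_nhds hne, nhdsWithin_le_nhds (hV.mem_nhds haV),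
      self_mem_nhdsWithin] with z hz hzV hzA
    have hstep : ∃ j, (dirDeriv e)^[j] g z = 0 ∧ (dirDeriv e)^[j + 1] g z ≠ 0 := by
      by_contra! h
      exact hz (Nat.rec (hgA z ⟨hzA, hzV⟩) h k)
    obtain ⟨j, hj⟩ := hstep
    exact mem_iUnion.2 ⟨j, hBT j ⟨⟨hzA, hzV⟩, hj⟩⟩

end LocalTheory

namespace CStruct

variable {X : Type} [TopologicalSpace X]

theorem HoloOn.continuous {S : CStruct X} {f : X → ℂ} (hf : S.HoloOn univ f) : Continuous f := by
  refine continuous_iff_continuousAt.2 fun x => ?_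
  obtain ⟨W, F, hW, hxW, hF, hfF⟩ := hf x (mem_univ x)
  refine ((S.O.continuousOn hF).continuousAt (hW.mem_nhds hxW)).congr ?_
  filter_upwards [hW.mem_nhds hxW] with y hy
  exact (hfF y ⟨hy, mem_univ y⟩).symm

theorem exists_almostOpen_image_inter {S : CStruct X} {f : X → ℂ} (hf : S.HoloOn univ f)
    {A : Set X} (hA : S.IsAnalyticSubset A) (x : X) :
    ∃ N ∈ 𝓝 x, AlmostOpen (f '' (A ∩ N)) := by
  obtain ⟨U, n, Ω, A₀, h, hU, hxU, -, ⟨-, hA₀⟩, hh, hinj, himg, hopen, hholo⟩ := S.locallyModel x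
  obtain ⟨U₁, hU₁, hxU₁, F, hF, hFA⟩ := hA x
  obtain ⟨W, f₀, hW, hxW, hf₀, hff₀⟩ := hf x (mem_univ x)
  have hfW : S.O.Holo (W ∩ U) f :=
    S.O.congr_holo (S.O.mono hf₀ (hW.inter hU) inter_subset_left)
      fun y hy => (hff₀ y ⟨hy.1, mem_univ y⟩).symm
  obtain ⟨Vf, f₁, hVf, hxVf, hVfΩ, hf₁, hff₁⟩ :=
    (hholo _ (hW.inter hU) inter_subset_right f).1 hfW x ⟨hxW, hxU⟩
  obtain ⟨V₁, hV₁, hUV₁⟩ := (hopen (U ∩ U₁) inter_subset_left).1 (hU.inter hU₁)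
  have hV₁U₁ : ∀ y ∈ U, h y ∈ V₁ → y ∈ U₁ := fun y hy hyV =>
    (hUV₁.ge ⟨hy, hyV⟩ : y ∈ U ∩ U₁).2
  have hxV₁ : h x ∈ V₁ := (hUV₁.le ⟨hxU, hxU₁⟩ : x ∈ U ∩ h ⁻¹' V₁).2
  have hVV : IsOpen (Vf ∩ V₁) := hVf.inter hV₁
  let Zf : (X → ℂ) → Set (Fin n → ℂ) := fun φ => h '' {y ∈ U | φ y = 0}
  have hZA₀ : IsLocallyZeroSet (Vf ∩ V₁) A₀ := by
    intro z hz
    obtain ⟨V, hV, hzV, -, G, hG, hGA⟩ := hA₀ z (hVfΩ hz.1)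
    exact ⟨V, hV, hzV, G, hG, fun w hw => ⟨fun hwA => (hGA.le ⟨hwA, hw⟩).2,
      fun hwG => (hGA.ge ⟨hw, hwG⟩).1⟩⟩
  have hZf : ∀ φ ∈ F, IsLocallyZeroSet (Vf ∩ V₁) (Zf φ) := by
    intro φ hφ z hz
    obtain ⟨V, hV, hzV, G, hG, hGA⟩ := hZA₀ z hz
    by_cases hzA : z ∈ A₀
    · obtain ⟨y, hy, rfl⟩ := himg.ge hzA
      obtain ⟨Vφ, φ₁, hVφ, hyVφ, -, hφ₁, hφφ₁⟩ :=
        (hholo _ (hU.inter hU₁) inter_subset_left φ).1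
          (S.O.mono (hF φ hφ) (hU.inter hU₁) inter_subset_right) y ⟨hy, hV₁U₁ y hy hz.2⟩
      refine ⟨V ∩ Vφ, hV.inter hVφ, ⟨hzV, hyVφ⟩, insert φ₁ G, ?_, fun w hw => ?_⟩
      · rintro g (rfl | hg)
        · exact hφ₁.mono inter_subset_right
        · exact (hG g hg).mono inter_subset_left
      · rw [forall_mem_insert, ← hGA w hw.1]
        constructor
        · rintro ⟨u, ⟨hu, hφu⟩, rfl⟩
          exact ⟨(hφφ₁ u hu hw.2).2.symm.trans hφu, himg.le (mem_image_of_mem h hu)⟩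
        · rintro ⟨hw₁, hwA⟩
          obtain ⟨u, hu, rfl⟩ := himg.ge hwA
          exact ⟨u, ⟨hu, (hφφ₁ u hu hw.2).2.trans hw₁⟩, rfl⟩
    · obtain ⟨g, hg, hgz⟩ : ∃ g ∈ G, g z ≠ 0 := by
        by_contra! hcon
        exact hzA ((hGA z hzV).2 hcon)
      refine ⟨V ∩ g ⁻¹' {0}ᶜ, (hG g hg).continuousOn.isOpen_inter_preimage hV
        isOpen_compl_singleton, ⟨hzV, hgz⟩, {fun _ => 1}, ?_, fun w hw => ?_⟩
      · rintro _ rfl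
        exact analyticOnNhd_const
      · refine ⟨?_, fun hw₁ => absurd (hw₁ _ rfl) one_ne_zero⟩
        rintro ⟨u, ⟨hu, -⟩, rfl⟩
        exact absurd ((hGA _ hw.1).1 (himg.le (mem_image_of_mem h hu)) g hg) hw.2
  have hsmall := almostOpen_image_inter_sInter (𝒵 := insert A₀ (Zf '' F)) hVV
    (hf₁.mono inter_subset_left) (forall_mem_insert.2 ⟨hZA₀, forall_mem_image.2 hZf⟩)
  refine ⟨U ∩ h ⁻¹' (Vf ∩ V₁),
    (hh.isOpen_inter_preimage hU hVV).mem_nhds ⟨hxU, hxVf, hxV₁⟩, ?_⟩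
  convert hsmall using 1
  refine Subset.antisymm ?_ ?_
  · rintro _ ⟨y, ⟨hyA, hyU, hyV⟩, rfl⟩
    have hyF := (hFA.le ⟨hyA, hV₁U₁ y hyU hyV.2⟩).2
    refine ⟨h y, ⟨hyV, ?_⟩, (hff₁ y hyU hyV.1).2.symm⟩
    rw [sInter_insert, sInter_image]
    exact ⟨himg.le (mem_image_of_mem h hyU),
      mem_iInter₂.2 fun φ hφ => ⟨y, ⟨hyU, hyF φ hφ⟩, rfl⟩⟩
  · rintro _ ⟨w, ⟨hwV, hw⟩, rfl⟩
    rw [sInter_insert, sInter_image] at hw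
    obtain ⟨y, hyU, rfl⟩ := himg.ge hw.1
    refine ⟨y, ⟨(hFA.ge ⟨hV₁U₁ y hyU hwV.2, fun φ hφ => ?_⟩).1, hyU, hwV⟩, (hff₁ y hyU hwV.1).2⟩
    obtain ⟨u, ⟨hu, hφu⟩, huy⟩ := mem_iInter₂.1 hw.2 φ hφ
    rwa [← hinj hu hyU huy]

/-- Global holomorphic functions are constant on compact connected analytic subsets. -/
theorem HoloOn.subsingleton_image {S : CStruct X} {f : X → ℂ} (hf : S.HoloOn univ f)
    {A : Set X} (hA : S.IsAnalyticSubset A) (hcomp : IsCompact A) (hconn : IsConnected A) :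
    (f '' A).Subsingleton := by
  refine AlmostOpen.subsingleton ?_ (hcomp.image hf.continuous)
    (hconn.isPreconnected.image f hf.continuous.continuousOn)
  choose N hN hsmall using exists_almostOpen_image_inter hf hA
  obtain ⟨I, -, hcov⟩ := hcomp.elim_nhds_subcover N fun x _ => hN x
  have hAI : A = ⋃ x ∈ (I : Set X), A ∩ N x := by
    rw [← inter_iUnion₂]
    exact (inter_eq_left.2 hcov).symm
  rw [hAI, image_iUnion₂]
  exact AlmostOpen.biUnion I.countable_toSet fun x _ => hsmall x

theorem Sx_subset_hullIn (S : CStruct X) {K : Set X} (hK : IsCompact K) {x : X} (hx : x ∈ K) :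
    S.Sx x ⊆ S.hullIn univ K := by
  rintro y ⟨A, ⟨hA, hcomp, hconn, hxA⟩, hyA⟩
  refine ⟨mem_univ y, fun f hf => ?_⟩
  rw [hf.subsingleton_image hA hcomp hconn (mem_image_of_mem f hyA) (mem_image_of_mem f hxA)]
  exact le_csSup (hK.image hf.continuous.norm).bddAbove (mem_image_of_mem (fun y => ‖f y‖) hx)

end CStruct

/-- If `X` is holomorphically convex, the relation
`x R x' ↔ S_x ∩ S_{x'} ≠ ∅` is proper: for every compact `K ⋐ X`, the
saturation `K' = ⋃_{x ∈ K} S_x` is relatively compact in `X`. -/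
theorem Rrel_proper
    {X : Type} [TopologicalSpace X] (S : CStruct X)
    (hconv : S.HolConvex) (K : Set X) (hK : IsCompact K) :
    IsCompact (closure (⋃ x ∈ K, S.Sx x)) := by
  have := S.t2
  exact (hconv K (subset_univ K) hK).closure_of_subset
    (iUnion₂_subset fun x hx => S.Sx_subset_hullIn hK hx)
end
end

section
/- (Universal property of the Remmert reduction) Let X be a holomorphically convex complex analytic space with Remmert reduction (π, Y), let S be a Stein space, and let f: X → S be a holomorphic map. Then there exists a holomorphic map g: Y → S such that g ∘ π = f. -/
/-!
Preliminary definitions.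

We model a (reduced) complex analytic space as a Hausdorff topological space
equipped with a sheaf of continuous ℂ-valued functions (its holomorphic
functions) which is locally isomorphic to the canonical model: an analytic
subset `A` of an open set `Ω ⊆ ℂⁿ`, with the sheaf of functions that locally
extend to holomorphic functions of the ambient ℂⁿ.
-/

open Set Topology Filter Function

noncomputable section

namespace CStruct

variable {X : Type} [TopologicalSpace X]

/-- On an open set, `HoloOn` coincides with the sections of the structure sheaf. -/
theorem holoOn_iff (S : CStruct X) {A : Set X} (hA : IsOpen A) {f : X → ℂ} :
    S.HoloOn A f ↔ S.O.Holo A f := by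
  refine ⟨fun h => S.O.glue hA fun x hx => ?_, fun h x hx =>
    ⟨A, f, hA, hx, h, fun _ _ => rfl⟩⟩
  obtain ⟨W, F, hW, hxW, hF, hfF⟩ := h x hx
  exact ⟨W ∩ A, ⟨hxW, hx⟩, inter_subset_right,
    S.O.congr_holo (S.O.mono hF (hW.inter hA) inter_subset_left) fun y hy => (hfF y hy).symm⟩

end CStruct

/-- Every point of an open set `Ω ⊆ ℂⁿ` has a ball whose closure meets a given analytic subset
of `Ω` in a compact set. -/
theorem IsAnalyticInCn.exists_isCompact_inter_closedBall {n : ℕ} {Ω A : Set (Fin n → ℂ)}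
    (hA : IsAnalyticInCn Ω A) {z : Fin n → ℂ} (hz : z ∈ Ω) :
    ∃ r > 0, IsCompact (A ∩ Metric.closedBall z r) := by
  obtain ⟨V, hV, hzV, -, F, hF, hAV⟩ := hA.2 z hz
  obtain ⟨r, hr, hrV⟩ := Metric.nhds_basis_closedBall.mem_iff.1 (hV.mem_nhds hzV)
  refine ⟨r, hr, ?_⟩
  have hzero : A ∩ Metric.closedBall z r =
      Metric.closedBall z r ∩ ⋂ f ∈ F, Metric.closedBall z r ∩ f ⁻¹' {0} := by
    ext w
    have hw : w ∈ Metric.closedBall z r → (w ∈ A ↔ ∀ f ∈ F, f w = 0) := fun hw => by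
      have := Set.ext_iff.1 hAV w
      simpa [hrV hw] using this
    simp only [mem_inter_iff, mem_iInter, mem_preimage, mem_singleton_iff]
    constructor
    · rintro ⟨h₁, h₂⟩
      exact ⟨h₂, fun f hf => ⟨h₂, (hw h₂).1 h₁ f hf⟩⟩
    · rintro ⟨h₁, h₂⟩
      exact ⟨(hw h₁).2 fun f hf => (h₂ f hf).2, h₁⟩
  rw [hzero]
  refine (isCompact_closedBall z r).inter_right (isClosed_biInter fun f hf => ?_)
  exact ((hF f hf).continuousOn.mono hrV).preimage_isClosed_of_isClosed
    Metric.isClosed_closedBall isClosed_singleton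

namespace CStruct

variable {X Y : Type} [TopologicalSpace X] [TopologicalSpace Y]

theorem weaklyLocallyCompactSpace (S : CStruct X) : WeaklyLocallyCompactSpace X := by
  refine ⟨fun x => ?_⟩
  obtain ⟨U, n, Ω, A, h, hU, hxU, -, hA, -, -, himg, htop, -⟩ := S.locallyModel x
  have hind : IsInducing (U.domRestrict h) := by
    refine ⟨TopologicalSpace.ext_iff.2 fun s => ?_⟩
    rw [hU.isOpenEmbedding_subtypeVal.isOpen_iff_image_isOpen, htop _ (by simp),
      isOpen_induced_iff]
    refine exists_congr fun V => and_congr_right fun _ => ?_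
    rw [← Subtype.image_preimage_coe, Subtype.val_injective.image_injective.eq_iff, eq_comm]
    rfl
  obtain ⟨r, hr, hK⟩ := hA.exists_isCompact_inter_closedBall
    (hA.1 (himg ▸ mem_image_of_mem h hxU))
  refine ⟨Subtype.val '' (U.domRestrict h ⁻¹' Metric.closedBall (h x) r), ?_, ?_⟩
  · refine IsCompact.image ?_ continuous_subtype_val
    rwa [hind.isCompact_iff, image_preimage_eq_inter_range, range_domRestrict, himg, inter_comm]
  · have hopen : IsOpen (U ∩ h ⁻¹' Metric.ball (h x) r) :=
      (htop _ inter_subset_left).2 ⟨_, Metric.isOpen_ball, rfl⟩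
    refine mem_of_superset (hopen.mem_nhds ⟨hxU, Metric.mem_ball_self hr⟩) ?_
    rintro y ⟨hyU, hy⟩
    exact ⟨⟨y, hyU⟩, Metric.ball_subset_closedBall hy, rfl⟩

theorem IsRemmertReduction.isProperMap {S : CStruct X} {T : CStruct Y} {π : X → Y}
    (h : S.IsRemmertReduction T π) : IsProperMap π := by
  have := T.t2
  have := T.weaklyLocallyCompactSpace
  refine isProperMap_iff_isCompact_preimage.2 ⟨continuousOn_univ.1 h.2.1.1, fun K hK => ?_⟩
  simpa using h.2.2.1 K hK

/-- On the complement of the (closed) image of a Remmert reduction, the functions `0` and `1` have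
the same pullback, so that this complement is empty. -/
theorem IsRemmertReduction.surjective {S : CStruct X} {T : CStruct Y} {π : X → Y}
    (h : S.IsRemmertReduction T π) : Surjective π := by
  intro y
  by_contra hy
  have hU : IsOpen (range π)ᶜ := h.isProperMap.isClosedMap.isClosed_range.isOpen_compl
  exact zero_ne_one ((h.2.2.2 _ hU).1 _ _ (T.O.const_mem hU 0) (T.O.const_mem hU 1)
    (fun x hx => (hx.2 (mem_range_self x)).elim) y hy)

/-- A holomorphic map from `X` to a space with point-separating global functions is constant on
the fibres of a Remmert reduction of `X`. -/
theorem IsRemmertReduction.factorsThrough {Z : Type} [TopologicalSpace Z] {S : CStruct X}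
    {T : CStruct Y} {R : CStruct Z} {π : X → Y} (h : S.IsRemmertReduction T π)
    (hR : R.SeparatesOn univ) {f : X → Z} (hf : S.IsHoloMap R f) : f.FactorsThrough π := by
  intro x x' hxx'
  by_contra hne
  obtain ⟨u, hu, hux⟩ := hR _ (mem_univ (f x)) _ (mem_univ (f x')) hne
  obtain ⟨v, -, hv⟩ := (h.2.2.2 univ isOpen_univ).2 (u ∘ f)
    (hf.2 univ u isOpen_univ ((R.holoOn_iff isOpen_univ).1 hu))
  apply hux
  have hx := hv x ⟨mem_univ _, mem_univ _⟩
  have hx' := hv x' ⟨mem_univ _, mem_univ _⟩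
  simp only [comp_apply] at hx hx'
  rw [hx, hx', hxx']

end CStruct

/-- Universal property of the Remmert reduction.  Let `X` be a
holomorphically convex complex space with Remmert reduction `(π, Y)`, let `S` be
a Stein space and `f : X → S` a holomorphic map.  Then there is a holomorphic
map `g : Y → S` with `g ∘ π = f`. -/
theorem remmert_reduction_universal_property
    {X Y Z : Type} [TopologicalSpace X] [TopologicalSpace Y] [TopologicalSpace Z]
    (SX : CStruct X) (SY : CStruct Y) (SZ : CStruct Z)
    (hconv : SX.HolConvex)
    (π : X → Y) (hred : SX.IsRemmertReduction SY π)
    (hStein : SZ.Stein)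
    (f : X → Z) (hf : SX.IsHoloMap SZ f) :
    ∃ g : Y → Z, SY.IsHoloMap SZ g ∧ ∀ x : X, g (π x) = f x := by
  obtain ⟨g, hg⟩ : ∃ g : Y → Z, g ∘ π = f :=
    ⟨f ∘ surjInv hred.surjective, funext fun x =>
      hred.factorsThrough hStein.2 hf (surjInv_eq hred.surjective (π x))⟩
  subst hg
  have hquot : IsQuotientMap π :=
    hred.isProperMap.isClosedMap.isQuotientMap hred.isProperMap.continuous hred.surjective
  have hcont : Continuous g := hquot.continuous_iff.2 (continuousOn_univ.1 hf.1)
  refine ⟨g, ⟨hcont.continuousOn, fun U u hU hu => ?_⟩, fun _ => rfl⟩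
  rw [univ_inter]
  have hgU : IsOpen (g ⁻¹' U) := hU.preimage hcont
  obtain ⟨v, hv, huv⟩ := (hred.2.2.2 _ hgU).2 _ (hf.2 U u hU hu)
  refine (SY.holoOn_iff hgU).2 (SY.O.congr_holo hv fun y hy => ?_)
  obtain ⟨x, rfl⟩ := hred.surjective y
  exact (huv x ⟨mem_univ _, hy⟩).symm
end
end
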